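/- Let ε > 0 be a constant. Consider the random graph process {G_i} on n vertices and let m_2 = min{m : δ(G_m) ≥ 2} be the step at which the last vertex of degree at most one disappears. Then asymptotically almost surely G_{m_2} is (1/2 − ε)-resilient with respect to being Hamiltonian. -/

import Mathlib

open MeasureTheory Filter ENNReal

namespace RGP

noncomputable section

variable {V : Type*}

/-- The degree of a vertex. -/
def deg (G : SimpleGraph V) (v : V) : ℕ := (G.neighborSet v).ncard

/-- `N^ℓ_G(v)`: vertices at distance at most `ℓ` from `v`, excluding `v`. -/
def nbhd (G : SimpleGraph V) (ℓ : ℕ) (v : V) : Set V :=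
  {u | u ≠ v ∧ ∃ p : G.Walk v u, p.length ≤ ℓ}

/-- `TINY_{p,δ}(G)`. -/
def TINY (G : SimpleGraph V) (p δ : ℝ) : Set V :=
  {v | (deg G v : ℝ) < δ * (Nat.card V) * p}

/-- `ATYP_{p,δ}(G)`. -/
def ATYP (G : SimpleGraph V) (p δ : ℝ) : Set V :=
  {v | (deg G v : ℝ) < (1 - δ) * (Nat.card V) * p ∨ (1 + δ) * (Nat.card V) * p < (deg G v : ℝ)}

/-- Edge density `|E| / C(n,2)`. -/
def density (G : SimpleGraph V) : ℝ :=
  (G.edgeSet.ncard : ℝ) / ((Nat.card V).choose 2 : ℕ)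

/-- A matching covering all but at most one vertex. -/
def HasNearPerfectMatching (G : SimpleGraph V) : Prop :=
  ∃ M : G.Subgraph, M.IsMatching ∧ (M.vertsᶜ).ncard ≤ 1

/-- Hamiltonicity (for finite vertex types). -/
def IsHam [Finite V] (G : SimpleGraph V) : Prop :=
  letI := Classical.decEq V; letI := Fintype.ofFinite V; G.IsHamiltonian

/-- `α`-resilience with respect to a property `P`. -/
def Resilient (G : SimpleGraph V) (α : ℝ) (P : SimpleGraph V → Prop) : Prop :=
  ∀ H : SimpleGraph V, H ≤ G → (∀ v, (deg H v : ℝ) ≤ α * (deg G v : ℝ)) → P (G \ H)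

/-- `(α, δt, Kt, δa, Ka)`-resilience with respect to a property `P`. -/
def StrongResilient (G : SimpleGraph V) (α δt : ℝ) (Kt : ℕ) (δa : ℝ) (Ka : ℕ)
    (P : SimpleGraph V → Prop) : Prop :=
  ∀ H : SimpleGraph V, H ≤ G →
    (∀ v ∈ TINY G (density G) δt, (deg H v : ℝ) ≤ (deg G v : ℝ) - Kt) →
    (∀ v, v ∈ ATYP G (density G) δa → v ∉ TINY G (density G) δt →
      (deg H v : ℝ) ≤ (deg G v : ℝ) - Ka) →
    (∀ v, v ∉ TINY G (density G) δt → v ∉ ATYP G (density G) δa →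
      (deg H v : ℝ) ≤ α * (deg G v : ℝ)) →
    P (G \ H)

/-! ### The random graph process -/

/-- Potential edges of the complete graph on `Fin n`. -/
abbrev EdgeType (n : ℕ) := {e : Sym2 (Fin n) // ¬ e.IsDiag}

/-- A sample point of the random graph process: a uniformly random ordering of the edges. -/
abbrev ProcessSpace (n : ℕ) := Fin (Fintype.card (EdgeType n)) ≃ EdgeType n

instance (n : ℕ) : MeasurableSpace (ProcessSpace n) := ⊤

/-- The uniform measure on orderings of the edges of `K_n`. -/
def processMeasure (n : ℕ) : Measure (ProcessSpace n) :=
  (Fintype.card (ProcessSpace n) : ℝ≥0∞)⁻¹ • Measure.sum (fun σ => Measure.dirac σ)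

/-- The graph `G_m` of the process: the first `m` edges in the random ordering. -/
def processGraph {n : ℕ} (σ : ProcessSpace n) (m : ℕ) : SimpleGraph (Fin n) :=
  SimpleGraph.fromEdgeSet {e | ∃ i : Fin (Fintype.card (EdgeType n)), (i : ℕ) < m ∧ (σ i : Sym2 (Fin n)) = e}

/-! ### The binomial random graph G(n,p) -/

abbrev GnpSpace (n : ℕ) := EdgeType n → Bool

/-- The Bernoulli product weight of an outcome. -/
def gnpWeight {n : ℕ} (p : ℝ) (ω : GnpSpace n) : ℝ≥0∞ :=
  ∏ e : EdgeType n, (if ω e then ENNReal.ofReal p else ENNReal.ofReal (1 - p))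

/-- The `G(n,p)` probability measure. -/
def gnp (n : ℕ) (p : ℝ) : Measure (GnpSpace n) :=
  Measure.sum (fun ω => gnpWeight p ω • Measure.dirac ω)

/-- The graph determined by an outcome of `G(n,p)`. -/
def gnpGraph {n : ℕ} (ω : GnpSpace n) : SimpleGraph (Fin n) :=
  SimpleGraph.fromEdgeSet {e | ∃ h : ¬ e.IsDiag, ω ⟨e, h⟩ = true}

/-- Joint distribution of two independent binomial random graphs. -/
def gnp2 (n : ℕ) (p₀ p' : ℝ) : Measure (GnpSpace n × GnpSpace n) :=
  Measure.sum (fun ω : GnpSpace n × GnpSpace n =>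
    (gnpWeight p₀ ω.1 * gnpWeight p' ω.2) • Measure.dirac ω)

/-! ### The 2-core -/

/-- The vertex set of the 2-core: the largest set every vertex of which has
at least two neighbours inside the set. -/
def coreSet (G : SimpleGraph V) : Set V :=
  ⋃₀ {S : Set V | ∀ v ∈ S, 2 ≤ ((G.neighborSet v) ∩ S).ncard}

/-- The 2-core of a graph, as a graph on the corresponding vertex subset. -/
def twoCore (G : SimpleGraph V) : SimpleGraph (coreSet G) := G.induce (coreSet G)

/-! ### Longest paths and rotations -/

open Classical in
/-- The neighbours of `v`, as a finset. -/
def nb [Fintype V] (G : SimpleGraph V) (v : V) : Finset V := Finset.univ.filter (G.Adj v)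

open Classical in
/-- The external neighbourhood of a set of vertices. -/
def bdry [Fintype V] (G : SimpleGraph V) (X : Finset V) : Finset V :=
  Finset.univ.filter (fun v => v ∉ X ∧ ∃ x ∈ X, G.Adj x v)

@[simp] lemma mem_nb [Fintype V] {G : SimpleGraph V} {u v : V} : u ∈ nb G v ↔ G.Adj v u := by
  simp [nb]

@[simp] lemma mem_bdry [Fintype V] {G : SimpleGraph V} {X : Finset V} {v : V} :
    v ∈ bdry G X ↔ v ∉ X ∧ ∃ x ∈ X, G.Adj x v := by
  simp [bdry]

lemma deg_eq_card_nb [Fintype V] (G : SimpleGraph V) (v : V) : deg G v = (nb G v).card := by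
  rw [deg, ← Set.ncard_coe_finset]
  congr 1
  ext u
  simp

lemma nb_mono [Fintype V] {G H : SimpleGraph V} (h : G ≤ H) (v : V) : nb G v ⊆ nb H v := by
  intro u hu
  simp only [mem_nb] at hu ⊢
  exact h hu

/-- A path, represented by the list of its vertices. -/
def IsPathList (G : SimpleGraph V) (l : List V) : Prop := l.IsChain G.Adj ∧ l.Nodup

/-- The largest number of vertices of a path. -/
def maxLen (G : SimpleGraph V) : ℕ := sSup {k | ∃ l, IsPathList G l ∧ l.length = k}

lemma bddAbove_pathLengths [Fintype V] (G : SimpleGraph V) :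
    BddAbove {k | ∃ l, IsPathList G l ∧ l.length = k} :=
  ⟨Fintype.card V, by rintro k ⟨l, hl, rfl⟩; exact hl.2.length_le_card⟩

lemma IsPathList.length_le [Fintype V] {G : SimpleGraph V} {l : List V} (h : IsPathList G l) :
    l.length ≤ maxLen G :=
  le_csSup (bddAbove_pathLengths G) ⟨l, h, rfl⟩

lemma exists_isPathList_maxLen [Fintype V] (G : SimpleGraph V) :
    ∃ l, IsPathList G l ∧ l.length = maxLen G :=
  have hne : {k | ∃ l, IsPathList G l ∧ l.length = k}.Nonempty :=
    ⟨0, [], ⟨List.IsChain.nil, List.nodup_nil⟩, rfl⟩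
  Nat.sSup_mem hne (bddAbove_pathLengths G)

lemma IsPathList.mono {G H : SimpleGraph V} (h : G ≤ H) {l : List V} (hl : IsPathList G l) :
    IsPathList H l :=
  ⟨hl.1.imp fun _ _ hab => h hab, hl.2⟩

lemma maxLen_eq [Fintype V] {G H : SimpleGraph V} (h : G ≤ H) {l : List V} (hl : IsPathList G l)
    (hlen : l.length = maxLen H) : maxLen G = maxLen H := by
  apply le_antisymm
  · obtain ⟨l', hl', hlen'⟩ := exists_isPathList_maxLen G
    rw [← hlen']
    exact (hl'.mono h).length_le
  · rw [← hlen]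
    exact hl.length_le

/-- `l` is a longest path of `G`, from `a` to `b`. -/
def EndPath (G : SimpleGraph V) (a b : V) (l : List V) : Prop :=
  IsPathList G l ∧ l.head? = some a ∧ l.getLast? = some b ∧ l.length = maxLen G

open Classical in
/-- The other endpoints of the longest paths starting at `a`. -/
def ends [Fintype V] (G : SimpleGraph V) (a : V) : Finset V :=
  Finset.univ.filter fun b => ∃ l, EndPath G a b l

@[simp] lemma mem_ends [Fintype V] {G : SimpleGraph V} {a b : V} :
    b ∈ ends G a ↔ ∃ l, EndPath G a b l := by
  simp [ends]

lemma EndPath.reverse {G : SimpleGraph V} {a b : V} {l : List V} (h : EndPath G a b l) :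
    EndPath G b a l.reverse := by
  obtain ⟨⟨h1, h2⟩, h3, h4, h5⟩ := h
  refine ⟨⟨?_, by simpa using h2⟩, by simpa using h4, by simpa using h3, by simpa using h5⟩
  rw [List.isChain_reverse]
  exact h1.imp fun _ _ hab => hab.symm

lemma mem_ends_comm [Fintype V] {G : SimpleGraph V} {a b : V} : b ∈ ends G a ↔ a ∈ ends G b := by
  simp only [mem_ends]
  exact ⟨fun ⟨l, h⟩ => ⟨_, h.reverse⟩, fun ⟨l, h⟩ => ⟨_, h.reverse⟩⟩

/-- A neighbour of the last vertex of a longest path lies on the path. -/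
lemma EndPath.mem_of_adj [Fintype V] {G : SimpleGraph V} {a b v : V} {l : List V}
    (h : EndPath G a b l) (hv : G.Adj b v) : v ∈ l := by
  by_contra hvl
  obtain ⟨⟨h1, h2⟩, h3, h4, h5⟩ := h
  have : IsPathList G (l ++ [v]) := by
    refine ⟨?_, ?_⟩
    · rw [List.isChain_append]
      refine ⟨h1, List.isChain_singleton _, ?_⟩
      intro x hx y hy
      simp_all
    · rw [List.nodup_append]
      refine ⟨h2, by simp, ?_⟩
      intro x hx y hy hxy
      simp at hy
      subst hy
      exact hvl (hxy ▸ hx)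
  have := this.length_le
  simp at this
  omega

lemma isChain_rotate {R : V → V → Prop} (hR : ∀ x y, R x y → R y x) {l1 l2 : List V} {w b : V}
    (h : (l1 ++ w :: l2).IsChain R) (hb : l2.getLast? = some b) (hwb : R w b) :
    (l1 ++ w :: l2.reverse).IsChain R := by
  have h' : ((l1 ++ [w]) ++ l2).IsChain R := by simpa using h
  have : ((l1 ++ [w]) ++ l2.reverse).IsChain R := by
    rw [List.isChain_append] at h' ⊢
    refine ⟨h'.1, ?_, ?_⟩
    · rw [List.isChain_reverse]
      exact h'.2.1.imp fun x y hxy => hR _ _ hxy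
    · intro x hx y hy
      simp only [List.getLast?_append, List.getLast?_singleton, Option.some_or,
        Option.mem_def, Option.some.injEq, List.head?_reverse] at hx hy
      rw [hb] at hy
      cases hy
      subst hx
      exact hwb
  simpa using this

/-- Lists obtained from a path by rotations that fix its first vertex. -/
inductive Rot (G : SimpleGraph V) (l0 : List V) : List V → Prop
  | refl : Rot G l0 l0
  | step {l1 l2 : List V} {w b : V} (h : Rot G l0 (l1 ++ w :: l2)) (hb : l2.getLast? = some b)
      (hwb : G.Adj w b) : Rot G l0 (l1 ++ w :: l2.reverse)

lemma Rot.endPath {G : SimpleGraph V} {l0 l : List V} {a b0 : V} (h0 : EndPath G a b0 l0)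
    (h : Rot G l0 l) : ∃ b, EndPath G a b l := by
  induction h with
  | refl => exact ⟨b0, h0⟩
  | @step l1 l2 w b h hb hwb ih =>
    obtain ⟨c, ⟨h1, h2⟩, h3, h4, h5⟩ := ih
    have hne : l2.reverse ≠ [] := by
      intro hh
      simp at hh
      simp [hh] at hb
    have hp : (l1 ++ w :: l2.reverse).Perm (l1 ++ w :: l2) :=
      List.Perm.append_left _ ((List.reverse_perm l2).cons w)
    refine ⟨l2.head (by simpa using hne), ⟨isChain_rotate (fun _ _ h => h.symm) h1 hb hwb, ?_⟩,
      ?_, ?_, ?_⟩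
    · exact hp.nodup_iff.mpr h2
    · cases l1 <;> simpa using h3
    · rw [List.getLast?_append_of_ne_nil _ (by simp)]
      cases l2 with
      | nil => simp at hne
      | cons x t => simp [List.getLast?_cons]
    · rw [← h5]
      exact hp.length_eq

lemma card_consecutive_lt [DecidableEq V] (l : List V) (hl : l.Nodup) (S T : Finset V) (b : V)
    (hb : l.getLast? = some b) (hbS : b ∈ S)
    (hT : ∀ v ∈ T, ∃ s ∈ S, ∃ i, (l[i]? = some s ∧ l[i+1]? = some v) ∨
      (l[i]? = some v ∧ l[i+1]? = some s)) : T.card < 2 * S.card := by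
  have hsub : T ⊆ (S.erase b).image (fun s => l.getD (l.idxOf s + 1) b) ∪
      S.image (fun s => l.getD (l.idxOf s - 1) b) := by
    intro v hv
    obtain ⟨s, hs, i, h | h⟩ := hT v hv
    · obtain ⟨h1, h2⟩ := h
      have hi := List.getElem?_eq_some_iff.mp h1
      obtain ⟨hi1, hi2⟩ := hi
      have hidx : l.idxOf s = i := by rw [← hi2]; exact hl.idxOf_getElem i hi1
      rw [Finset.mem_union]
      left
      rw [Finset.mem_image]
      refine ⟨s, ?_, ?_⟩
      · rw [Finset.mem_erase]
        refine ⟨?_, hs⟩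
        rintro rfl
        rw [List.getLast?_eq_getElem?] at hb
        obtain ⟨hj1, hj2⟩ := List.getElem?_eq_some_iff.mp hb
        have := hl.idxOf_getElem (l.length - 1) hj1
        rw [hj2, hidx] at this
        obtain ⟨hk1, _⟩ := List.getElem?_eq_some_iff.mp h2
        omega
      · rw [List.getD_eq_getElem?_getD, hidx, h2]
        rfl
    · obtain ⟨h1, h2⟩ := h
      obtain ⟨hi1, hi2⟩ := List.getElem?_eq_some_iff.mp h2
      have hidx : l.idxOf s = i + 1 := by rw [← hi2]; exact hl.idxOf_getElem (i + 1) hi1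
      rw [Finset.mem_union]
      right
      rw [Finset.mem_image]
      refine ⟨s, hs, ?_⟩
      rw [List.getD_eq_getElem?_getD, hidx, Nat.add_sub_cancel, h1]
      rfl
  have h1 := Finset.card_le_card hsub
  have h2 := Finset.card_union_le ((S.erase b).image (fun s => l.getD (l.idxOf s + 1) b))
    (S.image (fun s => l.getD (l.idxOf s - 1) b))
  have h3 := Finset.card_image_le (s := S.erase b) (f := fun s => l.getD (l.idxOf s + 1) b)
  have h4 := Finset.card_image_le (s := S) (f := fun s => l.getD (l.idxOf s - 1) b)
  have h5 := Finset.card_erase_lt_of_mem hbS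
  omega

/-- Pósa's rotation lemma. -/
theorem lt_card_ends [Fintype V] {G : SimpleGraph V} {k : ℕ}
    (hexp : ∀ X : Finset V, X.card ≤ k → 2 * X.card ≤ (bdry G X).card)
    {a b0 : V} {l0 : List V} (h0 : EndPath G a b0 l0) : k < (ends G a).card := by
  classical
  set S : Finset V := Finset.univ.filter fun b => ∃ l, Rot G l0 l ∧ l.getLast? = some b with hS
  have hSe : S ⊆ ends G a := by
    intro b hb
    rw [hS, Finset.mem_filter] at hb
    obtain ⟨-, l, hl, hlb⟩ := hb
    obtain ⟨c, hc⟩ := hl.endPath h0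
    have : b = c := by
      have := hc.2.2.1
      rw [hlb] at this
      exact Option.some.inj this
    subst this
    exact mem_ends.mpr ⟨l, hc⟩
  have hb0 : b0 ∈ S := by
    rw [hS, Finset.mem_filter]
    exact ⟨Finset.mem_univ _, l0, Rot.refl, h0.2.2.1⟩
  let K : V → V → Prop := fun x y => ∃ i, (l0[i]? = some x ∧ l0[i+1]? = some y) ∨
      (l0[i]? = some y ∧ l0[i+1]? = some x)
  have hKs : ∀ x y, K x y → K y x := fun x y ⟨i, h⟩ => ⟨i, h.symm⟩
  let C : Set V := {v | v ∉ S ∧ ∀ s ∈ S, ¬ K s v}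
  let T : V → V → Prop := fun x y => (x ∈ C ∨ y ∈ C) → K x y
  have hTs : ∀ x y, T x y → T y x := fun x y h h' => hKs _ _ (h h'.symm)
  have hend : ∀ l1 l2 w w' b, Rot G l0 (l1 ++ w :: w' :: l2) →
      (w' :: l2).getLast? = some b → G.Adj w b → w' ∈ S := by
    intro l1 l2 w w' b h hb hwb
    rw [hS, Finset.mem_filter]
    refine ⟨Finset.mem_univ _, _, Rot.step h hb hwb, ?_⟩
    rw [List.getLast?_append_of_ne_nil _ (by simp)]
    simp [List.getLast?_cons]
  have hmid : ∀ l1 l2 w w', (l1 ++ w :: w' :: l2).IsChain T → T w w' := by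
    intro l1 l2 w w' h
    rw [List.isChain_append_cons_cons] at h
    exact h.2.1
  have hT : ∀ l, Rot G l0 l → l.IsChain T := by
    intro l hl
    induction hl with
    | refl =>
      rw [List.isChain_iff_getElem]
      intro i hi _
      exact ⟨i, Or.inl ⟨List.getElem?_eq_getElem _, List.getElem?_eq_getElem _⟩⟩
    | @step l1 l2 w b h hb hwb ih =>
      apply isChain_rotate hTs ih hb
      intro hc
      exfalso
      have hbS : b ∈ S := by
        rw [hS, Finset.mem_filter]
        refine ⟨Finset.mem_univ _, _, h, ?_⟩
        rw [List.getLast?_append_of_ne_nil _ (by simp), List.getLast?_cons, hb]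
        rfl
      rcases hc with hc | hc
      · cases l2 with
        | nil => simp at hb
        | cons w' l2 =>
          exact hc.2 w' (hend _ _ _ _ _ h hb hwb) (hKs _ _ (hmid _ _ _ _ ih (Or.inl hc)))
      · exact hc.1 hbS
  have hlt : (bdry G S).card < 2 * S.card := by
    apply card_consecutive_lt l0 h0.1.2 S _ b0 h0.2.2.1 hb0
    intro v hv
    rw [mem_bdry] at hv
    obtain ⟨hvS, b, hbS, hadj⟩ := hv
    by_contra hcon
    have hvC : v ∈ C := ⟨hvS, fun s hs hK => hcon ⟨s, hs, hK⟩⟩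
    rw [hS, Finset.mem_filter] at hbS
    obtain ⟨-, l, hl, hlb⟩ := hbS
    obtain ⟨c, hc⟩ := hl.endPath h0
    have hcb : c = b := by
      have := hc.2.2.1
      rw [hlb] at this
      exact (Option.some.inj this).symm
    subst hcb
    have hvl := hc.mem_of_adj hadj
    obtain ⟨l1, l2, rfl⟩ := List.append_of_mem hvl
    cases l2 with
    | nil =>
      have : v = c := by simpa using hlb
      exact hadj.ne this.symm
    | cons w' l2 =>
      have hb' : (w' :: l2).getLast? = some c := by
        rw [List.getLast?_append_of_ne_nil _ (by simp), List.getLast?_cons_cons] at hlb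
        exact hlb
      have hw' := hend _ _ _ _ _ hl hb' hadj.symm
      exact hvC.2 w' hw' (hKs _ _ (hmid _ _ _ _ (hT _ hl) (Or.inl hvC)))
  have : k < S.card := by
    by_contra hle
    have := hexp S (by omega)
    omega
  exact this.trans_le (Finset.card_le_card hSe)

/-- Closing a longest path of a connected graph gives a Hamilton cycle. -/
theorem isHam_of_endPath_adj [Fintype V] {G : SimpleGraph V} (hV : 3 ≤ Fintype.card V)
    (hconn : ∀ C : Finset V, C.Nonempty → C ≠ Finset.univ → ∃ x ∈ C, ∃ y ∉ C, G.Adj x y)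
    {a b : V} {l : List V} (h : EndPath G a b l) (hab : G.Adj a b) : IsHam G := by
  classical
  obtain ⟨⟨h1, h2⟩, h3, h4, h5⟩ := h
  have hal : a ∈ l := List.mem_of_head? h3
  have hall : l.toFinset = Finset.univ := by
    by_contra hne
    obtain ⟨x, hx, y, hy, hxy⟩ := hconn l.toFinset ⟨a, by simpa using hal⟩ hne
    rw [List.mem_toFinset] at hx hy
    obtain ⟨l1, l2, rfl⟩ := List.append_of_mem hx
    have hp : (x :: l2 ++ l1).Perm (l1 ++ x :: l2) := List.perm_append_comm
    have : IsPathList G (y :: (x :: l2 ++ l1)) := by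
      refine ⟨?_, ?_⟩
      · rw [List.cons_append, List.isChain_cons_cons, ← List.cons_append]
        refine ⟨hxy.symm, ?_⟩
        rw [List.isChain_append] at h1 ⊢
        refine ⟨h1.2.1, h1.1, ?_⟩
        intro u hu v hv
        rw [List.getLast?_append_of_ne_nil _ (by simp)] at h4
        rw [Option.mem_def, h4] at hu
        cases l1 with
        | nil => simp at hv
        | cons z t =>
          simp at hv h3
          cases hu
          subst hv
          subst h3
          exact hab.symm
      · rw [List.nodup_cons]
        exact ⟨fun hm => hy (hp.mem_iff.mp hm), hp.nodup_iff.mpr h2⟩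
    have h6 := this.length_le
    have h7 := hp.length_eq
    rw [List.length_cons] at h6
    omega
  have hne : l ≠ [] := List.ne_nil_of_mem hal
  have hlen : l.length = Fintype.card V := by
    rw [← List.toFinset_card_of_nodup h2, hall, Finset.card_univ]
  have hha : l.head hne = a := by
    have := List.head?_eq_some_head hne
    rw [h3] at this
    exact (Option.some.inj this).symm
  have hlb : l.getLast hne = b := by
    have := List.getLast?_eq_some_getLast hne
    rw [h4] at this
    exact (Option.some.inj this).symm
  let p := SimpleGraph.Walk.ofSupport l hne h1
  have hps : p.support = l := SimpleGraph.Walk.support_ofSupport hne h1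
  have hpp : p.IsPath := by rw [SimpleGraph.Walk.isPath_def, hps]; exact h2
  have hpl : p.length = l.length - 1 := SimpleGraph.Walk.length_ofSupport hne h1
  have hadj : G.Adj (l.getLast hne) (l.head hne) := by rw [hha, hlb]; exact hab.symm
  unfold IsHam
  intro _
  refine ⟨_, SimpleGraph.Walk.cons hadj p, ?_⟩
  have hcyc : (SimpleGraph.Walk.cons hadj p).IsCycle := by
    rw [SimpleGraph.Walk.cons_isCycle_iff]
    refine ⟨hpp, ?_⟩
    intro hmem
    have h8 := hpp.length_eq_one_of_mem_edges (by rw [Sym2.eq_swap]; exact hmem)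
    omega
  rw [@SimpleGraph.Walk.isHamiltonianCycle_iff_isCycle_and_length_eq]
  refine ⟨hcyc, ?_⟩
  rw [SimpleGraph.Walk.length_cons, hpl]
  have : (Fintype.ofFinite V).card = Fintype.card V := by convert rfl
  convert (show l.length - 1 + 1 = Fintype.card V by omega)

/-! ### A deterministic criterion for Hamiltonicity -/

/-- The sum of the degrees. -/
def dsum [Fintype V] (G : SimpleGraph V) : ℕ := ∑ v, (nb G v).card

lemma dsum_sup_le [Fintype V] (G H : SimpleGraph V) : dsum (G ⊔ H) ≤ dsum G + dsum H := by
  classical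
  unfold dsum
  rw [← Finset.sum_add_distrib]
  refine Finset.sum_le_sum fun v _ => ?_
  have : nb (G ⊔ H) v ⊆ nb G v ∪ nb H v := by
    intro u hu
    simpa using hu
  exact (Finset.card_le_card this).trans (Finset.card_union_le _ _)

/-- `x` and `y` are consecutive in `l`, in one of the two orders. -/
def Consec (l : List V) (x y : V) : Prop :=
  ∃ i, (l[i]? = some x ∧ l[i+1]? = some y) ∨ (l[i]? = some y ∧ l[i+1]? = some x)

lemma Consec.symm {l : List V} {x y : V} (h : Consec l x y) : Consec l y x :=
  let ⟨i, h⟩ := h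
  ⟨i, h.symm⟩

/-- The edges of `G` that join consecutive vertices of `l`. -/
def pathGraph (G : SimpleGraph V) (l : List V) : SimpleGraph V where
  Adj x y := G.Adj x y ∧ Consec l x y
  symm := ⟨fun _ _ h => ⟨h.1.symm, h.2.symm⟩⟩
  loopless := ⟨fun _ h => h.1.ne rfl⟩

/-- The edges of `G` that meet `B`. -/
def starGraph (G : SimpleGraph V) (B : Finset V) : SimpleGraph V where
  Adj x y := G.Adj x y ∧ (x ∈ B ∨ y ∈ B)
  symm := ⟨fun _ _ h => ⟨h.1.symm, h.2.symm⟩⟩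
  loopless := ⟨fun _ h => h.1.ne rfl⟩

lemma dsum_pathGraph_le [Fintype V] (G : SimpleGraph V) {l : List V} (hl : l.Nodup) :
    dsum (pathGraph G l) ≤ 2 * Fintype.card V := by
  classical
  unfold dsum
  rw [mul_comm, ← smul_eq_mul, ← Finset.card_univ]
  refine Finset.sum_le_card_nsmul _ _ _ fun v _ => ?_
  have : nb (pathGraph G l) v ⊆ {l.getD (l.idxOf v + 1) v, l.getD (l.idxOf v - 1) v} := by
    intro u hu
    rw [mem_nb] at hu
    obtain ⟨-, i, ⟨h1, h2⟩ | ⟨h1, h2⟩⟩ := hu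
    · obtain ⟨hi1, hi2⟩ := List.getElem?_eq_some_iff.mp h1
      have hidx : l.idxOf v = i := by rw [← hi2]; exact hl.idxOf_getElem i hi1
      rw [Finset.mem_insert, List.getD_eq_getElem?_getD, hidx, h2]
      exact Or.inl rfl
    · obtain ⟨hi1, hi2⟩ := List.getElem?_eq_some_iff.mp h2
      have hidx : l.idxOf v = i + 1 := by rw [← hi2]; exact hl.idxOf_getElem (i + 1) hi1
      rw [Finset.mem_insert, Finset.mem_singleton]
      right
      rw [List.getD_eq_getElem?_getD, hidx, Nat.add_sub_cancel, h1]
      rfl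
  exact (Finset.card_le_card this).trans Finset.card_le_two

lemma dsum_starGraph_le [Fintype V] (G : SimpleGraph V) (B : Finset V) :
    dsum (starGraph G B) ≤ 2 * ∑ b ∈ B, (nb G b).card := by
  classical
  have h1 : ∀ v, (nb (starGraph G B) v).card ≤
      (if v ∈ B then (nb G v).card else 0) + ∑ b ∈ B, if G.Adj v b then 1 else 0 := by
    intro v
    have : nb (starGraph G B) v ⊆ (if v ∈ B then nb G v else ∅) ∪ B.filter (G.Adj v) := by
      intro u hu
      rw [mem_nb] at hu
      obtain ⟨h1, h2⟩ := hu
      rw [Finset.mem_union, Finset.mem_filter]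
      rcases h2 with h2 | h2
      · left; rw [if_pos h2]; exact mem_nb.mpr h1
      · exact Or.inr ⟨h2, h1⟩
    refine (Finset.card_le_card this).trans ((Finset.card_union_le _ _).trans ?_)
    rw [Finset.card_filter]
    apply Nat.add_le_add_right
    split_ifs <;> simp
  unfold dsum
  refine (Finset.sum_le_sum fun v _ => h1 v).trans ?_
  rw [Finset.sum_add_distrib, Finset.sum_comm, two_mul]
  apply Nat.add_le_add
  · rw [← Finset.sum_filter]
    simp
  · refine Finset.sum_le_sum fun b _ => ?_
    rw [← Finset.card_filter]
    refine Finset.card_le_card fun u hu => ?_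
    rw [Finset.mem_filter] at hu
    exact mem_nb.mpr hu.2.symm

open Classical in
/-- The vertices whose successor on the chosen longest path of `G` from `a` to `b` lies in `Z`. -/
def shiftSet [Fintype V] (G : SimpleGraph V) (a : V) (Z : Finset V) (b : V) : Finset V :=
  if h : ∃ l, EndPath G a b l then
    Finset.univ.filter fun w => ∃ w' ∈ Z, ∃ i : ℕ,
      h.choose[i]? = some w ∧ h.choose[i+1]? = some w'
  else ∅

lemma card_shiftSet_le [Fintype V] (G : SimpleGraph V) (a : V) (Z : Finset V) (b : V) :
    (shiftSet G a Z b).card ≤ Z.card := by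
  classical
  unfold shiftSet
  split_ifs with h
  · have hl := h.choose_spec.1.2
    set l := h.choose
    refine le_trans (Finset.card_le_card (t := Z.image fun w => l.getD (l.idxOf w - 1) a) ?_)
      Finset.card_image_le
    intro w hw
    rw [Finset.mem_filter] at hw
    obtain ⟨-, w', hw', i, h1, h2⟩ := hw
    rw [Finset.mem_image]
    obtain ⟨hi1, hi2⟩ := List.getElem?_eq_some_iff.mp h2
    have hidx : l.idxOf w' = i + 1 := by rw [← hi2]; exact hl.idxOf_getElem (i + 1) hi1
    refine ⟨w', hw', ?_⟩
    rw [List.getD_eq_getElem?_getD, hidx, Nat.add_sub_cancel, h1]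
    rfl
  · simp

lemma EndPath.of_le [Fintype V] {G H : SimpleGraph V} (h : G ≤ H) (hlen : maxLen G = maxLen H)
    {a b : V} {l : List V} (hl : EndPath G a b l) : EndPath H a b l :=
  ⟨hl.1.mono h, hl.2.1, hl.2.2.1, hl.2.2.2.trans hlen⟩

/-- Rotating with the edges of `H` at `b` yields endpoints of longest paths of `H'`. -/
lemma nb_subset_shiftSet [Fintype V] {G H' H : SimpleGraph V} (h1 : G ≤ H') (h2 : H' ≤ H)
    (hlen : maxLen G = maxLen H) (hlen' : maxLen H' = maxLen H) {a b : V}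
    (hb : ∀ w, H.Adj b w → H'.Adj b w) (hab : b ∈ ends G a) :
    nb H b ⊆ shiftSet G a (ends H' a) b := by
  classical
  intro w hw
  rw [mem_nb] at hw
  have hex := mem_ends.mp hab
  unfold shiftSet
  rw [dif_pos hex, Finset.mem_filter]
  refine ⟨Finset.mem_univ _, ?_⟩
  have hl := hex.choose_spec
  set l := hex.choose
  have hlH : EndPath H a b l := hl.of_le (h1.trans h2) hlen
  have hlH' : EndPath H' a b l := hl.of_le h1 (hlen.trans hlen'.symm)
  have hwl := hlH.mem_of_adj hw
  obtain ⟨l1, l2, hl12⟩ := List.append_of_mem hwl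
  rw [hl12] at hlH hlH' ⊢
  cases l2 with
  | nil =>
    have : w = b := by simpa using hlH.2.2.1
    exact absurd this.symm hw.ne
  | cons w' l2 =>
    have hb' : (w' :: l2).getLast? = some b := by
      have := hlH.2.2.1
      rw [List.getLast?_append_of_ne_nil _ (by simp), List.getLast?_cons_cons] at this
      exact this
    refine ⟨w', ?_, l1.length, by simp, by simp⟩
    obtain ⟨c, hc⟩ := (Rot.step (Rot.refl (G := H')) hb' (hb w hw).symm).endPath hlH'
    have : c = w' := by
      have := hc.2.2.1
      rw [List.getLast?_append_of_ne_nil _ (by simp)] at this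
      simpa [List.getLast?_cons] using this.symm
    subst this
    exact mem_ends.mpr ⟨_, hc⟩

/-- Some colour class meets many of the sets `E a`. -/
lemma exists_color [Fintype V] {M : ℕ} (hM : 0 < M) (col : V → Fin M)
    (hcol : ∀ c, ((Finset.univ.filter fun v => col v = c).card : ℝ) ≤ 2 * Fintype.card V / M)
    (A : Finset V) (E : V → Finset V) (hE : ∀ a ∈ A, (Fintype.card V : ℝ) / 16 ≤ (E a).card) :
    ∃ c, (A.card : ℝ) / 64 ≤ (A.filter fun a => (Fintype.card V : ℝ) / (32 * M) ≤
      ((E a).filter fun b => col b = c).card).card := by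
  classical
  rcases isEmpty_or_nonempty V with hV | hV
  · refine ⟨⟨0, hM⟩, ?_⟩
    have : A = ∅ := Finset.eq_empty_of_isEmpty A
    simp [this]
  set n : ℝ := ((Fintype.card V : ℕ) : ℝ) with hn
  have hnpos : 0 < n := by rw [hn]; exact_mod_cast Fintype.card_pos
  have hMpos : (0 : ℝ) < M := by exact_mod_cast hM
  have hsum : ∑ c : Fin M, ∑ a ∈ A, (((E a).filter fun b => col b = c).card : ℝ) =
      ∑ a ∈ A, ((E a).card : ℝ) := by
    rw [Finset.sum_comm]
    refine Finset.sum_congr rfl fun a _ => ?_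
    rw [Finset.card_eq_sum_card_fiberwise (f := col) (t := Finset.univ)]
    · push_cast; rfl
    · intro x _; simp
  have hge : (A.card : ℝ) * (n / 16) ≤ ∑ a ∈ A, ((E a).card : ℝ) := by
    rw [← nsmul_eq_mul]
    exact Finset.card_nsmul_le_sum _ _ _ hE
  obtain ⟨c, -, hc⟩ : ∃ c ∈ (Finset.univ : Finset (Fin M)), (A.card : ℝ) * (n / 16) / M ≤
      ∑ a ∈ A, (((E a).filter fun b => col b = c).card : ℝ) := by
    have : Nonempty (Fin M) := ⟨⟨0, hM⟩⟩
    apply Finset.exists_le_of_sum_le Finset.univ_nonempty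
    rw [hsum]
    simp only [Finset.sum_const, Finset.card_univ, Fintype.card_fin, nsmul_eq_mul]
    rw [mul_div_cancel₀ _ hMpos.ne']
    exact hge
  refine ⟨c, ?_⟩
  set A' := A.filter fun a => n / (32 * M) ≤ ((E a).filter fun b => col b = c).card with hA'
  have hle : ∑ a ∈ A, (((E a).filter fun b => col b = c).card : ℝ) ≤
      A'.card * (2 * n / M) + A.card * (n / (32 * M)) := by
    have : ∀ a ∈ A, (((E a).filter fun b => col b = c).card : ℝ) ≤
        (if a ∈ A' then 2 * n / M else 0) + n / (32 * M) := by
      intro a ha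
      split_ifs with h
      · have h1 : (((E a).filter fun b => col b = c).card : ℝ) ≤ 2 * n / M := by
          refine le_trans ?_ (hcol c)
          exact_mod_cast Finset.card_le_card
            (Finset.filter_subset_filter _ (Finset.subset_univ _))
        have : 0 ≤ n / (32 * M) := by positivity
        linarith
      · rw [hA', Finset.mem_filter, not_and, not_le] at h
        linarith [h ha]
    refine (Finset.sum_le_sum this).trans ?_
    rw [Finset.sum_add_distrib, ← Finset.sum_filter, Finset.sum_const, Finset.sum_const,
      nsmul_eq_mul, nsmul_eq_mul]
    have : A.filter (fun a => a ∈ A') = A' := by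
      ext x
      simp only [Finset.mem_filter, hA']
      tauto
    rw [this]
  have h3 := hc.trans hle
  have h4 : (A.card : ℝ) * (n / 16) / M = (A.card / 64) * (2 * n / M) + A.card * (n / (32 * M)) := by
    field_simp
    ring
  rw [h4] at h3
  have h5 : (A.card / 64 : ℝ) * (2 * n / M) ≤ A'.card * (2 * n / M) := by linarith
  exact le_of_mul_le_mul_right h5 (by positivity)

open Classical in
/-- Rotations from a sparse expander, then with all edges at a small set of vertices, and
finally a closing edge. -/
theorem isHam_of_sparse_expander [Fintype V] (hV : 3 ≤ Fintype.card V) (G Γ₀ : SimpleGraph V)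
    (hΓ₀ : Γ₀ ≤ G)
    (hexp : ∀ X : Finset V, X.card ≤ Fintype.card V / 8 → 2 * X.card ≤ (bdry Γ₀ X).card)
    (hconn : ∀ C : Finset V, C.Nonempty → C ≠ Finset.univ → ∃ x ∈ C, ∃ y ∉ C, G.Adj x y)
    {M : ℕ} (hM : 0 < M) (col : V → Fin M)
    (hcol : ∀ c, ((Finset.univ.filter fun v => col v = c).card : ℝ) ≤ 2 * Fintype.card V / M)
    (low : Finset V) (d : ℝ) (hlow : (lowᶜ.card : ℝ) ≤ (Fintype.card V : ℝ) / 16)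
    (hd : ∀ v ∈ low, ((nb G v).card : ℝ) ≤ d)
    {β M1 M2 : ℝ} (hβ : Fintype.card V ≤ 2 * β)
    (hM1 : dsum Γ₀ + 2 * (Fintype.card V : ℝ) ≤ M1)
    (hM2 : M1 + 2 * (2 * Fintype.card V / M * d) ≤ M2)
    (hgen1 : ∀ Γ ≤ G, (dsum Γ : ℝ) ≤ M1 → ∀ (a : V) (Z : Finset V), (Z.card : ℝ) ≤ β →
      ((Finset.univ.filter fun b => nb G b ⊆ shiftSet Γ a Z b).card : ℝ) <
        (Fintype.card V : ℝ) / (32 * M))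
    (hgen2 : ∀ Γ ≤ G, (dsum Γ : ℝ) ≤ M2 → ((Finset.univ.filter fun a => nb G a ⊆ (ends Γ a)ᶜ ∧
      ((ends Γ a)ᶜ.card : ℝ) ≤ β).card : ℝ) < (Fintype.card V : ℝ) / 512) : IsHam G := by
  obtain ⟨l, hl, hlen⟩ := exists_isPathList_maxLen G
  have hcardpos : 0 < Fintype.card V := by omega
  obtain ⟨v0⟩ := Fintype.card_pos_iff.mp hcardpos
  have hlne : l ≠ [] := by
    rintro rfl
    have : IsPathList G [v0] := ⟨List.isChain_singleton _, by simp⟩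
    have := this.length_le
    simp at this hlen
    omega
  set Γ := Γ₀ ⊔ pathGraph G l with hΓ
  have hΓG : Γ ≤ G := sup_le hΓ₀ fun x y h => h.1
  have hlΓ : IsPathList Γ l := by
    refine ⟨?_, hl.2⟩
    rw [List.isChain_iff_getElem]
    intro i hi
    right
    exact ⟨List.isChain_iff_getElem.mp hl.1 i hi, i,
      Or.inl ⟨List.getElem?_eq_getElem _, List.getElem?_eq_getElem _⟩⟩
  have hmax : maxLen Γ = maxLen G := maxLen_eq hΓG hlΓ hlen
  have hexpΓ : ∀ X : Finset V, X.card ≤ Fintype.card V / 8 → 2 * X.card ≤ (bdry Γ X).card := by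
    intro X hX
    refine (hexp X hX).trans (Finset.card_le_card fun v hv => ?_)
    rw [mem_bdry] at hv ⊢
    obtain ⟨h1, x, hx, h2⟩ := hv
    exact ⟨h1, x, hx, Or.inl h2⟩
  have hEP : EndPath Γ (l.head hlne) (l.getLast hlne) l :=
    ⟨hlΓ, List.head?_eq_some_head _, List.getLast?_eq_some_getLast _, hlen.trans hmax.symm⟩
  have hdiv : ∀ k : ℕ, Fintype.card V / 8 < k → (Fintype.card V : ℝ) / 8 ≤ k := by
    intro k hk
    have : Fintype.card V ≤ 8 * k := by omega
    have : (Fintype.card V : ℝ) ≤ 8 * k := by exact_mod_cast this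
    linarith
  set A : Finset V := Finset.univ.filter fun a => (ends Γ a).Nonempty with hA
  have hAends : ∀ a ∈ A, (Fintype.card V : ℝ) / 8 ≤ (ends Γ a).card := by
    intro a ha
    rw [hA, Finset.mem_filter] at ha
    obtain ⟨-, b, hb⟩ := ha
    obtain ⟨l', hl'⟩ := mem_ends.mp hb
    exact hdiv _ (lt_card_ends hexpΓ hl')
  have hAcard : (Fintype.card V : ℝ) / 8 ≤ A.card := by
    refine hdiv _ ((lt_card_ends hexpΓ hEP).trans_le (Finset.card_le_card fun b hb => ?_))
    rw [hA, Finset.mem_filter]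
    exact ⟨Finset.mem_univ _, _, mem_ends_comm.mp hb⟩
  have hE : ∀ a ∈ A, (Fintype.card V : ℝ) / 16 ≤ ((ends Γ a) ∩ low).card := by
    intro a ha
    have h1 := hAends a ha
    have h2 : (ends Γ a).card ≤ (ends Γ a ∩ low).card + lowᶜ.card := by
      rw [← Finset.card_inter_add_card_sdiff (ends Γ a) low]
      apply Nat.add_le_add_left
      apply Finset.card_le_card
      intro x hx
      rw [Finset.mem_sdiff] at hx
      exact Finset.mem_compl.mpr hx.2
    have h3 : ((ends Γ a).card : ℝ) ≤ (ends Γ a ∩ low).card + lowᶜ.card := by exact_mod_cast h2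
    linarith
  obtain ⟨c, hc⟩ := exists_color hM col hcol A _ hE
  set A' := A.filter fun a => (Fintype.card V : ℝ) / (32 * M) ≤
      (((ends Γ a) ∩ low).filter fun b => col b = c).card with hA'
  set B := low.filter fun b => col b = c with hB
  set Γ' := Γ ⊔ starGraph G B with hΓ'
  have hΓ'G : Γ' ≤ G := sup_le hΓG fun x y h => h.1
  have hmax' : maxLen Γ' = maxLen G := maxLen_eq hΓ'G (hlΓ.mono le_sup_left) hlen
  have hdΓ : (dsum Γ : ℝ) ≤ M1 := by
    refine le_trans ?_ hM1
    have h1 := (dsum_sup_le Γ₀ (pathGraph G l)).trans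
      (Nat.add_le_add_left (dsum_pathGraph_le G hl.2) _)
    exact_mod_cast h1
  have hdΓ' : (dsum Γ' : ℝ) ≤ M2 := by
    refine le_trans ?_ hM2
    have h1 := (dsum_sup_le Γ (starGraph G B)).trans
      (Nat.add_le_add_left (dsum_starGraph_le G B) _)
    have h2 : (dsum Γ' : ℝ) ≤ dsum Γ + 2 * ∑ b ∈ B, ((nb G b).card : ℝ) := by exact_mod_cast h1
    have hd0 : 0 ≤ d := by
      by_contra hneg
      have : low = ∅ := by
        apply Finset.eq_empty_of_forall_notMem
        intro v hv
        have := hd v hv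
        have : (0 : ℝ) ≤ (nb G v).card := by positivity
        linarith
      rw [this] at hlow
      simp at hlow
      have : (0 : ℝ) < Fintype.card V := by exact_mod_cast hcardpos
      linarith
    have h3 : ∑ b ∈ B, ((nb G b).card : ℝ) ≤ 2 * Fintype.card V / M * d := by
      refine (Finset.sum_le_card_nsmul B _ d fun b hb => hd b ?_).trans ?_
      · rw [hB, Finset.mem_filter] at hb
        exact hb.1
      · rw [nsmul_eq_mul]
        refine mul_le_mul_of_nonneg_right (le_trans ?_ (hcol c)) hd0
        exact_mod_cast Finset.card_le_card
            (Finset.filter_subset_filter _ (Finset.subset_univ _))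
    linarith
  have hbig : ∀ a ∈ A', β < (ends Γ' a).card := by
    intro a ha
    by_contra hle
    rw [not_lt] at hle
    have h1 := hgen1 Γ hΓG hdΓ a _ hle
    rw [hA', Finset.mem_filter] at ha
    have h2 : (((ends Γ a) ∩ low).filter fun b => col b = c).card ≤
        (Finset.univ.filter fun b => nb G b ⊆ shiftSet Γ a (ends Γ' a) b).card := by
      apply Finset.card_le_card
      intro b hb
      rw [Finset.mem_filter, Finset.mem_inter] at hb
      rw [Finset.mem_filter]
      refine ⟨Finset.mem_univ _, nb_subset_shiftSet le_sup_left hΓ'G hmax hmax' ?_ hb.1.1⟩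
      intro w hw
      right
      refine ⟨hw, Or.inl ?_⟩
      rw [hB, Finset.mem_filter]
      exact ⟨hb.1.2, hb.2⟩
    have h3 : ((((ends Γ a) ∩ low).filter fun b => col b = c).card : ℝ) ≤
        (Finset.univ.filter fun b => nb G b ⊆ shiftSet Γ a (ends Γ' a) b).card := by
      exact_mod_cast h2
    linarith [ha.2]
  have h2 := hgen2 Γ' hΓ'G hdΓ'
  obtain ⟨a, haA, ha⟩ : ∃ a ∈ A', ¬ (nb G a ⊆ (ends Γ' a)ᶜ) := by
    by_contra hcon
    push Not at hcon
    have h3 : A'.card ≤ (Finset.univ.filter fun a => nb G a ⊆ (ends Γ' a)ᶜ ∧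
      ((ends Γ' a)ᶜ.card : ℝ) ≤ β).card := by
      apply Finset.card_le_card
      intro a ha
      rw [Finset.mem_filter]
      refine ⟨Finset.mem_univ _, hcon a ha, ?_⟩
      have h4 := hbig a ha
      have h5 := Finset.card_add_card_compl (ends Γ' a)
      have h6 : ((ends Γ' a).card : ℝ) + (ends Γ' a)ᶜ.card = Fintype.card V := by exact_mod_cast h5
      linarith
    have h4 : (A'.card : ℝ) ≤ (Finset.univ.filter fun a => nb G a ⊆ (ends Γ' a)ᶜ ∧
      ((ends Γ' a)ᶜ.card : ℝ) ≤ β).card := by exact_mod_cast h3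
    linarith
  rw [Finset.not_subset] at ha
  obtain ⟨b, hb1, hb2⟩ := ha
  rw [Finset.mem_compl, not_not, mem_ends] at hb2
  obtain ⟨l', hl'⟩ := hb2
  exact isHam_of_endPath_adj hV hconn (hl'.of_le hΓ'G hmax') (mem_nb.mp hb1)

/-! ### Independent labels and random orderings -/

section Labels

variable {E : Type*} [Fintype E] [DecidableEq E]

/-- The weight of a labelling, for independent labels with weights `q`. -/
def wt (q : Fin 3 → ℝ) (ω : E → Fin 3) : ℝ := ∏ e, q (ω e)

open Classical in
/-- The probability of a set of labellings. -/
def Pr (q : Fin 3 → ℝ) (S : Set (E → Fin 3)) : ℝ := ∑ ω, if ω ∈ S then wt q ω else 0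

open Classical in
/-- The probability of a set of orderings, for a uniformly random ordering. -/
def PP (S : Set (Fin (Fintype.card E) ≃ E)) : ℝ :=
  ((Finset.univ.filter fun σ => σ ∈ S).card : ℝ) / (Fintype.card (Fin (Fintype.card E) ≃ E) : ℝ)

omit [DecidableEq E] in
lemma wt_nonneg {q : Fin 3 → ℝ} (hq : ∀ i, 0 ≤ q i) (ω : E → Fin 3) : 0 ≤ wt q ω :=
  Finset.prod_nonneg fun _ _ => hq _

lemma Pr_nonneg {q : Fin 3 → ℝ} (hq : ∀ i, 0 ≤ q i) (S : Set (E → Fin 3)) :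
    0 ≤ Pr q S :=
  Finset.sum_nonneg fun ω _ => by split_ifs; exacts [wt_nonneg hq ω, le_rfl]

lemma Pr_le_sum {ι : Type*} {q : Fin 3 → ℝ} (hq : ∀ i, 0 ≤ q i) {S : Set (E → Fin 3)}
    (I : Finset ι) (T : ι → Set (E → Fin 3)) (h : ∀ ω ∈ S, ∃ i ∈ I, ω ∈ T i) :
    Pr q S ≤ ∑ i ∈ I, Pr q (T i) := by
  classical
  unfold Pr
  rw [Finset.sum_comm]
  refine Finset.sum_le_sum fun ω _ => ?_
  have hn : ∀ i ∈ I, 0 ≤ if ω ∈ T i then wt q ω else 0 := fun i _ => by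
    split_ifs; exacts [wt_nonneg hq ω, le_rfl]
  split_ifs with hω
  · obtain ⟨i, hi, hi'⟩ := h ω hω
    refine le_trans ?_ (Finset.single_le_sum hn hi)
    rw [if_pos hi']
  · exact Finset.sum_nonneg hn

lemma sum_prod_eq (f : E → Fin 3 → ℝ) :
    ∑ ω : E → Fin 3, ∏ e, f e (ω e) = ∏ e, ∑ j, f e j := by
  rw [Finset.prod_univ_sum, Fintype.piFinset_univ]

/-- The exponential moment method. -/
lemma Pr_le_prod {q : Fin 3 → ℝ} (hq : ∀ i, 0 ≤ q i) {S : Set (E → Fin 3)} {C : ℝ} (hC : 0 ≤ C)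
    (f : E → Fin 3 → ℝ) (hf : ∀ e j, 0 ≤ f e j) (h : ∀ ω ∈ S, 1 ≤ C * ∏ e, f e (ω e)) :
    Pr q S ≤ C * ∏ e, ∑ j, q j * f e j := by
  classical
  rw [← sum_prod_eq, Finset.mul_sum]
  refine Finset.sum_le_sum fun ω _ => ?_
  rw [Finset.prod_mul_distrib]
  have h1 := wt_nonneg hq ω
  split_ifs with hω
  · have := mul_le_mul_of_nonneg_left (h ω hω) h1
    unfold wt at *
    linarith
  · have : 0 ≤ ∏ e, f e (ω e) := Finset.prod_nonneg fun e _ => hf e _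
    unfold wt at h1
    positivity

lemma Pr_univ {q : Fin 3 → ℝ} (hq1 : ∑ i, q i = 1) : Pr q (Set.univ : Set (E → Fin 3)) = 1 := by
  have := sum_prod_eq (E := E) fun _ => q
  simp only [hq1, Finset.prod_const_one] at this
  simpa [Pr, wt] using this

lemma Pr_add_compl {q : Fin 3 → ℝ} (hq1 : ∑ i, q i = 1) (S : Set (E → Fin 3)) :
    Pr q S + Pr q Sᶜ = 1 := by
  rw [← Pr_univ (E := E) hq1]
  unfold Pr
  rw [← Finset.sum_add_distrib]
  refine Finset.sum_congr rfl fun ω _ => ?_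
  by_cases h : ω ∈ S <;> simp [h]

lemma PP_nonneg (S : Set (Fin (Fintype.card E) ≃ E)) : 0 ≤ PP S := by
  unfold PP; positivity

lemma card_orderings_pos : 0 < Fintype.card (Fin (Fintype.card E) ≃ E) :=
  Fintype.card_pos_iff.mpr ⟨(Fintype.equivFin E).symm⟩

lemma PP_le_one (S : Set (Fin (Fintype.card E) ≃ E)) : PP S ≤ 1 := by
  unfold PP
  rw [div_le_one (by exact_mod_cast card_orderings_pos)]
  exact_mod_cast Finset.card_le_univ _

lemma PP_le_sum {ι : Type*} {S : Set (Fin (Fintype.card E) ≃ E)} (I : Finset ι)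
    (T : ι → Set (Fin (Fintype.card E) ≃ E)) (h : ∀ σ ∈ S, ∃ i ∈ I, σ ∈ T i) :
    PP S ≤ ∑ i ∈ I, PP (T i) := by
  classical
  unfold PP
  rw [← Finset.sum_div]
  gcongr
  have : (Finset.univ.filter fun σ => σ ∈ S) ⊆ I.biUnion fun i => Finset.univ.filter (· ∈ T i) := by
    intro σ hσ
    rw [Finset.mem_filter] at hσ
    obtain ⟨i, hi, hi'⟩ := h σ hσ.2
    rw [Finset.mem_biUnion]
    exact ⟨i, hi, by simpa using hi'⟩
  exact_mod_cast (Finset.card_le_card this).trans Finset.card_biUnion_le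

omit [DecidableEq E] in
/-- A labelling is monotone along some ordering. -/
lemma exists_monotone_ordering (ω : E → Fin 3) :
    ∃ σ : Fin (Fintype.card E) ≃ E, Monotone (ω ∘ σ) :=
  let σ₀ := (Fintype.equivFin E).symm
  ⟨(Tuple.sort (ω ∘ σ₀)).trans σ₀, Tuple.monotone_sort (ω ∘ σ₀)⟩

/-- Comparison of a uniformly random ordering with independent random labels: an ordering along
which the labels are monotone is, conditionally on an exchangeable event, uniformly random. -/
theorem PP_mul_Pr_le {q : Fin 3 → ℝ} (hq : ∀ i, 0 ≤ q i) {Ω₀ Bad : Set (E → Fin 3)}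
    {Ev : Set (Fin (Fintype.card E) ≃ E)}
    (hΩ : ∀ ω ∈ Ω₀, ∀ π : Equiv.Perm E, ω ∘ π ∈ Ω₀)
    (h : ∀ ω ∈ Ω₀, ∀ σ ∈ Ev, Monotone (ω ∘ σ) → ω ∈ Bad) :
    PP Ev * Pr q Ω₀ ≤ Pr q Bad := by
  classical
  have hpos : (0 : ℝ) < Fintype.card (Fin (Fintype.card E) ≃ E) := by
    exact_mod_cast card_orderings_pos
  have hcard : Fintype.card (Equiv.Perm E) = Fintype.card (Fin (Fintype.card E) ≃ E) :=
    Fintype.card_congr (Equiv.equivCongr (Fintype.equivFin E) (Equiv.refl E))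
  have h1 : ∀ π : Equiv.Perm E, Pr q Bad = ∑ ω, if ω ∘ π ∈ Bad then wt q ω else 0 := by
    intro π
    unfold Pr
    rw [← (Equiv.arrowCongr π.symm (Equiv.refl (Fin 3))).sum_comp]
    refine Finset.sum_congr rfl fun ω _ => ?_
    have h2 : (Equiv.arrowCongr π.symm (Equiv.refl (Fin 3))) ω = ω ∘ π := by
      ext e; simp
    have h3 : wt q (ω ∘ π) = wt q ω := by
      unfold wt
      exact Equiv.prod_comp π fun e => q (ω e)
    rw [h2, h3]
  have h2 : (Fintype.card (Fin (Fintype.card E) ≃ E) : ℝ) * Pr q Bad =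
      ∑ ω : E → Fin 3, wt q ω * (Finset.univ.filter fun π : Equiv.Perm E => ω ∘ π ∈ Bad).card := by
    rw [← hcard, ← nsmul_eq_mul, ← Finset.card_univ, ← Finset.sum_const,
      Finset.sum_congr rfl fun π _ => h1 π, Finset.sum_comm]
    refine Finset.sum_congr rfl fun ω _ => ?_
    rw [← Finset.sum_filter, Finset.sum_const, nsmul_eq_mul, mul_comm]
  have h3 : ∀ ω ∈ Ω₀, (Finset.univ.filter fun σ => σ ∈ Ev).card ≤
      (Finset.univ.filter fun π : Equiv.Perm E => ω ∘ π ∈ Bad).card := by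
    intro ω hω
    obtain ⟨σ₀, hσ₀⟩ := exists_monotone_ordering ω
    apply Finset.card_le_card_of_injOn fun σ => σ.symm.trans σ₀
    · intro σ hσ
      simp only [Finset.coe_filter, Finset.mem_univ, true_and, Set.mem_ofPred_eq] at hσ ⊢
      refine h _ (hΩ ω hω _) σ hσ ?_
      have : (ω ∘ (σ.symm.trans σ₀)) ∘ σ = ω ∘ σ₀ := by ext i; simp
      rw [this]
      exact hσ₀
    · intro σ _ σ' _ heq
      have : σ.symm = σ'.symm := by
        ext e
        have := congrArg (fun π : Equiv.Perm E => σ₀.symm (π e)) heq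
        simpa using congrArg Fin.val this
      rw [← Equiv.symm_symm σ, this, Equiv.symm_symm]
  have h4 : ((Finset.univ.filter fun σ => σ ∈ Ev).card : ℝ) * Pr q Ω₀ ≤
      Fintype.card (Fin (Fintype.card E) ≃ E) * Pr q Bad := by
    rw [h2, Pr, Finset.mul_sum]
    refine Finset.sum_le_sum fun ω _ => ?_
    have hw := wt_nonneg hq ω
    split_ifs with hω
    · rw [mul_comm]
      exact mul_le_mul_of_nonneg_left (by exact_mod_cast h3 ω hω) hw
    · rw [mul_zero]; positivity
  unfold PP
  rw [div_mul_eq_mul_div, div_le_iff₀ hpos]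
  linarith

theorem PP_le_add {q : Fin 3 → ℝ} (hq : ∀ i, 0 ≤ q i) (hq1 : ∑ i, q i = 1)
    {Ω₀ Bad : Set (E → Fin 3)} {Ev : Set (Fin (Fintype.card E) ≃ E)}
    (hΩ : ∀ ω ∈ Ω₀, ∀ π : Equiv.Perm E, ω ∘ π ∈ Ω₀)
    (h : ∀ ω ∈ Ω₀, ∀ σ ∈ Ev, Monotone (ω ∘ σ) → ω ∈ Bad) :
    PP Ev ≤ Pr q Bad + Pr q Ω₀ᶜ := by
  have h1 := PP_mul_Pr_le hq hΩ h
  have h2 := Pr_add_compl hq1 Ω₀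
  have h3 := PP_le_one Ev
  have h4 := Pr_nonneg hq Ω₀ᶜ
  have h5 : PP Ev * Pr q Ω₀ᶜ ≤ Pr q Ω₀ᶜ := mul_le_of_le_one_left h4 h3
  have h6 : Pr q Ω₀ = 1 - Pr q Ω₀ᶜ := by linarith
  rw [h6] at h1
  linarith

/-- The number of elements whose label is in `J`. -/
def cnt (J : Finset (Fin 3)) (ω : E → Fin 3) : ℕ := (Finset.univ.filter fun e => ω e ∈ J).card

omit [DecidableEq E] in
lemma cnt_comp (J : Finset (Fin 3)) (ω : E → Fin 3) (π : Equiv.Perm E) :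
    cnt J (ω ∘ π) = cnt J ω := by
  unfold cnt
  refine Finset.card_bij' (fun e _ => π e) (fun e _ => π.symm e) ?_ ?_ ?_ ?_ <;> simp

omit [DecidableEq E] in
lemma lt_of_cnt_le {J : Finset (Fin 3)} (hJ : ∀ i j, i ≤ j → j ∈ J → i ∈ J) {ω : E → Fin 3}
    {σ : Fin (Fintype.card E) ≃ E} (hσ : Monotone (ω ∘ σ)) {m : ℕ} (hm : cnt J ω ≤ m) {e : E}
    (he : ω e ∈ J) : (σ.symm e : ℕ) < m := by
  refine lt_of_lt_of_le ?_ hm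
  have : ((Finset.Iic (σ.symm e)).map σ.toEmbedding).card ≤ cnt J ω := by
    apply Finset.card_le_card
    intro e' he'
    rw [Finset.mem_map] at he'
    obtain ⟨i, hi, rfl⟩ := he'
    rw [Finset.mem_filter]
    refine ⟨Finset.mem_univ _, hJ _ _ (hσ (Finset.mem_Iic.mp hi)) ?_⟩
    simpa using he
  rw [Finset.card_map, Fin.card_Iic] at this
  omega

omit [DecidableEq E] in
lemma label_mem_of_lt {J : Finset (Fin 3)} (hJ : ∀ i j, i ≤ j → j ∈ J → i ∈ J) {ω : E → Fin 3}
    {σ : Fin (Fintype.card E) ≃ E} (hσ : Monotone (ω ∘ σ)) {m : ℕ} (hm : m ≤ cnt J ω) {e : E}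
    (he : (σ.symm e : ℕ) < m) : ω e ∈ J := by
  by_contra hcon
  have : cnt J ω ≤ ((Finset.Iio (σ.symm e)).map σ.toEmbedding).card := by
    apply Finset.card_le_card
    intro e' he'
    rw [Finset.mem_filter] at he'
    rw [Finset.mem_map]
    refine ⟨σ.symm e', ?_, by simp⟩
    rw [Finset.mem_Iio]
    by_contra hle
    rw [not_lt] at hle
    have := hσ hle
    simp only [Function.comp_apply, Equiv.apply_symm_apply] at this
    exact hcon (hJ _ _ this he'.2)
  rw [Finset.card_map, Fin.card_Iio] at this
  omega

/-- Exponential moment bound for the number of labels in `J`. -/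
lemma Pr_cnt_le {q : Fin 3 → ℝ} (hq : ∀ i, 0 ≤ q i) (hq1 : ∑ i, q i = 1) (J : Finset (Fin 3))
    {x : ℝ} (hx : 0 < x) {S : Set (E → Fin 3)} {μ : ℝ}
    (h : ∀ ω ∈ S, μ * Real.log x ≤ cnt J ω * Real.log x) :
    Pr q S ≤ Real.exp ((∑ i ∈ J, q i) * (x - 1) * Fintype.card E - μ * Real.log x) := by
  classical
  have h1 := Pr_le_prod hq (S := S) (C := Real.exp (-(μ * Real.log x))) (Real.exp_nonneg _)
    (fun _ j => if j ∈ J then x else 1) (fun _ j => by split_ifs <;> positivity) (by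
      intro ω hω
      rw [Finset.prod_ite, Finset.prod_const_one, mul_one, Finset.prod_const, ← Real.rpow_natCast,
        Real.rpow_def_of_pos hx, ← Real.exp_add, Real.one_le_exp_iff]
      have := h ω hω
      unfold cnt at this
      linarith)
  refine h1.trans ?_
  have h2 : ∑ j, q j * (if j ∈ J then x else 1) = 1 + (∑ i ∈ J, q i) * (x - 1) := by
    have : ∀ j, q j * (if j ∈ J then x else 1) = q j + if j ∈ J then q j * (x - 1) else 0 := by
      intro j; split_ifs <;> ring
    rw [Finset.sum_congr rfl fun j _ => this j, Finset.sum_add_distrib, hq1, Finset.sum_mul,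
      Finset.sum_ite_mem, Finset.univ_inter]
  have h3 : 0 ≤ 1 + (∑ i ∈ J, q i) * (x - 1) := by
    rw [← h2]
    exact Finset.sum_nonneg fun j _ => mul_nonneg (hq j) (by split_ifs <;> positivity)
  rw [Finset.prod_const, Finset.card_univ, h2]
  have h4 : (1 + (∑ i ∈ J, q i) * (x - 1)) ^ Fintype.card E ≤
      Real.exp ((∑ i ∈ J, q i) * (x - 1)) ^ Fintype.card E := by
    gcongr
    linarith [Real.add_one_le_exp ((∑ i ∈ J, q i) * (x - 1))]
  refine (mul_le_mul_of_nonneg_left h4 (Real.exp_nonneg _)).trans (le_of_eq ?_)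
  rw [← Real.exp_nat_mul, ← Real.exp_add]
  ring_nf

end Labels

/-! ### Hitting sets and sparse subgraphs -/

/-- Greedy hitting sets: few elements of `W` miss only a small proportion of a family of large
subsets of `W`. -/
lemma exists_hitting_set {α ι : Type*} [DecidableEq α] (W : Finset α) (F : Finset ι)
    (hit : ι → Finset α) (c : ℝ) (hc1 : c ≤ 1)
    (hsub : ∀ f ∈ F, hit f ⊆ W) (hlarge : ∀ f ∈ F, c * W.card ≤ (hit f).card) (hW : W.Nonempty)
    (t : ℕ) : ∃ T ⊆ W, T.card ≤ t ∧
      ((F.filter fun f => Disjoint (hit f) T).card : ℝ) ≤ F.card * (1 - c) ^ t := by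
  classical
  induction t with
  | zero =>
    refine ⟨∅, Finset.empty_subset _, le_rfl, ?_⟩
    simp
  | succ t ih =>
    obtain ⟨T, hTW, hT, hTF⟩ := ih
    set F' := F.filter fun f => Disjoint (hit f) T with hF'
    have hWpos : (0 : ℝ) < W.card := by exact_mod_cast hW.card_pos
    have hsum : ∑ w ∈ W, ((F'.filter fun f => w ∈ hit f).card : ℝ) =
        ∑ f ∈ F', ((hit f).card : ℝ) := by
      have : ∑ w ∈ W, (F'.filter fun f => w ∈ hit f).card = ∑ f ∈ F', (hit f).card := by
        simp only [Finset.card_filter]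
        rw [Finset.sum_comm]
        refine Finset.sum_congr rfl fun f hf => ?_
        rw [← Finset.card_filter]
        congr 1
        ext w
        rw [Finset.mem_filter]
        exact ⟨fun h => h.2, fun h => ⟨hsub f (Finset.filter_subset _ _ hf) h, h⟩⟩
      exact_mod_cast this
    have hge : (F'.card : ℝ) * (c * W.card) ≤ ∑ f ∈ F', ((hit f).card : ℝ) := by
      rw [← nsmul_eq_mul]
      exact Finset.card_nsmul_le_sum _ _ _ fun f hf => hlarge f (Finset.filter_subset _ _ hf)
    obtain ⟨w, hw, hwc⟩ : ∃ w ∈ W, (F'.card : ℝ) * c ≤ ((F'.filter fun f => w ∈ hit f).card : ℝ) := by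
      apply Finset.exists_le_of_sum_le hW
      rw [hsum, Finset.sum_const, nsmul_eq_mul]
      linarith
    refine ⟨insert w T, Finset.insert_subset hw hTW, (Finset.card_insert_le _ _).trans (by omega), ?_⟩
    have h1 : (F.filter fun f => Disjoint (hit f) (insert w T)) =
        F'.filter fun f => w ∉ hit f := by
      ext f
      simp only [hF', Finset.mem_filter, Finset.disjoint_insert_right]
      tauto
    have h2 := Finset.card_filter_add_card_filter_not (s := F') fun f => w ∈ hit f
    have h3 : ((F'.filter fun f => w ∈ hit f).card : ℝ) + (F'.filter fun f => w ∉ hit f).card =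
        F'.card := by exact_mod_cast h2
    rw [h1, pow_succ]
    have h4 : (F'.card : ℝ) * (1 - c) ≤ F.card * (1 - c) ^ t * (1 - c) :=
      mul_le_mul_of_nonneg_right hTF (by linarith)
    linarith

/-- Keeping at most `D` edges chosen by each vertex. -/
lemma exists_sparse_subgraph [Fintype V] (G : SimpleGraph V) (D : ℕ) :
    ∃ Γ ≤ G, (∀ v, min (nb G v).card D ≤ (nb Γ v).card) ∧ dsum Γ ≤ 2 * (Fintype.card V * D) := by
  classical
  have : ∀ v, ∃ S ⊆ nb G v, S.card = min (nb G v).card D := fun v =>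
    Finset.exists_subset_card_eq (min_le_left _ _)
  choose S hS hcard using this
  let Γ : SimpleGraph V :=
    { Adj := fun u v => u ∈ S v ∨ v ∈ S u
      symm := ⟨fun _ _ h => h.symm⟩
      loopless := ⟨fun v h => (mem_nb.mp (hS v (h.elim id id))).ne rfl⟩ }
  refine ⟨Γ, ?_, ?_, ?_⟩
  · rintro u v (h | h)
    · exact (mem_nb.mp (hS v h)).symm
    · exact mem_nb.mp (hS u h)
  · intro v
    rw [← hcard v]
    exact Finset.card_le_card fun u hu => mem_nb.mpr (Or.inr hu)
  · have h1 : ∀ v, (nb Γ v).card ≤ (S v).card + ∑ u, if v ∈ S u then 1 else 0 := by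
      intro v
      have : nb Γ v ⊆ S v ∪ Finset.univ.filter fun u => v ∈ S u := by
        intro u hu
        rw [mem_nb] at hu
        rw [Finset.mem_union, Finset.mem_filter]
        exact hu.symm.imp id fun h => ⟨Finset.mem_univ _, h⟩
      refine (Finset.card_le_card this).trans ((Finset.card_union_le _ _).trans ?_)
      rw [Finset.card_filter]
    unfold dsum
    refine (Finset.sum_le_sum fun v _ => h1 v).trans ?_
    rw [Finset.sum_add_distrib, Finset.sum_comm (s := Finset.univ) (t := Finset.univ)]
    have h2 : ∀ u, (∑ v, if v ∈ S u then 1 else 0) = (S u).card := by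
      intro u; simp
    rw [Finset.sum_congr rfl fun u _ => h2 u, ← two_mul]
    apply Nat.mul_le_mul_left
    rw [← smul_eq_mul, ← Finset.card_univ]
    exact Finset.sum_le_card_nsmul _ _ _ fun v _ => (hcard v).trans_le (min_le_right _ _)

open Classical in
/-- Few edges suffice to join every not too small set `X` with the complement of every not too
large set `Z`. -/
lemma exists_hitting_graph [Fintype V] [Nonempty V] (G : SimpleGraph V) {δ s c β : ℝ} (hδ : 0 < δ)
    (hs : 0 < s) (hc1 : c ≤ 1)
    (hc : c * dsum G ≤ δ / 2 * Fintype.card V * s)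
    (h : ∀ Z : Finset V, (Z.card : ℝ) ≤ β →
      ((Finset.univ.filter fun v => ((nb G v \ Z).card : ℝ) ≤ s).card : ℝ) <
        δ / 2 * Fintype.card V)
    {t : ℕ} (ht : (4 : ℝ) ^ Fintype.card V * (1 - c) ^ t < 1) :
    ∃ Γ ≤ G, dsum Γ ≤ 2 * t ∧ ∀ X Z : Finset V, δ * Fintype.card V ≤ X.card →
      (Z.card : ℝ) ≤ β → ∃ x ∈ X, ∃ y ∉ Z, Γ.Adj x y := by
  have hnpos : (0 : ℝ) < Fintype.card V := by exact_mod_cast Fintype.card_pos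
  set W : Finset (V × V) := Finset.univ.filter fun p => G.Adj p.1 p.2 with hW
  let F : Finset (Finset V × Finset V) := Finset.univ.filter fun f =>
    δ * Fintype.card V ≤ f.1.card ∧ (f.2.card : ℝ) ≤ β
  let hit : Finset V × Finset V → Finset (V × V) := fun f =>
    W.filter fun p => p.1 ∈ f.1 ∧ p.2 ∉ f.2
  have hcardsum : ∀ (X Z : Finset V), (hit (X, Z)).card = ∑ x ∈ X, (nb G x \ Z).card := by
    intro X Z
    rw [← Finset.card_sigma]
    refine Finset.card_bij' (fun p _ => ⟨p.1, p.2⟩) (fun p _ => (p.1, p.2)) ?_ ?_ ?_ ?_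
    · rintro ⟨x, y⟩ hp
      simp only [hit, hW, Finset.mem_filter, Finset.mem_univ, true_and] at hp
      simp [hp]
    · rintro ⟨x, y⟩ hp
      simp only [Finset.mem_sigma, Finset.mem_sdiff, mem_nb] at hp
      simp [hit, hW, hp]
    · simp
    · simp
  have hWcard : W.card = dsum G := by
    have := hcardsum Finset.univ ∅
    simpa [hit, dsum] using this
  have hlarge : ∀ f ∈ F, δ / 2 * Fintype.card V * s ≤ (hit f).card ∧ (hit f).Nonempty := by
    rintro ⟨X, Z⟩ hf
    simp only [F, Finset.mem_filter, Finset.mem_univ, true_and] at hf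
    have h1 := h Z hf.2
    set B := Finset.univ.filter fun v => ((nb G v \ Z).card : ℝ) ≤ s with hB
    have h2 : (X.card : ℝ) ≤ (X \ B).card + B.card := by
      have := Finset.card_le_card_sdiff_add_card (s := X) (t := B)
      exact_mod_cast this
    have h3 : δ / 2 * Fintype.card V ≤ ((X \ B).card : ℝ) := by linarith [hf.1]
    have h4 : ((X \ B).card : ℝ) * s ≤ (hit (X, Z)).card := by
      rw [hcardsum]
      push_cast
      rw [← nsmul_eq_mul]
      refine (Finset.card_nsmul_le_sum _ _ _ fun x hx => ?_).trans
        (Finset.sum_le_sum_of_subset_of_nonneg (Finset.sdiff_subset (s := X) (t := B))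
          fun _ _ _ => by positivity)
      rw [Finset.mem_sdiff, hB, Finset.mem_filter, not_and, not_le] at hx
      exact (hx.2 (Finset.mem_univ _)).le
    have h5 : δ / 2 * Fintype.card V * s ≤ (hit (X, Z)).card := by
      refine le_trans ?_ h4
      gcongr
    refine ⟨h5, ?_⟩
    rw [← Finset.card_pos]
    have : (0 : ℝ) < (hit (X, Z)).card := lt_of_lt_of_le (by positivity) h5
    exact_mod_cast this
  rcases F.eq_empty_or_nonempty with hF | ⟨f₀, hf₀⟩
  · refine ⟨⊥, bot_le, ?_, ?_⟩
    · have : ∀ v, nb (⊥ : SimpleGraph V) v = ∅ := fun v => by ext u; simp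
      simp [dsum, this]
    · intro X Z hX hZ
      have : (X, Z) ∈ F := by simp [F, hX, hZ]
      simp [hF] at this
  · have hWne : W.Nonempty := (hlarge f₀ hf₀).2.mono (Finset.filter_subset _ _)
    obtain ⟨T, hTW, hTt, hTF⟩ := exists_hitting_set W F hit c hc1
      (fun f _ => Finset.filter_subset _ _)
      (fun f hf => by rw [hWcard]; exact hc.trans (hlarge f hf).1) hWne t
    have hFcard : (F.card : ℝ) ≤ 4 ^ Fintype.card V := by
      have h1 : F.card ≤ Fintype.card (Finset V × Finset V) := Finset.card_le_univ _
      rw [Fintype.card_prod, Fintype.card_finset, ← Nat.mul_pow] at h1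
      exact_mod_cast h1
    have hzero : (F.filter fun f => Disjoint (hit f) T).card = 0 := by
      have h1 : 0 ≤ (1 - c) ^ t := pow_nonneg (by linarith) _
      have h2 := hTF.trans (mul_le_mul_of_nonneg_right hFcard h1)
      have h3 := h2.trans_lt ht
      have h4 : (F.filter fun f => Disjoint (hit f) T).card < 1 := by exact_mod_cast h3
      omega
    rw [Finset.card_eq_zero] at hzero
    let Γ : SimpleGraph V :=
      { Adj := fun u v => (u, v) ∈ T ∨ (v, u) ∈ T
        symm := ⟨fun _ _ h => h.symm⟩
        loopless := ⟨fun v h => by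
          have := hTW (h.elim id id)
          simp [hW] at this⟩ }
    refine ⟨Γ, ?_, ?_, ?_⟩
    · rintro u v (h | h)
      · simpa [hW] using hTW h
      · simpa [hW, G.adj_comm] using hTW h
    · refine le_trans ?_ (Nat.mul_le_mul_left 2 hTt)
      have h1 : ∀ v, (nb Γ v).card ≤ (T.filter fun p => p.1 = v).card +
          (T.filter fun p => p.2 = v).card := by
        intro v
        have : nb Γ v ⊆ (T.filter fun p => p.1 = v).image Prod.snd ∪
            (T.filter fun p => p.2 = v).image Prod.fst := by
          intro u hu
          rw [mem_nb] at hu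
          rw [Finset.mem_union, Finset.mem_image, Finset.mem_image]
          rcases hu with hu | hu
          · exact Or.inl ⟨(v, u), by simp [hu], rfl⟩
          · exact Or.inr ⟨(u, v), by simp [hu], rfl⟩
        exact (Finset.card_le_card this).trans ((Finset.card_union_le _ _).trans
          (Nat.add_le_add Finset.card_image_le Finset.card_image_le))
      refine (Finset.sum_le_sum fun v _ => h1 v).trans (le_of_eq ?_)
      have h2 : T.card = ∑ v, (T.filter fun p => p.1 = v).card :=
        Finset.card_eq_sum_card_fiberwise (f := Prod.fst) (fun _ _ => Finset.mem_univ _)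
      have h3 : T.card = ∑ v, (T.filter fun p => p.2 = v).card :=
        Finset.card_eq_sum_card_fiberwise (f := Prod.snd) (fun _ _ => Finset.mem_univ _)
      rw [Finset.sum_add_distrib, ← h2, ← h3, two_mul]
    · intro X Z hX hZ
      have hf : (X, Z) ∈ F := by simp [F, hX, hZ]
      have : ¬ Disjoint (hit (X, Z)) T := by
        intro hd
        have : (X, Z) ∈ F.filter fun f => Disjoint (hit f) T := Finset.mem_filter.mpr ⟨hf, hd⟩
        simp [hzero] at this
      rw [Finset.not_disjoint_iff] at this
      obtain ⟨⟨x, y⟩, h1, h2⟩ := this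
      simp only [hit, Finset.mem_filter] at h1
      exact ⟨x, h1.2.1, y, h1.2.2, Or.inl h2⟩

/-- Small sets expand in a graph in which low-degree vertices are far apart, codegrees are
small, and small sets are sparse. -/
lemma small_expansion [Fintype V] [DecidableEq V] {Γ H : SimpleGraph V} (hΓH : Γ ≤ H) {S : Finset V}
    {D K : ℝ} {r : ℕ} (hDK : 4 * K + 3 ≤ D) (hΓ2 : ∀ v, 2 ≤ (nb Γ v).card)
    (hΓD : ∀ v ∉ S, D ≤ (nb Γ v).card)
    (hcodeg : ∀ u v, u ≠ v → (nb H u ∩ nb H v).card ≤ 2)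
    (h1 : ∀ u ∈ S, ∀ v ∈ S, ¬ H.Adj u v)
    (h2 : ∀ u ∈ S, ∀ v ∈ S, u ≠ v → ∀ x, H.Adj u x → ¬ H.Adj x v)
    (h4 : ∀ u ∈ S, ∀ v ∈ S, u ≠ v → ∀ x y z, H.Adj u x → H.Adj x y → H.Adj y z → ¬ H.Adj z v)
    (hsparse : ∀ U : Finset V, U.Nonempty → U.card ≤ 4 * r →
      ((∑ u ∈ U, (nb H u ∩ U).card : ℕ) : ℝ) < K * U.card)
    (X : Finset V) (hX : X.card ≤ r) : 2 * X.card ≤ (bdry Γ X).card := by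
  set T := X ∩ S with hT
  set L := X \ S with hL
  have hTL : T.card + L.card = X.card := Finset.card_inter_add_card_sdiff X S
  set NS : Finset V := S.biUnion (nb H) with hNS
  have hfew : ∀ l ∉ S, (nb H l ∩ (S ∪ NS)).card ≤ 3 := by
    intro l hl
    have ha : (nb H l ∩ S).card ≤ 1 := by
      rw [Finset.card_le_one]
      intro a ha b hb
      rw [Finset.mem_inter, mem_nb] at ha hb
      by_contra hab
      exact h2 a ha.2 b hb.2 hab l ha.1.symm hb.1
    have hb : (nb H l ∩ NS).card ≤ 2 := by
      rcases (nb H l ∩ NS).eq_empty_or_nonempty with he | ⟨x, hx⟩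
      · simp [he]
      · rw [Finset.mem_inter, mem_nb, hNS, Finset.mem_biUnion] at hx
        obtain ⟨hlx, s, hs, hsx⟩ := hx
        rw [mem_nb] at hsx
        have hls : l ≠ s := fun h => hl (h ▸ hs)
        refine le_trans (Finset.card_le_card ?_) (hcodeg l s hls)
        intro y hy
        rw [Finset.mem_inter, mem_nb, hNS, Finset.mem_biUnion] at hy
        obtain ⟨hly, s', hs', hsy⟩ := hy
        rw [mem_nb] at hsy
        rw [Finset.mem_inter, mem_nb, mem_nb]
        refine ⟨hly, ?_⟩
        by_contra hne
        have hss : s ≠ s' := by rintro rfl; exact hne hsy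
        exact h4 s hs s' hs' hss x l y hsx hlx.symm hly hsy.symm
    rw [Finset.inter_union_distrib_left]
    exact (Finset.card_union_le _ _).trans (by omega)
  set Q := (L.biUnion (nb Γ)) \ (L ∪ (S ∪ NS)) with hQ
  have hQcard : 3 * L.card ≤ Q.card := by
    by_contra hlt
    push Not at hlt
    have hLne : L.Nonempty := by
      rw [← Finset.card_pos]; omega
    set U := L ∪ Q with hU
    have hUcard : U.card ≤ 4 * L.card := (Finset.card_union_le _ _).trans (by omega)
    have hs := hsparse U (hLne.mono Finset.subset_union_left) (by omega)
    have hge : (L.card : ℝ) * (D - 3) ≤ ((∑ u ∈ U, (nb H u ∩ U).card : ℕ) : ℝ) := by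
      push_cast
      rw [← nsmul_eq_mul]
      refine (Finset.card_nsmul_le_sum L (fun u => ((nb H u ∩ U).card : ℝ)) _ fun l hl => ?_).trans
        (Finset.sum_le_sum_of_subset_of_nonneg Finset.subset_union_left
          fun _ _ _ => by positivity)
      have hlS : l ∉ S := (Finset.mem_sdiff.mp hl).2
      have hsub : nb Γ l ⊆ (nb H l ∩ U) ∪ (nb H l ∩ (S ∪ NS)) := by
        intro u hu
        have huH := nb_mono hΓH l hu
        rw [Finset.mem_union, Finset.mem_inter, Finset.mem_inter]
        by_cases hc : u ∈ S ∪ NS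
        · exact Or.inr ⟨huH, hc⟩
        · left
          refine ⟨huH, ?_⟩
          rw [hU, Finset.mem_union]
          by_cases huL : u ∈ L
          · exact Or.inl huL
          · right
            rw [hQ, Finset.mem_sdiff, Finset.mem_union, Finset.mem_biUnion]
            exact ⟨⟨l, hl, hu⟩, fun h => h.elim huL hc⟩
      have hcard := (Finset.card_le_card hsub).trans (Finset.card_union_le _ _)
      have h5 := hfew l hlS
      have h6 : (nb Γ l).card ≤ (nb H l ∩ U).card + 3 := by omega
      have h7 : ((nb Γ l).card : ℝ) ≤ (nb H l ∩ U).card + 3 := by exact_mod_cast h6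
      have h8 := hΓD l hlS
      linarith
    have hLpos : (0 : ℝ) < L.card := by exact_mod_cast hLne.card_pos
    have hUc : (U.card : ℝ) ≤ 4 * L.card := by exact_mod_cast hUcard
    have hK : 0 < K * U.card := lt_of_le_of_lt (Nat.cast_nonneg _) hs
    have hK' : 0 < K := pos_of_mul_pos_left hK (Nat.cast_nonneg _)
    have h9 := mul_le_mul_of_nonneg_left hUc hK'.le
    have h10 := mul_le_mul_of_nonneg_left (show 4 * K ≤ D - 3 by linarith) hLpos.le
    linarith
  set R := (T.biUnion (nb Γ)) \ L with hR
  have hTn : 2 * T.card ≤ (T.biUnion (nb Γ)).card := by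
    rw [Finset.card_biUnion]
    · rw [mul_comm, ← smul_eq_mul]
      exact Finset.card_nsmul_le_sum _ _ _ fun v _ => hΓ2 v
    · intro u hu v hv huv
      rw [Function.onFun, Finset.disjoint_left]
      intro x hx hx'
      rw [mem_nb] at hx hx'
      exact h2 u (Finset.mem_inter.mp hu).2 v (Finset.mem_inter.mp hv).2 huv x (hΓH hx)
        (hΓH hx').symm
  have hRcard : 2 * T.card ≤ R.card + L.card :=
    hTn.trans (Finset.card_le_card_sdiff_add_card)
  have hdisj : Disjoint Q R := by
    rw [Finset.disjoint_left]
    intro x hxQ hxR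
    rw [hQ, Finset.mem_sdiff] at hxQ
    rw [hR, Finset.mem_sdiff, Finset.mem_biUnion] at hxR
    obtain ⟨⟨t, ht, hx⟩, -⟩ := hxR
    apply hxQ.2
    rw [Finset.mem_union, Finset.mem_union]
    right; right
    rw [hNS, Finset.mem_biUnion]
    exact ⟨t, (Finset.mem_inter.mp ht).2, nb_mono hΓH t hx⟩
  have hsub : Q ∪ R ⊆ bdry Γ X := by
    intro x hx
    rw [mem_bdry]
    rw [Finset.mem_union] at hx
    have hXTL : ∀ y ∈ X, y ∈ S ∨ y ∈ L := by
      intro y hy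
      by_cases hyS : y ∈ S
      · exact Or.inl hyS
      · exact Or.inr (Finset.mem_sdiff.mpr ⟨hy, hyS⟩)
    rcases hx with hx | hx
    · rw [hQ, Finset.mem_sdiff, Finset.mem_biUnion, Finset.mem_union, Finset.mem_union] at hx
      obtain ⟨⟨l, hl, hlx⟩, hx2⟩ := hx
      refine ⟨fun hxX => ?_, l, (Finset.mem_sdiff.mp hl).1, mem_nb.mp hlx⟩
      rcases hXTL x hxX with h | h
      · exact hx2 (Or.inr (Or.inl h))
      · exact hx2 (Or.inl h)
    · rw [hR, Finset.mem_sdiff, Finset.mem_biUnion] at hx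
      obtain ⟨⟨t, ht, htx⟩, hx2⟩ := hx
      rw [mem_nb] at htx
      refine ⟨fun hxX => ?_, t, (Finset.mem_inter.mp ht).1, htx⟩
      rcases hXTL x hxX with h | h
      · exact h1 t (Finset.mem_inter.mp ht).2 x h (hΓH htx)
      · exact hx2 h
  have := Finset.card_le_card hsub
  rw [Finset.card_union_of_disjoint hdisj] at this
  omega

open Classical in
/-- The deterministic part of the argument: a graph without sparse obstructions is Hamiltonian. -/
theorem isHam_of_robust [Fintype V] (hV : 3 ≤ Fintype.card V) {G H : SimpleGraph V} (hGH : G ≤ H)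
    (hG2 : ∀ v, 2 ≤ (nb G v).card) {S : Finset V} {D : ℕ} (hD2 : 2 ≤ D)
    (hGD : ∀ v ∉ S, D ≤ (nb G v).card)
    (hcodeg : ∀ u v, u ≠ v → (nb H u ∩ nb H v).card ≤ 2)
    (h1 : ∀ u ∈ S, ∀ v ∈ S, ¬ H.Adj u v)
    (h2 : ∀ u ∈ S, ∀ v ∈ S, u ≠ v → ∀ x, H.Adj u x → ¬ H.Adj x v)
    (h4 : ∀ u ∈ S, ∀ v ∈ S, u ≠ v → ∀ x y z, H.Adj u x → H.Adj x y → H.Adj y z → ¬ H.Adj z v)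
    {K δ : ℝ} (hDK : 4 * K + 3 ≤ D) (hδ : 0 < δ) (hδ8 : δ ≤ 1 / 8)
    (hsparse : ∀ U : Finset V, U.Nonempty → (U.card : ℝ) ≤ 4 * δ * Fintype.card V →
      ((∑ u ∈ U, (nb H u ∩ U).card : ℕ) : ℝ) < K * U.card)
    {β s c : ℝ} (hβ : Fintype.card V ≤ 2 * β) (hs : 0 < s) (hc1 : c ≤ 1)
    (hc : c * dsum G ≤ δ / 2 * Fintype.card V * s)
    (hhit : ∀ Z : Finset V, (Z.card : ℝ) ≤ β →
      ((Finset.univ.filter fun v => ((nb G v \ Z).card : ℝ) ≤ s).card : ℝ) <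
        δ / 2 * Fintype.card V)
    {t : ℕ} (ht : (4 : ℝ) ^ Fintype.card V * (1 - c) ^ t < 1)
    {M : ℕ} (hM : 0 < M) (col : V → Fin M)
    (hcol : ∀ c, ((Finset.univ.filter fun v => col v = c).card : ℝ) ≤ 2 * Fintype.card V / M)
    {d : ℝ} (hd : 0 < d) (hlow : (dsum G : ℝ) ≤ d * (Fintype.card V / 16))
    {M1 M2 : ℝ}
    (hM1 : 2 * Fintype.card V * D + 2 * t + 2 * (Fintype.card V : ℝ) ≤ M1)
    (hM2 : M1 + 2 * (2 * Fintype.card V / M * d) ≤ M2)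
    (hgen1 : ∀ Γ ≤ G, (dsum Γ : ℝ) ≤ M1 → ∀ (a : V) (Z : Finset V), (Z.card : ℝ) ≤ β →
      ((Finset.univ.filter fun b => nb G b ⊆ shiftSet Γ a Z b).card : ℝ) <
        (Fintype.card V : ℝ) / (32 * M))
    (hgen2 : ∀ Γ ≤ G, (dsum Γ : ℝ) ≤ M2 → ((Finset.univ.filter fun a => nb G a ⊆ (ends Γ a)ᶜ ∧
      ((ends Γ a)ᶜ.card : ℝ) ≤ β).card : ℝ) < (Fintype.card V : ℝ) / 512) : IsHam G := by
  have hcardpos : 0 < Fintype.card V := by omega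
  have hne : Nonempty V := Fintype.card_pos_iff.mp hcardpos
  have hnpos : (0 : ℝ) < Fintype.card V := by exact_mod_cast hcardpos
  obtain ⟨Γ₁, hΓ₁G, hΓ₁, hdΓ₁⟩ := exists_sparse_subgraph G D
  obtain ⟨Γ₂, hΓ₂G, hdΓ₂, hΓ₂⟩ := exists_hitting_graph G hδ hs hc1 hc hhit ht
  have hsmall : ∀ X : Finset V, X.card ≤ ⌊δ * Fintype.card V⌋₊ →
      2 * X.card ≤ (bdry Γ₁ X).card := by
    refine small_expansion (hΓ₁G.trans hGH) hDK (fun v => ?_) (fun v hv => ?_) hcodeg h1 h2 h4 ?_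
    · exact (le_min (hG2 v) hD2).trans (hΓ₁ v)
    · exact_mod_cast (le_min (hGD v hv) le_rfl).trans (hΓ₁ v)
    · intro U hU hUr
      refine hsparse U hU ?_
      have h5 : (U.card : ℝ) ≤ 4 * ⌊δ * Fintype.card V⌋₊ := by exact_mod_cast hUr
      have := Nat.floor_le (show 0 ≤ δ * Fintype.card V by positivity)
      linarith
  have hexp : ∀ X : Finset V, X.card ≤ Fintype.card V / 8 →
      2 * X.card ≤ (bdry (Γ₁ ⊔ Γ₂) X).card := by
    intro X hX
    rcases lt_or_ge (X.card : ℝ) (δ * Fintype.card V) with hlt | hge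
    · refine (hsmall X (Nat.le_floor hlt.le)).trans (Finset.card_le_card fun v hv => ?_)
      rw [mem_bdry] at hv ⊢
      obtain ⟨h5, x, hx, h6⟩ := hv
      exact ⟨h5, x, hx, Or.inl h6⟩
    · by_contra hlt
      push Not at hlt
      have hZ : (X ∪ bdry (Γ₁ ⊔ Γ₂) X).card ≤ 3 * X.card :=
        (Finset.card_union_le _ _).trans (by omega)
      have hZ' : 8 * (X ∪ bdry (Γ₁ ⊔ Γ₂) X).card ≤ 3 * Fintype.card V := by omega
      have hZ'' : (8 : ℝ) * (X ∪ bdry (Γ₁ ⊔ Γ₂) X).card ≤ 3 * Fintype.card V := by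
        exact_mod_cast hZ'
      obtain ⟨x, hx, y, hy, hxy⟩ := hΓ₂ X _ hge (by linarith : ((X ∪ bdry (Γ₁ ⊔ Γ₂) X).card : ℝ) ≤ β)
      apply hy
      rw [Finset.mem_union, mem_bdry]
      by_cases hyX : y ∈ X
      · exact Or.inl hyX
      · exact Or.inr ⟨hyX, x, hx, Or.inr hxy⟩
  have hΓG : Γ₁ ⊔ Γ₂ ≤ G := sup_le hΓ₁G hΓ₂G
  have hconn' : ∀ C : Finset V, C.Nonempty → 2 * C.card ≤ Fintype.card V →
      ∃ x ∈ C, ∃ y ∉ C, G.Adj x y := by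
    intro C hC hCcard
    rcases le_or_gt C.card (Fintype.card V / 8) with hle | hgt
    · have h5 := hexp C hle
      have h6 := hC.card_pos
      obtain ⟨y, hy⟩ := Finset.card_pos.mp (show 0 < (bdry (Γ₁ ⊔ Γ₂) C).card by omega)
      rw [mem_bdry] at hy
      obtain ⟨hy, x, hx, hxy⟩ := hy
      exact ⟨x, hx, y, hy, hΓG hxy⟩
    · have h5 : (2 : ℝ) * C.card ≤ Fintype.card V := by exact_mod_cast hCcard
      have h6 : Fintype.card V ≤ 8 * C.card := by omega
      have h7 : (Fintype.card V : ℝ) ≤ 8 * C.card := by exact_mod_cast h6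
      obtain ⟨x, hx, y, hy, hxy⟩ := hΓ₂ C C (by nlinarith) (by linarith)
      exact ⟨x, hx, y, hy, hΓ₂G hxy⟩
  have hconn : ∀ C : Finset V, C.Nonempty → C ≠ Finset.univ → ∃ x ∈ C, ∃ y ∉ C, G.Adj x y := by
    intro C hC hCu
    rcases le_or_gt (2 * C.card) (Fintype.card V) with hle | hgt
    · exact hconn' C hC hle
    · have h5 := Finset.card_add_card_compl C
      have hCc : Cᶜ.Nonempty := by
        rw [Finset.nonempty_iff_ne_empty, Ne, Finset.compl_eq_empty_iff]
        exact hCu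
      obtain ⟨x, hx, y, hy, hxy⟩ := hconn' Cᶜ hCc (by omega)
      rw [Finset.mem_compl] at hx hy
      rw [not_not] at hy
      exact ⟨y, hy, x, hx, hxy.symm⟩
  set low : Finset V := Finset.univ.filter fun v => ((nb G v).card : ℝ) ≤ d with hlowdef
  refine isHam_of_sparse_expander hV G (Γ₁ ⊔ Γ₂) hΓG hexp hconn hM col hcol low d ?_ ?_ hβ ?_ hM2
    hgen1 hgen2
  · have h5 : (lowᶜ.card : ℝ) * d ≤ dsum G := by
      rw [← nsmul_eq_mul]
      unfold dsum
      push_cast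
      refine (Finset.card_nsmul_le_sum lowᶜ (fun v => ((nb G v).card : ℝ)) _ fun v hv => ?_).trans
        (Finset.sum_le_sum_of_subset_of_nonneg (Finset.subset_univ _)
          fun _ _ _ => Nat.cast_nonneg _)
      rw [Finset.mem_compl, hlowdef, Finset.mem_filter, not_and, not_le] at hv
      exact (hv (Finset.mem_univ _)).le
    have h6 := h5.trans hlow
    rw [mul_comm] at h6
    exact le_of_mul_le_mul_left h6 hd
  · intro v hv
    exact (Finset.mem_filter.mp hv).2
  · refine le_trans ?_ hM1
    have h5 := dsum_sup_le Γ₁ Γ₂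
    have h6 : dsum (Γ₁ ⊔ Γ₂) ≤ 2 * Fintype.card V * D + 2 * t := by
      rw [mul_assoc]; omega
    have h7 : (dsum (Γ₁ ⊔ Γ₂) : ℝ) ≤ 2 * Fintype.card V * D + 2 * t := by exact_mod_cast h6
    linarith

/-! ### Graphs given by sets of edges -/

/-- The edge joining two distinct vertices. -/
def ed {n : ℕ} (u v : Fin n) (h : u ≠ v) : EdgeType n := ⟨s(u, v), by simpa using h⟩

lemma ed_comm {n : ℕ} (u v : Fin n) (h : u ≠ v) : ed u v h = ed v u h.symm :=
  Subtype.ext Sym2.eq_swap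

lemma exists_eq_ed {n : ℕ} (e : EdgeType n) : ∃ u v h, e = ed u v h := by
  obtain ⟨e, he⟩ := e
  induction e with | h u v => exact ⟨u, v, by simpa using he, rfl⟩

lemma ed_eq_iff {n : ℕ} {u v u' v' : Fin n} {h : u ≠ v} {h' : u' ≠ v'} :
    ed u v h = ed u' v' h' ↔ (u = u' ∧ v = v') ∨ (u = v' ∧ v = u') := by
  simp [ed]

/-- The graph with edge set `A`. -/
def edgesGraph {n : ℕ} (A : Set (EdgeType n)) : SimpleGraph (Fin n) where
  Adj u v := ∃ h : u ≠ v, ed u v h ∈ A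
  symm := ⟨fun u v ⟨h, hA⟩ => ⟨h.symm, by rwa [ed_comm]⟩⟩
  loopless := ⟨fun _ h => h.1 rfl⟩

lemma edgesGraph_adj {n : ℕ} {A : Set (EdgeType n)} {u v : Fin n} :
    (edgesGraph A).Adj u v ↔ ∃ h : u ≠ v, ed u v h ∈ A := Iff.rfl

lemma edgesGraph_mono {n : ℕ} {A B : Set (EdgeType n)} (h : A ⊆ B) :
    edgesGraph A ≤ edgesGraph B := fun _ _ ⟨hne, hA⟩ => ⟨hne, h hA⟩

lemma processGraph_eq {n : ℕ} (σ : ProcessSpace n) (m : ℕ) :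
    processGraph σ m = edgesGraph {e | (σ.symm e : ℕ) < m} := by
  ext u v
  rw [processGraph, SimpleGraph.fromEdgeSet_adj, edgesGraph_adj]
  constructor
  · rintro ⟨⟨i, hi, hie⟩, hne⟩
    refine ⟨hne, ?_⟩
    have : σ i = ed u v hne := Subtype.ext hie
    change (σ.symm (ed u v hne) : ℕ) < m
    rw [← this, Equiv.symm_apply_apply]
    exact hi
  · rintro ⟨hne, h⟩
    exact ⟨⟨σ.symm (ed u v hne), h, by rw [Equiv.apply_symm_apply]; rfl⟩, hne⟩

lemma processGraph_mono {n : ℕ} (σ : ProcessSpace n) {m m' : ℕ} (h : m ≤ m') :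
    processGraph σ m ≤ processGraph σ m' := by
  rw [processGraph_eq, processGraph_eq]
  exact edgesGraph_mono fun e he => lt_of_lt_of_le he h

/-- The ordered pairs that represent an edge. -/
def fib {n : ℕ} (e : EdgeType n) : Finset (Fin n × Fin n) :=
  Finset.univ.filter fun p => s(p.1, p.2) = e.1

lemma fib_ed {n : ℕ} (u v : Fin n) (h : u ≠ v) : fib (ed u v h) = {(u, v), (v, u)} := by
  ext ⟨x, y⟩
  simp [fib, ed]

lemma sum_fib_ed {n : ℕ} (u v : Fin n) (h : u ≠ v) (g : Fin n × Fin n → ℝ) :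
    ∑ p ∈ fib (ed u v h), g p = g (u, v) + g (v, u) := by
  rw [fib_ed, Finset.sum_pair]
  intro heq
  exact h (Prod.mk.inj heq).1

/-- Summing over edges the sums over their orientations is summing over ordered pairs. -/
lemma sum_sum_fib {n : ℕ} (g : Fin n × Fin n → ℝ) :
    ∑ e : EdgeType n, ∑ p ∈ fib e, g p = ∑ p : Fin n × Fin n, if p.1 = p.2 then 0 else g p := by
  unfold fib
  simp_rw [Finset.sum_filter]
  rw [Finset.sum_comm]
  refine Finset.sum_congr rfl fun p _ => ?_
  split_ifs with h
  · refine Finset.sum_eq_zero fun e _ => ?_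
    rw [if_neg]
    intro heq
    exact e.2 (by rw [← heq]; simpa using h)
  · rw [Finset.sum_eq_single (ed p.1 p.2 h)]
    · simp [ed]
    · intro e _ hne
      rw [if_neg]
      intro heq
      exact hne (Subtype.ext heq.symm)
    · simp

lemma card_edgeType (n : ℕ) : Fintype.card (EdgeType n) = n.choose 2 := by
  have := Sym2.card_subtype_not_diag (α := Fin n)
  rw [Fintype.card_fin] at this
  rw [← this]

open Classical in
/-- The edges of a graph. -/
def edgesOf {n : ℕ} (G : SimpleGraph (Fin n)) : Finset (EdgeType n) :=
  Finset.univ.filter fun e => (e : Sym2 (Fin n)) ∈ G.edgeSet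

lemma ed_mem_edgesOf {n : ℕ} {G : SimpleGraph (Fin n)} {u v : Fin n} {h : u ≠ v} :
    ed u v h ∈ edgesOf G ↔ G.Adj u v := by
  simp [edgesOf, ed]

lemma edgesGraph_edgesOf {n : ℕ} (G : SimpleGraph (Fin n)) :
    edgesGraph (edgesOf G : Set (EdgeType n)) = G := by
  ext u v
  rw [edgesGraph_adj]
  exact ⟨fun ⟨_, h⟩ => ed_mem_edgesOf.mp h, fun h => ⟨h.ne, ed_mem_edgesOf.mpr h⟩⟩

lemma edgesOf_edgesGraph {n : ℕ} (A : Finset (EdgeType n)) :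
    edgesOf (edgesGraph (A : Set (EdgeType n))) = A := by
  ext e
  obtain ⟨u, v, h, rfl⟩ := exists_eq_ed e
  rw [ed_mem_edgesOf, edgesGraph_adj]
  exact ⟨fun ⟨_, h⟩ => h, fun h' => ⟨h, h'⟩⟩

lemma card_nb_eq_sum {n : ℕ} (A : Set (EdgeType n)) [DecidablePred (· ∈ A)] (v : Fin n)
    (F : Finset (Fin n)) : (nb (edgesGraph A) v ∩ F).card =
      ∑ w, if h : v ≠ w then (if ed v w h ∈ A ∧ w ∈ F then 1 else 0) else 0 := by
  classical
  have : nb (edgesGraph A) v ∩ F =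
      Finset.univ.filter fun w => ∃ h : v ≠ w, ed v w h ∈ A ∧ w ∈ F := by
    ext w
    simp [edgesGraph_adj]
  rw [this, Finset.card_filter]
  refine Finset.sum_congr rfl fun w _ => ?_
  by_cases h : v = w <;> simp [h]

lemma dsum_eq_two_mul {n : ℕ} (G : SimpleGraph (Fin n)) : dsum G = 2 * (edgesOf G).card := by
  classical
  have h1 : ∀ v, (nb G v).card = G.degree v := by
    intro v
    rw [← SimpleGraph.card_neighborFinset_eq_degree]
    congr 1
    ext u
    simp
  unfold dsum
  rw [Finset.sum_congr rfl fun v _ => h1 v, SimpleGraph.sum_degrees_eq_twice_card_edges]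
  congr 1
  refine (Finset.card_bij (fun e _ => e.1) ?_ ?_ ?_).symm
  · intro e he
    simpa [edgesOf] using he
  · intro e _ e' _ h
    exact Subtype.ext h
  · intro e he
    rw [SimpleGraph.mem_edgeFinset] at he
    exact ⟨⟨e, G.not_isDiag_of_mem_edgeSet he⟩, by simpa [edgesOf] using he, rfl⟩

lemma dsum_processGraph_le {n : ℕ} (σ : ProcessSpace n) (m : ℕ) :
    dsum (processGraph σ m) ≤ 2 * m := by
  rw [dsum_eq_two_mul]
  apply Nat.mul_le_mul_left
  have : edgesOf (processGraph σ m) ⊆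
      (Finset.univ.filter fun i : Fin (Fintype.card (EdgeType n)) => (i : ℕ) < m).map σ.toEmbedding := by
    intro e he
    obtain ⟨u, v, h, rfl⟩ := exists_eq_ed e
    rw [ed_mem_edgesOf, processGraph_eq, edgesGraph_adj] at he
    obtain ⟨_, he⟩ := he
    rw [Finset.mem_map]
    exact ⟨σ.symm (ed u v h), by simpa using he, by simp⟩
  refine (Finset.card_le_card this).trans ?_
  rw [Finset.card_map]
  calc (Finset.univ.filter fun i : Fin (Fintype.card (EdgeType n)) => (i : ℕ) < m).card
      = ((Finset.univ.filter fun i : Fin (Fintype.card (EdgeType n)) => (i : ℕ) < m).map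
          Fin.valEmbedding).card := (Finset.card_map _).symm
    _ ≤ (Finset.range m).card := by
        apply Finset.card_le_card
        intro i hi
        simp only [Finset.mem_map, Finset.mem_filter, Finset.mem_univ, true_and] at hi
        obtain ⟨j, hj, rfl⟩ := hi
        simpa using hj
    _ = m := Finset.card_range m

/-! ### Vertices that send most of their edges to a given set -/

open Classical in
/-- The vertices that send at least the proportion `α` of their edges to a prescribed set, up to
an error `s`. -/
def viol {n : ℕ} (G : SimpleGraph (Fin n)) (F : Fin n → Finset (Fin n)) (α s : ℝ) :
    Finset (Fin n) :=
  Finset.univ.filter fun v => α * (nb G v).card ≤ (nb G v ∩ F v).card + s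

lemma exp_le_one_add_add_sq {x : ℝ} (hx : |x| ≤ 1) : Real.exp x ≤ 1 + (x + x ^ 2) := by
  have := (abs_le.mp (Real.abs_exp_sub_one_sub_id_le hx)).2
  linarith

lemma Pr_forall_viol_le {n : ℕ} {q : Fin 3 → ℝ} (hq : ∀ i, 0 ≤ q i) (hq1 : ∑ i, q i = 1)
    (A : Finset (EdgeType n)) (U : Finset (Fin n)) (F : Fin n → Finset (Fin n))
    {α s β l : ℝ} (hα0 : 0 ≤ α) (hα1 : α ≤ 1) (hl0 : 0 ≤ l) (hl : l ≤ 1 / 2)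
    (hF : ∀ v, ((F v).card : ℝ) ≤ β) :
    Pr q {ω : EdgeType n → Fin 3 | (∀ e ∈ A, ω e = 0) ∧ U ⊆ viol (edgesGraph {e | ω e = 0}) F α s} ≤
      (q 0 * Real.exp 2) ^ A.card *
        Real.exp (U.card * (l * s + q 0 * (l * (β - α * (n - 1)) + 2 * l ^ 2 * n))) := by
  classical
  set g : Fin n × Fin n → ℝ := fun p => if p.1 ∈ U then (if p.2 ∈ F p.1 then 1 else 0) - α else 0
    with hg
  have hg1 : ∀ p, |g p| ≤ 1 := by
    intro p
    simp only [hg]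
    split_ifs <;> rw [abs_le] <;> constructor <;> linarith
  set c : EdgeType n → ℝ := fun e => ∑ p ∈ fib e, g p with hc
  have hc2 : ∀ e, |c e| ≤ 2 ∧ c e ^ 2 ≤ 2 * ∑ p ∈ fib e, g p ^ 2 := by
    intro e
    obtain ⟨u, v, h, rfl⟩ := exists_eq_ed e
    simp only [hc]
    rw [sum_fib_ed, sum_fib_ed]
    constructor
    · have := abs_add_le (g (u, v)) (g (v, u))
      linarith [hg1 (u, v), hg1 (v, u)]
    · nlinarith [sq_nonneg (g (u, v) - g (v, u))]
  have hsumc : ∑ e, c e ≤ U.card * (β - α * (n - 1)) := by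
    rw [hc, sum_sum_fib, Fintype.sum_prod_type, ← nsmul_eq_mul]
    have h1 : ∀ u : Fin n, (∑ v, if u = v then 0 else g (u, v)) ≤
        if u ∈ U then β - α * (n - 1) else 0 := by
      intro u
      by_cases hu : u ∈ U
      · simp only [hg, hu, if_true]
        have h2 : ∀ v, (if u = v then 0 else (if v ∈ F u then (1 : ℝ) else 0) - α) ≤
            (if v ∈ F u then (1 : ℝ) else 0) - (if u = v then 0 else α) := by
          intro v; split_ifs <;> linarith
        refine (Finset.sum_le_sum fun v _ => h2 v).trans ?_
        rw [Finset.sum_sub_distrib]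
        have h3 : ∑ v, (if v ∈ F u then (1 : ℝ) else 0) = (F u).card := by simp
        have h4 : ∑ v, (if u = v then 0 else α) = α * (n - 1) := by
          have : ∀ v, (if u = v then 0 else α) = α - if u = v then α else 0 := by
            intro v; split_ifs <;> ring
          rw [Finset.sum_congr rfl fun v _ => this v, Finset.sum_sub_distrib]
          simp; ring
        rw [h3, h4]
        linarith [hF u]
      · simp [hg, hu]
    refine (Finset.sum_le_sum fun u _ => h1 u).trans ?_
    rw [← Finset.sum_filter, Finset.filter_mem_eq_inter, Finset.univ_inter, Finset.sum_const]
  have hsumsq : ∑ e, c e ^ 2 ≤ U.card * (2 * n) := by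
    refine (Finset.sum_le_sum fun e _ => (hc2 e).2).trans ?_
    rw [← Finset.mul_sum, sum_sum_fib, Fintype.sum_prod_type]
    have h1 : ∀ u : Fin n, (∑ v, if u = v then 0 else g (u, v) ^ 2) ≤ if u ∈ U then (n : ℝ) else 0 := by
      intro u
      by_cases hu : u ∈ U
      · rw [if_pos hu]
        calc (∑ v, if u = v then 0 else g (u, v) ^ 2) ≤ ∑ v : Fin n, (1 : ℝ) := by
              refine Finset.sum_le_sum fun v _ => ?_
              split_ifs
              · norm_num
              · have := hg1 (u, v)
                rw [← sq_abs]
                nlinarith [abs_nonneg (g (u, v))]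
          _ = n := by simp
      · simp [hg, hu]
    have h2 := Finset.sum_le_sum fun u (_ : u ∈ Finset.univ) => h1 u
    rw [← Finset.sum_filter, Finset.filter_mem_eq_inter, Finset.univ_inter, Finset.sum_const,
      nsmul_eq_mul] at h2
    simp only at h2 ⊢
    linarith
  let f : EdgeType n → Fin 3 → ℝ := fun e j =>
    if j = 0 then Real.exp (l * c e) else if e ∈ A then 0 else 1
  have hf : ∀ e j, 0 ≤ f e j := by
    intro e j
    simp only [f]
    split_ifs <;> positivity
  have h1 := Pr_le_prod hq (S := {ω : EdgeType n → Fin 3 | (∀ e ∈ A, ω e = 0) ∧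
      U ⊆ viol (edgesGraph {e | ω e = 0}) F α s}) (C := Real.exp (l * (U.card * s)))
      (Real.exp_nonneg _) f hf ?_
  · refine h1.trans ?_
    have h2 : ∀ e, ∑ j, q j * f e j ≤ (if e ∈ A then q 0 * Real.exp 2 else 1) *
        Real.exp (q 0 * (l * c e + l ^ 2 * c e ^ 2)) := by
      intro e
      have hq0 := hq 0
      have hq0' : q 0 ≤ 1 := by
        rw [← hq1]
        exact Finset.single_le_sum (fun i _ => hq i) (Finset.mem_univ _)
      have habs := (hc2 e).1
      have hlc : |l * c e| ≤ 1 := by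
        rw [abs_mul, abs_of_nonneg hl0]
        nlinarith [abs_nonneg (c e)]
      rw [Fin.sum_univ_three] at hq1 ⊢
      simp only [f, if_true, Fin.isValue, one_ne_zero, if_false, Fin.reduceEq]
      split_ifs with he
      · rw [mul_zero, mul_zero, add_zero, add_zero, mul_assoc, ← Real.exp_add]
        apply mul_le_mul_of_nonneg_left _ hq0
        apply Real.exp_le_exp.mpr
        have h3 := abs_le.mp hlc
        have h4 : -1 ≤ q 0 * (l * c e + l ^ 2 * c e ^ 2) := by
          have h5 : -1 ≤ l * c e + l ^ 2 * c e ^ 2 := by nlinarith [sq_nonneg (l * c e)]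
          nlinarith
        linarith
      · have h3 := exp_le_one_add_add_sq hlc
        have h4 := Real.add_one_le_exp (q 0 * (l * c e + l ^ 2 * c e ^ 2))
        have h5 := mul_le_mul_of_nonneg_left h3 hq0
        rw [one_mul]
        refine le_trans ?_ h4
        nlinarith
    have h3 : ∏ e, ∑ j, q j * f e j ≤ ∏ e, ((if e ∈ A then q 0 * Real.exp 2 else 1) *
        Real.exp (q 0 * (l * c e + l ^ 2 * c e ^ 2))) :=
      Finset.prod_le_prod (fun e _ => Finset.sum_nonneg fun j _ => mul_nonneg (hq j) (hf e j))
        fun e _ => h2 e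
    refine (mul_le_mul_of_nonneg_left h3 (Real.exp_nonneg _)).trans ?_
    rw [Finset.prod_mul_distrib, Finset.prod_ite_mem, Finset.univ_inter, Finset.prod_const,
      ← Real.exp_sum, mul_left_comm, ← Real.exp_add]
    have hq0 := hq 0
    apply mul_le_mul_of_nonneg_left _ (by positivity)
    apply Real.exp_le_exp.mpr
    rw [← Finset.mul_sum, Finset.sum_add_distrib, ← Finset.mul_sum, ← Finset.mul_sum]
    have h4 : q 0 * (l * ∑ e, c e + l ^ 2 * ∑ e, c e ^ 2) ≤
        q 0 * (l * (U.card * (β - α * (n - 1))) + l ^ 2 * (U.card * (2 * n))) := by gcongr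
    refine (add_le_add_right h4 _).trans (le_of_eq ?_)
    ring
  · rintro ω ⟨hA, hU⟩
    have h2 : ∏ e, f e (ω e) = Real.exp (l * ∑ e, if ω e = 0 then c e else 0) := by
      rw [Finset.mul_sum, Real.exp_sum]
      refine Finset.prod_congr rfl fun e _ => ?_
      simp only [f]
      by_cases h : ω e = 0
      · simp [h]
      · have : e ∉ A := fun he => h (hA e he)
        simp [h, this]
    rw [h2, ← Real.exp_add, Real.one_le_exp_iff, ← mul_add]
    refine mul_nonneg hl0 ?_
    set R : Set (EdgeType n) := {e | ω e = 0} with hR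
    have h3 : ∑ e, (if ω e = 0 then c e else 0) =
        ∑ u ∈ U, (((nb (edgesGraph R) u ∩ F u).card : ℝ) - α * (nb (edgesGraph R) u).card) := by
      have h4 : ∀ e, (if ω e = 0 then c e else 0) =
          ∑ p ∈ fib e, if h : p.1 ≠ p.2 then (if ed p.1 p.2 h ∈ R then g p else 0) else 0 := by
        intro e
        obtain ⟨u, v, h, rfl⟩ := exists_eq_ed e
        simp only [hc]
        rw [sum_fib_ed, sum_fib_ed]
        simp only [dif_pos h, dif_pos h.symm, ed_comm v u h.symm]
        by_cases h' : ω (ed u v h) = 0 <;> simp [hR, h']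
      rw [Finset.sum_congr rfl fun e _ => h4 e, sum_sum_fib, Fintype.sum_prod_type,
        ← Finset.sum_subset (Finset.subset_univ U)]
      · refine Finset.sum_congr rfl fun u hu => ?_
        have h5 := card_nb_eq_sum R u (F u)
        have h6 := card_nb_eq_sum R u Finset.univ
        rw [Finset.inter_univ] at h6
        rw [h5, h6]
        push_cast
        rw [Finset.mul_sum, ← Finset.sum_sub_distrib]
        refine Finset.sum_congr rfl fun v _ => ?_
        by_cases huv : u = v
        · simp [huv]
        · by_cases huR : ed u v huv ∈ R <;> by_cases hvF : v ∈ F u <;>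
            simp [huv, huR, hg, hu, hvF]
      · intro u _ hu
        refine Finset.sum_eq_zero fun v _ => ?_
        simp [hg, hu]
    rw [h3]
    have h4 : -(U.card * s) ≤
        ∑ u ∈ U, (((nb (edgesGraph R) u ∩ F u).card : ℝ) - α * (nb (edgesGraph R) u).card) := by
      have h5 : (U.card : ℝ) * (-s) ≤ ∑ u ∈ U, (((nb (edgesGraph R) u ∩ F u).card : ℝ) -
          α * (nb (edgesGraph R) u).card) := by
        rw [← nsmul_eq_mul]
        refine Finset.card_nsmul_le_sum _ _ _ fun u hu => ?_
        have := hU hu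
        rw [viol, Finset.mem_filter] at this
        linarith [this.2]
      linarith
    linarith

lemma binomial_term_step_up {N m k : ℕ} (hm : m ≤ N) (hk : k < m) :
    N.choose k * m ^ k * (N - m) ^ (N - k) ≤
      N.choose (k + 1) * m ^ (k + 1) * (N - m) ^ (N - (k + 1)) := by
  have h1 := Nat.choose_succ_right_eq N k
  have h2 : (k + 1) * (N - m) ≤ (N - k) * m := by
    zify [hm, (hk.le.trans hm)]
    have : (k : ℤ) + 1 ≤ m := by exact_mod_cast hk
    have : (0 : ℤ) ≤ N := by positivity
    nlinarith
  have h3 : N - k = N - (k + 1) + 1 := by omega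
  refine le_of_mul_le_mul_left ?_ (show 0 < k + 1 from Nat.succ_pos k)
  calc (k + 1) * (N.choose k * m ^ k * (N - m) ^ (N - k))
      = (N.choose k * m ^ k * (N - m) ^ (N - (k + 1))) * ((k + 1) * (N - m)) := by
        rw [h3, pow_succ]; ring
    _ ≤ (N.choose k * m ^ k * (N - m) ^ (N - (k + 1))) * ((N - k) * m) :=
        Nat.mul_le_mul_left _ h2
    _ = (N.choose k * (N - k)) * m ^ (k + 1) * (N - m) ^ (N - (k + 1)) := by rw [pow_succ]; ring
    _ = _ := by rw [← h1]; ring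

lemma binomial_term_step_down {N m k : ℕ} (hm : m ≤ N) (hk : m ≤ k) (hkN : k < N) :
    N.choose (k + 1) * m ^ (k + 1) * (N - m) ^ (N - (k + 1)) ≤
      N.choose k * m ^ k * (N - m) ^ (N - k) := by
  have h1 := Nat.choose_succ_right_eq N k
  have h2 : (N - k) * m ≤ (k + 1) * (N - m) := by
    zify [hm, hkN.le]
    have : (m : ℤ) ≤ k := by exact_mod_cast hk
    have : (m : ℤ) ≤ N := by exact_mod_cast hm
    have : (0 : ℤ) ≤ N := by positivity
    nlinarith
  have h3 : N - k = N - (k + 1) + 1 := by omega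
  refine le_of_mul_le_mul_left ?_ (show 0 < k + 1 from Nat.succ_pos k)
  calc (k + 1) * (N.choose (k + 1) * m ^ (k + 1) * (N - m) ^ (N - (k + 1)))
      = (N.choose k * m ^ k * (N - m) ^ (N - (k + 1))) * ((N - k) * m) := by
        rw [show (k + 1) * (N.choose (k + 1) * m ^ (k + 1) * (N - m) ^ (N - (k + 1))) =
          (N.choose (k + 1) * (k + 1)) * m ^ (k + 1) * (N - m) ^ (N - (k + 1)) by ring, h1, pow_succ]
        ring
    _ ≤ (N.choose k * m ^ k * (N - m) ^ (N - (k + 1))) * ((k + 1) * (N - m)) :=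
        Nat.mul_le_mul_left _ h2
    _ = _ := by rw [h3, pow_succ]; ring

/-- The mean of a binomial distribution, if integral, is a mode. -/
lemma binomial_term_le {N m k : ℕ} (hm : m ≤ N) (hk : k ≤ N) :
    N.choose k * m ^ k * (N - m) ^ (N - k) ≤ N.choose m * m ^ m * (N - m) ^ (N - m) := by
  rcases le_total k m with h | h
  · induction h using Nat.decreasingInduction with
    | self => exact le_rfl
    | of_succ k hkm ih => exact (binomial_term_step_up hm hkm).trans (ih (by omega))
  · induction k, h using Nat.le_induction with
    | base => exact le_rfl
    | succ k hmk ih => exact (binomial_term_step_down hm hmk (by omega)).trans (ih (by omega))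

lemma pow_le_binomial_term {N m : ℕ} (hm : m ≤ N) :
    N ^ N ≤ (N + 1) * (N.choose m * m ^ m * (N - m) ^ (N - m)) := by
  have h1 := add_pow m (N - m) N
  rw [Nat.add_sub_cancel' hm] at h1
  rw [h1]
  have h2 := Finset.sum_le_card_nsmul (Finset.range (N + 1))
    (fun k => m ^ k * (N - m) ^ (N - k) * N.choose k) _ fun k hk => by
      have := binomial_term_le hm (Nat.lt_succ_iff.mp (Finset.mem_range.mp hk))
      calc m ^ k * (N - m) ^ (N - k) * N.choose k = N.choose k * m ^ k * (N - m) ^ (N - k) := by ring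
        _ ≤ _ := this
  simpa using h2

section

variable {E : Type*} [Fintype E] [DecidableEq E]

/-- The label weights for a binomial subset with expected size `m`. -/
def qm (p : ℝ) : Fin 3 → ℝ := ![p, 1 - p, 0]

lemma qm_nonneg {p : ℝ} (hp : 0 ≤ p) (hp1 : p ≤ 1) (i : Fin 3) : 0 ≤ qm p i := by
  fin_cases i <;> simp [qm, hp, hp1]

lemma qm_sum (p : ℝ) : ∑ i, qm p i = 1 := by
  simp [qm, Fin.sum_univ_three]

lemma le_Pr_cnt_eq {m : ℕ} (hm : m ≤ Fintype.card E) (hE : 0 < Fintype.card E) :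
    1 / ((Fintype.card E : ℝ) + 1) ≤
      Pr (qm ((m : ℝ) / Fintype.card E)) {ω : E → Fin 3 | cnt {0} ω = m} := by
  classical
  set N := Fintype.card E with hN
  have hNpos : (0 : ℝ) < N := by exact_mod_cast hE
  set p : ℝ := (m : ℝ) / N with hp
  have hmN : (m : ℝ) ≤ N := by exact_mod_cast hm
  have hp0 : 0 ≤ p := by positivity
  have hp1 : p ≤ 1 := by rw [hp, div_le_one hNpos]; exact hmN
  have h1 : (N.choose m : ℝ) * (p ^ m * (1 - p) ^ (N - m)) ≤
      Pr (qm p) {ω : E → Fin 3 | cnt {0} ω = m} := by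
    let w : Finset E → (E → Fin 3) := fun A e => if e ∈ A then 0 else 1
    have hmem : ∀ A e, w A e ∈ ({0} : Finset (Fin 3)) ↔ e ∈ A := by
      intro A e
      by_cases h : e ∈ A <;> simp [w, h]
    have hwinj : Function.Injective w := by
      intro A B h
      ext e
      rw [← hmem A, ← hmem B, h]
    have hwt : ∀ A ∈ (Finset.univ : Finset E).powersetCard m,
        wt (qm p) (w A) = p ^ m * (1 - p) ^ (N - m) := by
      intro A hA
      rw [Finset.mem_powersetCard] at hA
      have h2 : ∀ e, qm p (w A e) = if e ∈ A then p else 1 - p := by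
        intro e
        by_cases h : e ∈ A <;> simp [w, h, qm]
      unfold wt
      rw [Finset.prod_congr rfl fun e _ => h2 e, Finset.prod_ite, Finset.prod_const,
        Finset.prod_const, Finset.filter_mem_eq_inter, Finset.univ_inter, hA.2]
      congr 2
      have h3 := Finset.card_filter_add_card_filter_not (s := (Finset.univ : Finset E)) (· ∈ A)
      rw [Finset.filter_mem_eq_inter, Finset.univ_inter, hA.2, Finset.card_univ] at h3
      omega
    have h2 : ((Finset.univ : Finset E).powersetCard m).card = N.choose m := by
      rw [Finset.card_powersetCard, Finset.card_univ]
    rw [← h2, ← nsmul_eq_mul, ← Finset.sum_const, ← Finset.sum_congr rfl hwt]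
    rw [show Pr (qm p) {ω : E → Fin 3 | cnt {0} ω = m} =
      ∑ ω ∈ Finset.univ.filter (fun ω : E → Fin 3 => cnt {0} ω = m), wt (qm p) ω by
        rw [Finset.sum_filter]; unfold Pr; exact Finset.sum_congr rfl fun _ _ => by congr]
    rw [show ∑ A ∈ (Finset.univ : Finset E).powersetCard m, wt (qm p) (w A) = _ from
      (Finset.sum_map _ ⟨w, hwinj⟩ (wt (qm p))).symm]
    refine Finset.sum_le_sum_of_subset_of_nonneg ?_ fun ω _ _ => wt_nonneg (qm_nonneg hp0 hp1) ω
    intro ω hω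
    rw [Finset.mem_map] at hω
    obtain ⟨A, hA, rfl⟩ := hω
    rw [Finset.mem_powersetCard] at hA
    rw [Finset.mem_filter]
    refine ⟨Finset.mem_univ _, ?_⟩
    change cnt {0} (w A) = m
    unfold cnt
    rw [Finset.filter_congr fun e _ => hmem A e, Finset.filter_mem_eq_inter, Finset.univ_inter, hA.2]
  refine le_trans ?_ h1
  have h2 : ((N : ℝ) ^ N) ≤ (N + 1) * (N.choose m * m ^ m * (N - m) ^ (N - m)) := by
    have := pow_le_binomial_term hm
    have h3 : ((N ^ N : ℕ) : ℝ) ≤ (((N + 1) * (N.choose m * m ^ m * (N - m) ^ (N - m)) : ℕ) : ℝ) := by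
      exact_mod_cast this
    push_cast [Nat.cast_sub hm] at h3
    exact h3
  have h3 : p ^ m * (1 - p) ^ (N - m) = (m ^ m * ((N : ℝ) - m) ^ (N - m)) / N ^ N := by
    have h4 : 1 - p = ((N : ℝ) - m) / N := by rw [hp]; field_simp
    have h5 : (N : ℝ) ^ N = N ^ m * N ^ (N - m) := by rw [← pow_add, Nat.add_sub_cancel' hm]
    rw [h4, hp, div_pow, div_pow, h5]
    field_simp
  rw [h3, div_le_iff₀ (by positivity)]
  have h4 : (N.choose m : ℝ) * (m ^ m * ((N : ℝ) - m) ^ (N - m) / N ^ N) * (N + 1) =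
      ((N + 1) * (N.choose m * m ^ m * ((N : ℝ) - m) ^ (N - m))) / N ^ N := by ring
  rw [h4, le_div_iff₀ (by positivity), one_mul]
  exact h2

omit [DecidableEq E] in
lemma sum_small_sets_le {x a Y : ℝ} (hx : 0 ≤ x) (hY : 0 ≤ Y) :
    ∑ A : Finset E with (A.card : ℝ) ≤ a, x ^ A.card ≤
      Real.exp (a * Y + x * Real.exp (-Y) * Fintype.card E) := by
  classical
  have h1 : ∀ A ∈ (Finset.univ : Finset (Finset E)).filter (fun A => (A.card : ℝ) ≤ a), x ^ A.card ≤
      Real.exp (a * Y) * ((x * Real.exp (-Y)) ^ A.card * 1 ^ (Fintype.card E - A.card)) := by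
    intro A hA
    rw [Finset.mem_filter] at hA
    rw [one_pow, mul_one, mul_pow, ← Real.exp_nat_mul, mul_left_comm, ← Real.exp_add]
    refine le_mul_of_one_le_right (by positivity) ?_
    rw [Real.one_le_exp_iff]
    have := mul_le_mul_of_nonneg_right hA.2 hY
    linarith
  refine (Finset.sum_le_sum h1).trans ?_
  have h2 : ∑ A ∈ (Finset.univ : Finset (Finset E)).filter (fun A => (A.card : ℝ) ≤ a),
      Real.exp (a * Y) * ((x * Real.exp (-Y)) ^ A.card * 1 ^ (Fintype.card E - A.card)) ≤
      ∑ A : Finset E, Real.exp (a * Y) * ((x * Real.exp (-Y)) ^ A.card *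
        1 ^ (Fintype.card E - A.card)) :=
    Finset.sum_le_sum_of_subset_of_nonneg (Finset.filter_subset _ _)
      fun _ _ _ => by positivity
  refine h2.trans ?_
  rw [← Finset.mul_sum, Fintype.sum_pow_mul_eq_add_pow, Real.exp_add]
  refine mul_le_mul_of_nonneg_left ?_ (Real.exp_nonneg _)
  rw [mul_comm _ (Fintype.card E : ℝ), Real.exp_nat_mul]
  have := Real.add_one_le_exp (x * Real.exp (-Y))
  gcongr

end

/-- In the random graph process, for all sparse subgraphs `Γ` of `G_m` simultaneously, few
vertices send too many edges to sets that are determined by `Γ`. -/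
theorem PP_viol_le {n m : ℕ} (hm : m ≤ Fintype.card (EdgeType n))
    (hN : 0 < Fintype.card (EdgeType n)) {J : Type*} [Fintype J]
    (F : SimpleGraph (Fin n) → J → Fin n → Finset (Fin n)) {α s β l a h Y : ℝ}
    (hα0 : 0 ≤ α) (hα1 : α ≤ 1) (hl0 : 0 ≤ l) (hl : l ≤ 1 / 2) (hY : 0 ≤ Y)
    (hF : ∀ Γ j v, ((F Γ j v).card : ℝ) ≤ β)
    (hX : l * s + (m : ℝ) / Fintype.card (EdgeType n) *
      (l * (β - α * (n - 1)) + 2 * l ^ 2 * n) ≤ 0) :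
    PP {σ : ProcessSpace n | ∃ Γ ≤ processGraph σ m, (dsum Γ : ℝ) ≤ 2 * a ∧
        ∃ j, h ≤ (viol (processGraph σ m) (F Γ j) α s).card} ≤
      (Fintype.card (EdgeType n) + 1) * (Fintype.card J * 2 ^ n *
        Real.exp (a * Y + m * Real.exp (2 - Y) + h * (l * s + (m : ℝ) / Fintype.card (EdgeType n) *
          (l * (β - α * (n - 1)) + 2 * l ^ 2 * n)))) := by
  classical
  set N := Fintype.card (EdgeType n) with hNdef
  have hNpos : (0 : ℝ) < N := by exact_mod_cast hN
  set p : ℝ := (m : ℝ) / N with hp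
  have hmN : (m : ℝ) ≤ N := by exact_mod_cast hm
  have hp0 : 0 ≤ p := by positivity
  have hp1 : p ≤ 1 := by rw [hp, div_le_one hNpos]; exact hmN
  set X := l * s + p * (l * (β - α * (n - 1)) + 2 * l ^ 2 * n) with hXdef
  have hq := qm_nonneg hp0 hp1
  set Bad : Set (EdgeType n → Fin 3) := {ω | ∃ A : Finset (EdgeType n), (A.card : ℝ) ≤ a ∧
    ∃ j, ∃ U : Finset (Fin n), h ≤ U.card ∧ (∀ e ∈ A, ω e = 0) ∧
      U ⊆ viol (edgesGraph {e | ω e = 0}) (F (edgesGraph (A : Set (EdgeType n))) j) α s} with hBad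
  have h1 := PP_mul_Pr_le hq (Ω₀ := {ω : EdgeType n → Fin 3 | cnt {0} ω = m}) (Bad := Bad)
    (Ev := {σ : ProcessSpace n | ∃ Γ ≤ processGraph σ m, (dsum Γ : ℝ) ≤ 2 * a ∧
        ∃ j, h ≤ (viol (processGraph σ m) (F Γ j) α s).card})
    (fun ω hω π => by
      change cnt {0} (ω ∘ π) = m
      rw [cnt_comp]; exact hω) ?_
  · have h2 := le_Pr_cnt_eq hm hN
    have h3 : Pr (qm p) Bad ≤ Fintype.card J * 2 ^ n *
        Real.exp (a * Y + m * Real.exp (2 - Y) + h * X) := by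
      have h4 := Pr_le_sum hq (S := Bad)
        (((Finset.univ : Finset (Finset (EdgeType n))).filter fun A => (A.card : ℝ) ≤ a) ×ˢ
          ((Finset.univ : Finset J) ×ˢ
            (Finset.univ : Finset (Finset (Fin n))).filter fun U => h ≤ U.card))
        (fun i => {ω : EdgeType n → Fin 3 | (∀ e ∈ i.1, ω e = 0) ∧
          i.2.2 ⊆ viol (edgesGraph {e | ω e = 0})
            (F (edgesGraph (i.1 : Set (EdgeType n))) i.2.1) α s}) (by
          rintro ω ⟨A, hA, j, U, hU, h5, h6⟩
          exact ⟨(A, j, U), by simp [hA, hU], h5, h6⟩)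
      refine h4.trans ?_
      have h5 : ∀ i ∈ (((Finset.univ : Finset (Finset (EdgeType n))).filter
          fun A => (A.card : ℝ) ≤ a) ×ˢ ((Finset.univ : Finset J) ×ˢ
            (Finset.univ : Finset (Finset (Fin n))).filter fun U => h ≤ U.card)),
          Pr (qm p) {ω : EdgeType n → Fin 3 | (∀ e ∈ i.1, ω e = 0) ∧
            i.2.2 ⊆ viol (edgesGraph {e | ω e = 0})
              (F (edgesGraph (i.1 : Set (EdgeType n))) i.2.1) α s} ≤
          (p * Real.exp 2) ^ i.1.card * Real.exp (h * X) := by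
        rintro ⟨A, j, U⟩ hi
        simp only [Finset.mem_product, Finset.mem_filter, Finset.mem_univ, true_and] at hi
        refine (Pr_forall_viol_le hq (qm_sum p) A U _ hα0 hα1 hl0 hl (hF _ j)).trans ?_
        refine mul_le_mul_of_nonneg_left ?_ (by have := hq 0; positivity)
        apply Real.exp_le_exp.mpr
        exact mul_le_mul_of_nonpos_right hi.2 hX
      refine (Finset.sum_le_sum h5).trans ?_
      rw [Finset.sum_product]
      simp only [Finset.sum_const]
      rw [← Finset.smul_sum, ← Finset.sum_mul, nsmul_eq_mul, Finset.card_product, Finset.card_univ]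
      have h6 := sum_small_sets_le (E := EdgeType n) (x := p * Real.exp 2) (a := a)
        (by positivity) hY
      have h7 : p * Real.exp 2 * Real.exp (-Y) * Fintype.card (EdgeType n) =
          m * Real.exp (2 - Y) := by
        rw [← hNdef, mul_assoc p, ← Real.exp_add, hp, ← sub_eq_add_neg]
        field_simp
      rw [h7] at h6
      have h8 : (((Finset.univ : Finset (Finset (Fin n))).filter fun U => h ≤ U.card).card : ℝ) ≤
          2 ^ n := by
        have := Finset.card_le_univ ((Finset.univ : Finset (Finset (Fin n))).filter
          fun U => h ≤ U.card)
        rw [Fintype.card_finset, Fintype.card_fin] at this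
        exact_mod_cast this
      rw [Real.exp_add _ (h * X), Nat.cast_mul]
      gcongr
    have h4 := mul_le_mul_of_nonneg_left h2 (PP_nonneg {σ : ProcessSpace n |
      ∃ Γ ≤ processGraph σ m, (dsum Γ : ℝ) ≤ 2 * a ∧
        ∃ j, h ≤ (viol (processGraph σ m) (F Γ j) α s).card})
    have h5 := (h4.trans h1).trans h3
    rw [mul_one_div, div_le_iff₀ (by positivity)] at h5
    linarith
  · rintro ω hω σ ⟨Γ, hΓ, hd, j, hj⟩ hmono
    have hω' : cnt {0} ω = m := hω
    have hset : {e | (σ.symm e : ℕ) < m} = {e | ω e = 0} := by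
      have hJ : ∀ i j : Fin 3, i ≤ j → j ∈ ({0} : Finset (Fin 3)) → i ∈ ({0} : Finset (Fin 3)) := by
        decide
      ext e
      constructor
      · intro he
        simpa using label_mem_of_lt hJ hmono hω'.ge he
      · intro he
        exact lt_of_cnt_le hJ hmono hω'.le (by simpa using he)
    rw [processGraph_eq, hset] at hΓ hj
    refine ⟨edgesOf Γ, ?_, j, _, hj, ?_, ?_⟩
    · rw [dsum_eq_two_mul] at hd
      push_cast at hd
      linarith
    · intro e he
      obtain ⟨u, v, huv, rfl⟩ := exists_eq_ed e
      obtain ⟨_, h⟩ := hΓ (ed_mem_edgesOf.mp he)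
      exact h
    · rw [edgesGraph_edgesOf]

lemma tendsto_log_nat : Tendsto (fun n : ℕ => Real.log n) atTop atTop :=
  Real.tendsto_log_atTop.comp tendsto_natCast_atTop_atTop

lemma eventually_le_log (C : ℝ) : ∀ᶠ n : ℕ in atTop, C ≤ Real.log n :=
  tendsto_log_nat.eventually_ge_atTop C

lemma eventually_le_nat (C : ℝ) : ∀ᶠ n : ℕ in atTop, C ≤ n :=
  tendsto_natCast_atTop_atTop.eventually_ge_atTop C

lemma eventually_mul_log_le {c : ℝ} (hc : 0 < c) : ∀ᶠ n : ℕ in atTop, Real.log n ≤ c * n := by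
  have h1 := (Real.isLittleO_log_id_atTop.comp_tendsto
    (tendsto_natCast_atTop_atTop (R := ℝ))).def hc
  filter_upwards [h1] with n hn
  simp only [Function.comp, id, Real.norm_eq_abs, Nat.abs_cast] at hn
  exact (le_abs_self _).trans hn

lemma card_edgeType_cast (n : ℕ) : (Fintype.card (EdgeType n) : ℝ) = n * (n - 1) / 2 := by
  rw [card_edgeType, Nat.cast_choose_two]

set_option maxHeartbeats 800000 in
/-- Away from an exponentially unlikely event, all small subgraphs of `G_m` determine sets that
are rarely over-represented in neighbourhoods. -/
lemma exists_PP_viol_le {ε η : ℝ} (hε : 0 < ε) (hε1 : ε ≤ 1 / 4) (hη : 0 < η) (hη1 : η ≤ 1) :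
    ∃ θ : ℝ, 0 < θ ∧ ∀ᶠ n : ℕ in atTop, ∀ m : ℕ, n * Real.log n / 4 ≤ m → m ≤ n * Real.log n →
      ∀ (J : Type) [Fintype J], (Fintype.card J : ℝ) ≤ 4 ^ n →
      ∀ F : SimpleGraph (Fin n) → J → Fin n → Finset (Fin n),
      (∀ Γ j v, ((F Γ j v).card : ℝ) ≤ (1 / 2 + ε / 2) * n) →
      PP {σ : ProcessSpace n | ∃ Γ ≤ processGraph σ m,
        (dsum Γ : ℝ) ≤ 2 * (θ * (n * Real.log n)) ∧
        ∃ j, η * n ≤ (viol (processGraph σ m) (F Γ j) (1 / 2 + ε) (ε / 32 * Real.log n)).card} ≤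
      Real.exp (-n) := by
  set ζ : ℝ := ε ^ 2 * η / 1024 with hζ
  have hζ0 : 0 < ζ := by positivity
  have hζ1 : ζ ≤ 1 := by
    have : ε ^ 2 ≤ 1 := by nlinarith
    rw [hζ, div_le_one (by norm_num)]
    nlinarith
  set Y : ℝ := 2 - Real.log ζ with hY
  have hlogζ : Real.log ζ ≤ 0 := Real.log_nonpos hζ0.le hζ1
  have hY0 : 0 < Y := by linarith
  have hexpY : Real.exp (2 - Y) = ζ := by rw [hY, _root_.sub_sub_cancel, Real.exp_log hζ0]
  refine ⟨ζ / Y, by positivity, ?_⟩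
  filter_upwards [eventually_le_log (1 / ζ), eventually_le_log 1, eventually_le_nat (96 / ε),
    eventually_le_nat 2, eventually_mul_log_le (c := 1 / 4) (by norm_num)]
    with n hL hL1 hn96 hn2 hnL m hm1 hm2 J _ hJ F hF
  set L := Real.log n with hLdef
  have hn0 : (0 : ℝ) < n := by linarith
  have hNcast := card_edgeType_cast n
  have hN0 : (0 : ℝ) < Fintype.card (EdgeType n) := by
    rw [hNcast]; have : (0 : ℝ) < n - 1 := by linarith
    positivity
  have hmN : m ≤ Fintype.card (EdgeType n) := by
    have : (m : ℝ) ≤ Fintype.card (EdgeType n) := by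
      rw [hNcast]
      have : (1 / 4 * n : ℝ) ≤ (n - 1) / 2 := by linarith
      nlinarith
    exact_mod_cast this
  set p : ℝ := (m : ℝ) / Fintype.card (EdgeType n) with hp
  have hpn : L / 2 ≤ p * n := by
    rw [hp, div_mul_eq_mul_div, le_div_iff₀ hN0, hNcast]
    nlinarith [mul_nonneg (mul_nonneg hn0.le hn0.le) (by linarith : (0 : ℝ) ≤ L)]
  have hpn2 : p * n ≤ 4 * L := by
    rw [hp, div_mul_eq_mul_div, div_le_iff₀ hN0, hNcast]
    have h1 : (m : ℝ) * n ≤ n * L * n := mul_le_mul_of_nonneg_right hm2 hn0.le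
    have h2 : (0 : ℝ) ≤ L * n := by positivity
    nlinarith
  set X := ε / 8 * (ε / 32 * L) + p * (ε / 8 * ((1 / 2 + ε / 2) * n - (1 / 2 + ε) * (n - 1)) +
      2 * (ε / 8) ^ 2 * n) with hX
  have hXle : X ≤ -(ε ^ 2 * L / 128) := by
    have e1 : X = ε ^ 2 * L / 256 - ε ^ 2 / 32 * (p * n) + p * (ε / 8 * (1 / 2 + ε)) := by
      rw [hX]; ring
    have h96 : 96 ≤ n * ε := by rwa [div_le_iff₀ hε] at hn96
    have hp0 : 0 ≤ p := by positivity
    have e2 : p * (ε / 8 * (1 / 2 + ε)) ≤ ε ^ 2 * L / 256 := by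
      have e3 : p * 96 ≤ 4 * L * ε := by
        calc p * 96 ≤ p * (n * ε) := mul_le_mul_of_nonneg_left h96 hp0
          _ = (p * n) * ε := by ring
          _ ≤ _ := mul_le_mul_of_nonneg_right hpn2 hε.le
      have e4 : p * (ε / 8 * (1 / 2 + ε)) ≤ p * (ε / 8 * (3 / 4)) := by gcongr; linarith
      nlinarith
    have e3 : ε ^ 2 / 32 * (L / 2) ≤ ε ^ 2 / 32 * (p * n) := by gcongr
    rw [e1]
    linarith
  have hX0 : X ≤ 0 := by
    have : 0 ≤ ε ^ 2 * L / 128 := by positivity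
    linarith
  have hmain := PP_viol_le hmN (by exact_mod_cast hN0) F (α := 1 / 2 + ε) (s := ε / 32 * L)
    (β := (1 / 2 + ε / 2) * n) (l := ε / 8) (a := ζ / Y * (n * L)) (h := η * n) (Y := Y)
    (by linarith) (by linarith) (by linarith) (by linarith) hY0.le hF hX0
  rw [← hp, ← hX] at hmain
  refine hmain.trans ?_
  rw [hexpY]
  have h1 : ζ / Y * (n * L) * Y + m * ζ + η * n * X ≤ -(6 * ζ * (n * L)) := by
    have e1 : ζ / Y * (n * L) * Y = ζ * (n * L) := by field_simp
    have e2 : (m : ℝ) * ζ ≤ n * L * ζ := by gcongr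
    have e3 : η * n * X ≤ η * n * (-(ε ^ 2 * L / 128)) := by gcongr
    have e4 : η * n * (-(ε ^ 2 * L / 128)) = -(8 * ζ * (n * L)) := by rw [hζ]; ring
    rw [e1]; linarith
  have h2 : (1 : ℝ) ≤ ζ * L := by rwa [div_le_iff₀ hζ0, mul_comm] at hL
  have h3 : -(6 * ζ * (n * L)) ≤ -(6 * n : ℝ) := by
    have e1 : (n : ℝ) * 1 ≤ n * (ζ * L) := mul_le_mul_of_nonneg_left h2 hn0.le
    linarith
  have h4 : (Fintype.card (EdgeType n) : ℝ) + 1 ≤ Real.exp (2 * n) := by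
    have e1 : (n : ℝ) ≤ Real.exp n := by have := Real.add_one_le_exp (n : ℝ); linarith
    have e2 : Real.exp (2 * n) = Real.exp n * Real.exp n := by rw [← Real.exp_add]; ring_nf
    rw [e2, hNcast]
    nlinarith [Real.exp_pos (n : ℝ)]
  have h8 : (4 : ℝ) ^ n * 2 ^ n ≤ Real.exp (3 * n) := by
    have e1 : (2 : ℝ) ≤ Real.exp 1 := by have := Real.add_one_le_exp (1 : ℝ); linarith
    have e2 : Real.exp (3 * n) = (Real.exp 1 ^ 3) ^ n := by
      rw [← Real.exp_nat_mul, ← Real.exp_nat_mul]; push_cast; ring_nf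
    rw [e2, ← mul_pow]
    gcongr
    calc (4 : ℝ) * 2 = 2 ^ 3 := by norm_num
      _ ≤ _ := by gcongr
  calc _ ≤ Real.exp (2 * n) * (4 ^ n * 2 ^ n * Real.exp (-(6 * n))) := by
        gcongr
        exact h1.trans h3
    _ ≤ Real.exp (2 * n) * (Real.exp (3 * n) * Real.exp (-(6 * n))) := by gcongr
    _ = Real.exp (-n) := by rw [← Real.exp_add, ← Real.exp_add]; congr 1; ring

section

variable {E : Type*} [Fintype E] [DecidableEq E]

lemma PP_union_le (S T : Set (Fin (Fintype.card E) ≃ E)) : PP (S ∪ T) ≤ PP S + PP T := by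
  refine (PP_le_sum (Finset.univ : Finset Bool) (fun b => if b then S else T) ?_).trans
    (le_of_eq ?_)
  · rintro σ (h | h)
    · exact ⟨true, Finset.mem_univ _, by simpa using h⟩
    · exact ⟨false, Finset.mem_univ _, by simpa using h⟩
  · rw [Fintype.sum_bool]; simp

lemma PP_mono {S T : Set (Fin (Fintype.card E) ≃ E)} (h : S ⊆ T) : PP S ≤ PP T := by
  refine (PP_le_sum (Finset.univ : Finset Unit) (fun _ => T) ?_).trans (le_of_eq ?_)
  · exact fun σ hσ => ⟨(), Finset.mem_univ _, h hσ⟩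
  · simp

end

open Classical in
/-- Few vertices of `G` are badly connected to the sets on which rotations can get stuck. -/
structure RotationRobust {n : ℕ} (G : SimpleGraph (Fin n)) (ε θ M : ℝ) : Prop where
  shift : ∀ Γ ≤ G, (dsum Γ : ℝ) ≤ 2 * (θ * (n * Real.log n)) → ∀ (a : Fin n) (Z : Finset (Fin n)),
    (Z.card : ℝ) ≤ (1 / 2 + ε / 2) * n →
    ((viol G (shiftSet Γ a Z) (1 / 2 + ε) (ε / 32 * Real.log n)).card : ℝ) < n / (32 * M)
  ends : ∀ Γ ≤ G, (dsum Γ : ℝ) ≤ 2 * ((θ + 64 / M) * (n * Real.log n)) →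
    ((viol G (fun a => if ((ends Γ a)ᶜ.card : ℝ) ≤ (1 / 2 + ε / 2) * n then (ends Γ a)ᶜ else ∅)
      (1 / 2 + ε) (ε / 32 * Real.log n)).card : ℝ) < n / 512

theorem exists_rotationRobust {ε : ℝ} (hε : 0 < ε) (hε1 : ε ≤ 1 / 4) :
    ∃ M : ℕ, 0 < M ∧ ∃ θ : ℝ, 0 < θ ∧ ∀ᶠ n : ℕ in atTop, ∀ m : ℕ, n * Real.log n / 4 ≤ m →
      m ≤ n * Real.log n →
      PP {σ : ProcessSpace n | ¬ RotationRobust (processGraph σ m) ε θ M} ≤ 2 * Real.exp (-n) := by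
  classical
  obtain ⟨θ₂, hθ₂, hev₂⟩ := exists_PP_viol_le hε hε1 (η := 1 / 512) (by norm_num) (by norm_num)
  obtain ⟨M, hM⟩ := exists_nat_gt (128 / θ₂)
  have hM0 : (0 : ℝ) < M := lt_trans (by positivity) hM
  have hM1 : (1 : ℝ) ≤ M := by
    have : 0 < M := by exact_mod_cast hM0
    exact_mod_cast this
  obtain ⟨θ₁, hθ₁, hev₁⟩ := exists_PP_viol_le hε hε1 (η := 1 / (32 * M)) (by positivity)
    (by rw [div_le_one (by positivity)]; linarith)
  have hMθ : 64 / (M : ℝ) ≤ θ₂ / 2 := by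
    rw [div_lt_iff₀ hθ₂] at hM
    rw [div_le_iff₀ hM0]; linarith
  refine ⟨M, by exact_mod_cast hM0, min θ₁ (θ₂ / 2), by positivity, ?_⟩
  filter_upwards [hev₁, hev₂] with n h₁ h₂ m hm1 hm2
  have hL : 0 ≤ n * Real.log n := by have := Real.log_natCast_nonneg n; positivity
  have hn2 : (n : ℝ) ≤ 2 ^ n := by exact_mod_cast Nat.lt_two_pow_self.le
  have hβ : 0 ≤ (1 / 2 + ε / 2) * n := by positivity
  have hJ₁ : (Fintype.card (Fin n × Finset (Fin n)) : ℝ) ≤ 4 ^ n := by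
    rw [Fintype.card_prod, Fintype.card_finset, Fintype.card_fin]
    push_cast
    calc (n : ℝ) * 2 ^ n ≤ 2 ^ n * 2 ^ n := by gcongr
      _ = 4 ^ n := by rw [← mul_pow]; norm_num
  have hJ₂ : (Fintype.card Unit : ℝ) ≤ 4 ^ n := by
    simpa using one_le_pow₀ (M₀ := ℝ) (a := 4) (n := n) (by norm_num)
  have e₁ := h₁ m hm1 hm2 (Fin n × Finset (Fin n)) hJ₁
    (fun Γ j b => if ((shiftSet Γ j.1 j.2 b).card : ℝ) ≤ (1 / 2 + ε / 2) * n then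
      shiftSet Γ j.1 j.2 b else ∅)
    (fun Γ j v => by split_ifs with h; exacts [h, by simpa using hβ])
  have e₂ := h₂ m hm1 hm2 Unit hJ₂
    (fun Γ _ a => if ((ends Γ a)ᶜ.card : ℝ) ≤ (1 / 2 + ε / 2) * n then (ends Γ a)ᶜ else ∅)
    (fun Γ j v => by split_ifs with h; exacts [h, by simpa using hβ])
  refine (PP_mono ?_).trans ((PP_union_le _ _).trans ((add_le_add e₁ e₂).trans
    (by linarith)))
  intro σ hσ
  by_contra hcon
  apply hσ
  simp only [Set.mem_union, not_or, Set.mem_ofPred_eq, not_exists, not_and, not_le] at hcon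
  refine ⟨fun Γ hΓ hd a Z hZ => ?_, fun Γ hΓ hd => ?_⟩
  · have := hcon.1 Γ hΓ (hd.trans ?_) (a, Z)
    · rw [show (n : ℝ) / (32 * M) = 1 / (32 * M) * n by ring]
      have hle : ∀ b, ((shiftSet Γ a Z b).card : ℝ) ≤ (1 / 2 + ε / 2) * n := fun b =>
        le_trans (by exact_mod_cast card_shiftSet_le Γ a Z b) hZ
      simp only [hle, if_true] at this
      exact this
    · gcongr; exact min_le_left _ _
  · have := hcon.2 Γ hΓ (hd.trans ?_) ()
    · linarith
    · gcongr
      have := min_le_right θ₁ (θ₂ / 2)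
      linarith

/-- No moderately small set swallows the neighbourhoods of linearly many vertices. -/
theorem eventually_PP_hit_le {ε η : ℝ} (hε : 0 < ε) (hε1 : ε ≤ 1 / 4) (hη : 0 < η) (hη1 : η ≤ 1) :
    ∀ᶠ n : ℕ in atTop, ∀ m : ℕ, n * Real.log n / 4 ≤ m → m ≤ n * Real.log n →
      PP {σ : ProcessSpace n | ∃ Z : Finset (Fin n), (Z.card : ℝ) ≤ (1 / 2 + ε / 2) * n ∧
        η * n ≤ (viol (processGraph σ m) (fun _ => Z) (1 / 2 + ε) (ε / 32 * Real.log n)).card} ≤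
      Real.exp (-n) := by
  classical
  obtain ⟨θ, hθ, hev⟩ := exists_PP_viol_le hε hε1 hη hη1
  filter_upwards [hev] with n h m hm1 hm2
  have hL : 0 ≤ n * Real.log n := by have := Real.log_natCast_nonneg n; positivity
  have hβ : 0 ≤ (1 / 2 + ε / 2) * n := by positivity
  have hJ : (Fintype.card (Finset (Fin n)) : ℝ) ≤ 4 ^ n := by
    rw [Fintype.card_finset, Fintype.card_fin]
    push_cast
    gcongr; norm_num
  have e := h m hm1 hm2 (Finset (Fin n)) hJ
    (fun _ Z _ => if (Z.card : ℝ) ≤ (1 / 2 + ε / 2) * n then Z else ∅)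
    (fun Γ j v => by split_ifs with h; exacts [h, by simpa using hβ])
  refine le_trans (PP_mono ?_) e
  rintro σ ⟨Z, hZ, hv⟩
  refine ⟨⊥, bot_le, ?_, Z, ?_⟩
  · have : dsum (⊥ : SimpleGraph (Fin n)) = 0 := by simp [dsum, nb]
    rw [this, Nat.cast_zero]; positivity
  · rwa [if_pos hZ]

/-- Structural properties of a pair of nested random graphs: the low degree vertices of the smaller
one are far apart in the larger one, which is locally sparse and has small codegrees. -/
structure Scattered {n : ℕ} (G₀ G₁ : SimpleGraph (Fin n)) (D : ℕ) (K δ : ℝ) : Prop where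
  codeg : ∀ u v, u ≠ v → (nb G₁ u ∩ nb G₁ v).card ≤ 2
  one : ∀ u v, (nb G₀ u).card < D → (nb G₀ v).card < D → ¬ G₁.Adj u v
  two : ∀ u v, (nb G₀ u).card < D → (nb G₀ v).card < D → u ≠ v →
    ∀ x, G₁.Adj u x → ¬ G₁.Adj x v
  four : ∀ u v, (nb G₀ u).card < D → (nb G₀ v).card < D → u ≠ v →
    ∀ x y z, G₁.Adj u x → G₁.Adj x y → G₁.Adj y z → ¬ G₁.Adj z v
  sparse : ∀ U : Finset (Fin n), U.Nonempty → (U.card : ℝ) ≤ 4 * δ * n →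
    ((∑ u ∈ U, (nb G₁ u ∩ U).card : ℕ) : ℝ) < K * U.card

lemma card_mod_eq_le {n M : ℕ} (hM : 0 < M) (c : Fin M) :
    (Finset.univ.filter fun v : Fin n => (⟨v % M, Nat.mod_lt _ hM⟩ : Fin M) = c).card ≤
      n / M + 1 := by
  rw [← Finset.card_range (n / M + 1)]
  refine Finset.card_le_card_of_injOn (fun v => (v : ℕ) / M) (fun v _ => ?_) fun u hu v hv h => ?_
  · simp only [Finset.coe_range, Set.mem_Iio]
    exact Nat.lt_succ_of_le (Nat.div_le_div_right v.2.le)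
  · simp only [Finset.coe_filter, Finset.mem_univ, true_and, Set.mem_ofPred_eq] at hu hv
    have h1 : (u : ℕ) % M = v % M := congrArg Fin.val (hu.trans hv.symm)
    ext
    rw [← Nat.div_add_mod (u : ℕ) M, ← Nat.div_add_mod (v : ℕ) M, h1]
    simp only at h
    rw [h]

lemma deg_le_of_resilience {n : ℕ} {G H : SimpleGraph (Fin n)} {ε : ℝ} (hHG : H ≤ G) {v : Fin n}
    (hdeg : (deg H v : ℝ) ≤ (1 / 2 - ε) * deg G v) :
    (1 / 2 + ε) * (nb G v).card ≤ (nb (G \ H) v).card := by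
  classical
  rw [deg_eq_card_nb, deg_eq_card_nb] at hdeg
  have h1 : nb (G \ H) v = nb G v \ nb H v := by
    ext u
    simp [mem_nb]
  have h2 := Finset.card_sdiff_add_card_eq_card (nb_mono hHG v)
  rw [← h1] at h2
  have h3 : ((nb (G \ H) v).card : ℝ) + (nb H v).card = (nb G v).card := by exact_mod_cast h2
  linarith

theorem eventually_isHam_sdiff {ε θ θ₁ δ : ℝ} (hε : 0 < ε) (hε1 : ε ≤ 1 / 4) (hθ₁ : 0 < θ₁)
    (hθ : θ₁ ≤ θ / 2) (hδ : 0 < δ) (hδ8 : δ ≤ 1 / 8) {M : ℕ} (hM : 0 < M) :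
    ∀ᶠ n : ℕ in atTop, ∀ G₀ G G₁ H : SimpleGraph (Fin n), G₀ ≤ G → G ≤ G₁ → H ≤ G →
      (∀ v, (deg H v : ℝ) ≤ (1 / 2 - ε) * deg G v) → (∀ v, 2 ≤ deg G v) →
      (dsum G : ℝ) ≤ 2 * (n * Real.log n) → RotationRobust G ε θ M →
      (∀ Z : Finset (Fin n), (Z.card : ℝ) ≤ (1 / 2 + ε / 2) * n →
        ((viol G (fun _ => Z) (1 / 2 + ε) (ε / 32 * Real.log n)).card : ℝ) < δ / 2 * n) →
      Scattered G₀ G₁ (2 * ⌈θ₁ * Real.log n⌉₊) (θ₁ * Real.log n / 8) δ → IsHam (G \ H) := by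
  classical
  set c : ℝ := δ * ε / 128 with hc
  have hc0 : 0 < c := by positivity
  have hc1 : c ≤ 1 := by
    rw [hc, div_le_one (by norm_num)]
    nlinarith
  filter_upwards [eventually_le_log (6 / θ₁), eventually_le_log ((6 + 4 / c) / θ), eventually_le_nat 3,
    eventually_le_nat M] with n hL1 hL2 hn3 hnM G₀ G G₁ H h0 h1 hH hdeg h2 hds hR hhit hS
  have hθ0 : 0 < θ := by linarith
  set L := Real.log n with hLdef
  have hn0 : (0 : ℝ) < n := by linarith
  have hL0 : 0 < L := lt_of_lt_of_le (by positivity) hL1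
  rw [div_le_iff₀ hθ₁] at hL1
  rw [div_le_iff₀ hθ0] at hL2
  have hM0 : (0 : ℝ) < M := by exact_mod_cast hM
  set D := ⌈θ₁ * L⌉₊ with hD
  have hD1 : θ₁ * L ≤ D := Nat.le_ceil _
  have hD2 : (D : ℝ) < θ₁ * L + 1 := Nat.ceil_lt_add_one (by positivity)
  set t := ⌈2 * n / c⌉₊ with ht
  have ht1 : 2 * n / c ≤ t := Nat.le_ceil _
  have ht2 : (t : ℝ) < 2 * n / c + 1 := Nat.ceil_lt_add_one (by positivity)
  have hle : G \ H ≤ G := sdiff_le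
  have hdiff : ∀ v, (1 / 2 + ε) * (nb G v).card ≤ (nb (G \ H) v).card := fun v =>
    deg_le_of_resilience hH (hdeg v)
  have hds' : (dsum (G \ H) : ℝ) ≤ 2 * (n * L) := by
    refine le_trans ?_ hds
    exact_mod_cast Finset.sum_le_sum fun v _ => Finset.card_le_card (nb_mono hle v)
  have hcard : Fintype.card (Fin n) = n := Fintype.card_fin n
  have hviol : ∀ (F : Fin n → Finset (Fin n)) v,
      ((nb (G \ H) v \ F v).card : ℝ) ≤ ε / 32 * L → v ∈ viol G F (1 / 2 + ε) (ε / 32 * L) := by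
    intro F v hv
    rw [viol, Finset.mem_filter]
    refine ⟨Finset.mem_univ _, (hdiff v).trans ?_⟩
    have e1 := Finset.card_sdiff_add_card_inter (nb (G \ H) v) (F v)
    have e2 : (nb (G \ H) v ∩ F v).card ≤ (nb G v ∩ F v).card :=
      Finset.card_le_card (Finset.inter_subset_inter_right (nb_mono hle v))
    have e3 : ((nb (G \ H) v).card : ℝ) ≤ (nb (G \ H) v \ F v).card + (nb G v ∩ F v).card := by
      rw [← e1]; push_cast; gcongr
    linarith
  have hs0 : 0 < ε / 32 * L := by positivity
  have hviol0 : ∀ (F : Fin n → Finset (Fin n)) v, nb (G \ H) v ⊆ F v →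
      v ∈ viol G F (1 / 2 + ε) (ε / 32 * L) := fun F v hv => hviol F v (by
    rw [Finset.sdiff_eq_empty_iff_subset.mpr hv]; simpa using hs0.le)
  refine isHam_of_robust (V := Fin n) (S := Finset.univ.filter fun v => (nb G₀ v).card < 2 * D)
    (D := D) (K := θ₁ * L / 8) (β := (1 / 2 + ε / 2) * n) (s := ε / 32 * L) (c := c) (t := t)
    (d := 32 * L) (M1 := 2 * (θ * (n * L))) (M2 := 2 * ((θ + 64 / M) * (n * L)))
    (by rw [hcard]; exact_mod_cast hn3) (hle.trans h1) ?_ ?_ ?_ (by convert hS.codeg)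
    ?_ ?_ ?_ ?_ hδ hδ8 ?_ ?_ hs0 hc1 ?_ ?_ ?_ hM (fun v => ⟨v % M, Nat.mod_lt _ hM⟩) ?_ (by positivity)
    ?_ ?_ ?_ ?_ ?_
  · intro v
    have e1 := hdiff v
    have e2 : (2 : ℝ) ≤ (nb G v).card := by rw [← deg_eq_card_nb]; exact_mod_cast h2 v
    have e3 : (1 : ℝ) < (nb (G \ H) v).card := by nlinarith
    exact_mod_cast e3
  · have : (2 : ℝ) ≤ D := by linarith
    exact_mod_cast this
  · intro v hv
    rw [Finset.mem_filter, not_and, not_lt] at hv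
    have e1 : 2 * D ≤ (nb G v).card :=
      (hv (Finset.mem_univ _)).trans (Finset.card_le_card (nb_mono h0 v))
    have e2 : (2 * D : ℝ) ≤ (nb G v).card := by exact_mod_cast e1
    have e3 : (D : ℝ) ≤ (nb (G \ H) v).card := by
      have := hdiff v
      have e4 : (0 : ℝ) ≤ D := by positivity
      nlinarith
    exact_mod_cast e3
  · intro u hu v hv
    rw [Finset.mem_filter] at hu hv
    exact hS.one u v hu.2 hv.2
  · intro u hu v hv
    rw [Finset.mem_filter] at hu hv
    exact hS.two u v hu.2 hv.2
  · intro u hu v hv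
    rw [Finset.mem_filter] at hu hv
    exact hS.four u v hu.2 hv.2
  · linarith
  · rw [hcard]; convert hS.sparse
  · rw [hcard]; nlinarith
  · rw [hcard]
    calc c * dsum (G \ H) ≤ c * (2 * (n * L)) := by gcongr
      _ = δ / 2 * n * (ε / 32 * L) := by rw [hc]; ring
  · intro Z hZ
    rw [hcard]
    refine lt_of_le_of_lt ?_ (hhit Z hZ)
    refine Nat.cast_le.mpr (Finset.card_le_card fun v hv => ?_)
    rw [Finset.mem_filter] at hv
    exact hviol (fun _ => Z) v (by convert hv.2)
  · rw [hcard]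
    have e1 : (1 - c) ^ t ≤ Real.exp (-(2 * n)) := by
      calc (1 - c) ^ t ≤ Real.exp (-c) ^ t := by
            have := Real.add_one_le_exp (-c)
            gcongr
            · linarith
        _ = Real.exp (t * -c) := (Real.exp_nat_mul _ _).symm
        _ ≤ _ := by
          rw [div_le_iff₀ hc0] at ht1
          apply Real.exp_le_exp.mpr
          linarith
    have e2 : Real.exp (-(2 * n)) = (Real.exp (-2)) ^ n := by rw [← Real.exp_nat_mul]; ring_nf
    have e3 : (4 : ℝ) * Real.exp (-2) < 1 := by
      have := Real.exp_one_gt_d9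
      have e4 : Real.exp (-2) * (Real.exp 1 * Real.exp 1) = 1 := by
        rw [← Real.exp_add, ← Real.exp_add]; norm_num
      nlinarith [Real.exp_pos (-2)]
    calc (4 : ℝ) ^ n * (1 - c) ^ t ≤ 4 ^ n * (Real.exp (-2)) ^ n := by rw [← e2]; gcongr
      _ = (4 * Real.exp (-2)) ^ n := (mul_pow _ _ _).symm
      _ < 1 := pow_lt_one₀ (by positivity) e3 (by
          have : (n : ℝ) ≠ 0 := hn0.ne'
          exact_mod_cast this)
  · intro c
    rw [hcard]
    have e1 : (Finset.univ.filter fun v : Fin n =>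
        (⟨v % M, Nat.mod_lt _ hM⟩ : Fin M) = c).card ≤ n / M + 1 := card_mod_eq_le hM c
    have e2 : ((n / M : ℕ) : ℝ) ≤ n / M := Nat.cast_div_le
    have e3 : (1 : ℝ) ≤ n / M := by rwa [one_le_div hM0]
    have e4 : (((Finset.univ.filter fun v : Fin n =>
        (⟨v % M, Nat.mod_lt _ hM⟩ : Fin M) = c).card : ℕ) : ℝ) ≤ ((n / M + 1 : ℕ) : ℝ) :=
      Nat.cast_le.mpr e1
    push_cast at e4
    calc _ ≤ ((n / M : ℕ) : ℝ) + 1 := by convert e4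
      _ ≤ 2 * n / M := by rw [mul_div_assoc]; linarith
  · rw [hcard]; linarith
  · rw [hcard]
    have e1 : 2 * n * (D : ℝ) ≤ 2 * n * (θ₁ * L + 1) := by gcongr
    have e2 : n * (θ₁ * L) ≤ n * (θ / 2 * L) := by gcongr
    have e3 : n * (6 + 4 / c) ≤ n * (L * θ) := by gcongr
    have e4 : 2 * n / c * 2 = n * (4 / c) := by ring
    nlinarith
  · rw [hcard]
    apply le_of_eq; ring
  · intro Γ hΓ hd a Z hZ
    rw [hcard]
    refine lt_of_le_of_lt ?_ (hR.shift Γ (hΓ.trans hle) hd a Z hZ)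
    refine Nat.cast_le.mpr (Finset.card_le_card fun v hv => ?_)
    simp only [Finset.mem_filter, Finset.mem_univ, true_and] at hv
    exact hviol0 _ v hv
  · intro Γ hΓ hd
    rw [hcard]
    refine lt_of_le_of_lt ?_ (hR.ends Γ (hΓ.trans hle) hd)
    refine Nat.cast_le.mpr (Finset.card_le_card fun v hv => ?_)
    simp only [Finset.mem_filter, Finset.mem_univ, true_and] at hv
    refine hviol0 _ v ?_
    have h3 : ((ends Γ v)ᶜ.card : ℝ) ≤ (1 / 2 + ε / 2) * n := by convert hv.2
    rw [if_pos (by convert h3)]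
    convert hv.1

section

variable {E : Type*} [Fintype E] [DecidableEq E]

lemma Pr_mono {q : Fin 3 → ℝ} (hq : ∀ i, 0 ≤ q i) {S T : Set (E → Fin 3)} (h : S ⊆ T) :
    Pr q S ≤ Pr q T := by
  have := Pr_le_sum hq (S := S) (Finset.univ : Finset Unit) (fun _ => T)
    fun ω hω => ⟨(), Finset.mem_univ _, h hω⟩
  simpa using this

lemma Pr_union_le {q : Fin 3 → ℝ} (hq : ∀ i, 0 ≤ q i) (S T : Set (E → Fin 3)) :
    Pr q (S ∪ T) ≤ Pr q S + Pr q T := by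
  have := Pr_le_sum hq (S := S ∪ T) (Finset.univ : Finset Bool) (fun b => if b then S else T) (by
    rintro ω (h | h)
    · exact ⟨true, Finset.mem_univ _, by simpa using h⟩
    · exact ⟨false, Finset.mem_univ _, by simpa using h⟩)
  simpa [Fintype.sum_bool] using this

/-- The probability that the edges of `T` are present while few edges of `W` have label `0`. -/
lemma Pr_low_le {q : Fin 3 → ℝ} (hq : ∀ i, 0 ≤ q i) (hq1 : ∑ i, q i = 1) (W T : Finset E) (k : ℕ)
    {y : ℝ} (hy : 0 ≤ y) :
    Pr q {ω | (∀ e ∈ T, ω e ≠ 2) ∧ (W.filter fun e => ω e = 0).card ≤ k} ≤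
      Real.exp (y * k) * ((1 - q 2) ^ T.card *
        Real.exp (-(q 0 * (1 - Real.exp (-y)) * (W.card - T.card)))) := by
  have hx1 : Real.exp (-y) ≤ 1 := Real.exp_le_one_iff.mpr (by linarith)
  set f : E → Fin 3 → ℝ := fun e j => if e ∈ T then (if j = 2 then 0 else 1) else
    if e ∈ W then (if j = 0 then Real.exp (-y) else 1) else 1 with hf
  have hf0 : ∀ e j, 0 ≤ f e j := by
    intro e j; simp only [hf]; split_ifs <;> positivity
  have h1 := Pr_le_prod hq (S := {ω | (∀ e ∈ T, ω e ≠ 2) ∧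
    (W.filter fun e => ω e = 0).card ≤ k}) (C := Real.exp (y * k)) (Real.exp_nonneg _) f hf0 ?_
  · refine h1.trans (mul_le_mul_of_nonneg_left ?_ (Real.exp_nonneg _))
    rw [Fin.sum_univ_three] at hq1
    have h2 : ∀ e, ∑ j, q j * f e j ≤ (if e ∈ T then 1 - q 2 else 1) *
        (if e ∈ W \ T then Real.exp (-(q 0 * (1 - Real.exp (-y)))) else 1) := by
      intro e
      rw [Fin.sum_univ_three]
      by_cases hT : e ∈ T
      · simp only [hf, hT, if_true, Finset.mem_sdiff, not_true, and_false, if_false]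
        simp; linarith
      · by_cases hW : e ∈ W
        · have := Real.add_one_le_exp (-(q 0 * (1 - Real.exp (-y))))
          simp only [hf, hT, hW, if_true, Finset.mem_sdiff, if_false, not_false_eq_true, and_true]
          simp
          linarith
        · simp only [hf, hT, hW, Finset.mem_sdiff, if_false, not_false_eq_true, and_true]
          simp; linarith
    refine (Finset.prod_le_prod (fun e _ => Finset.sum_nonneg fun j _ => mul_nonneg (hq j) (hf0 e j))
      fun e _ => h2 e).trans ?_
    rw [Finset.prod_mul_distrib, Finset.prod_ite_mem, Finset.prod_ite_mem, Finset.univ_inter,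
      Finset.univ_inter, Finset.prod_const, Finset.prod_const, ← Real.exp_nat_mul]
    have h3 : 0 ≤ 1 - q 2 := by have := hq 0; have := hq 1; linarith
    apply mul_le_mul_of_nonneg_left _ (by positivity)
    apply Real.exp_le_exp.mpr
    rw [mul_neg, neg_le_neg_iff, mul_comm]
    have h4 : (W.card : ℝ) - T.card ≤ (W \ T).card := by
      have := Finset.le_card_sdiff T W
      have h5 : W.card ≤ (W \ T).card + T.card := by omega
      have : (W.card : ℝ) ≤ (W \ T).card + T.card := by exact_mod_cast h5
      linarith
    exact mul_le_mul_of_nonneg_right h4 (mul_nonneg (hq 0) (by linarith))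
  · rintro ω ⟨hT, hW⟩
    have h2 : ∏ e, (if e ∈ W.filter (fun e => ω e = 0) then Real.exp (-y) else 1) ≤
        ∏ e, f e (ω e) := by
      refine Finset.prod_le_prod (fun e _ => by split_ifs <;> positivity) fun e _ => ?_
      by_cases h : e ∈ T
      · simp only [hf, h, if_true, hT e h, if_false]
        split_ifs <;> simp [hy]
      · by_cases h' : e ∈ W <;> by_cases h'' : ω e = 0 <;> simp [hf, h, h', h'']
    rw [Finset.prod_ite_mem, Finset.univ_inter, Finset.prod_const, ← Real.exp_nat_mul] at h2
    refine le_trans ?_ (mul_le_mul_of_nonneg_left h2 (Real.exp_nonneg _))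
    rw [← Real.exp_add, Real.one_le_exp_iff]
    have : ((W.filter fun e => ω e = 0).card : ℝ) ≤ k := by exact_mod_cast hW
    nlinarith

lemma Pr_high_le {q : Fin 3 → ℝ} (hq : ∀ i, 0 ≤ q i) (hq1 : ∑ i, q i = 1) (T : Finset E)
    {k y : ℝ} (hy : 0 ≤ y) :
    Pr q {ω | k ≤ (T.filter fun e => ω e ≠ 2).card} ≤
      Real.exp (-(y * k) + (1 - q 2) * Real.exp y * T.card) := by
  set f : E → Fin 3 → ℝ := fun e j => if e ∈ T then (if j = 2 then 1 else Real.exp y) else 1 with hf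
  have hf0 : ∀ e j, 0 ≤ f e j := by
    intro e j; simp only [hf]; split_ifs <;> positivity
  have h1 := Pr_le_prod hq (S := {ω | k ≤ (T.filter fun e => ω e ≠ 2).card})
    (C := Real.exp (-(y * k))) (Real.exp_nonneg _) f hf0 ?_
  · rw [Real.exp_add]
    refine h1.trans (mul_le_mul_of_nonneg_left ?_ (Real.exp_nonneg _))
    rw [Fin.sum_univ_three] at hq1
    have h3 : 0 ≤ 1 - q 2 := by have := hq 0; have := hq 1; linarith
    have h2 : ∀ e, ∑ j, q j * f e j ≤
        (if e ∈ T then Real.exp ((1 - q 2) * Real.exp y) else 1) := by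
      intro e
      rw [Fin.sum_univ_three]
      by_cases hT : e ∈ T
      · have := Real.add_one_le_exp ((1 - q 2) * Real.exp y)
        simp only [hf, hT, if_true]
        simp
        nlinarith [Real.exp_pos y]
      · simp only [hf, hT, if_false]
        simp; linarith
    refine (Finset.prod_le_prod (fun e _ => Finset.sum_nonneg fun j _ => mul_nonneg (hq j) (hf0 e j))
      fun e _ => h2 e).trans ?_
    rw [Finset.prod_ite_mem, Finset.univ_inter, Finset.prod_const, ← Real.exp_nat_mul, mul_comm]
  · intro ω hω
    have h2 : ∏ e, f e (ω e) =
        ∏ e, (if e ∈ T.filter (fun e => ω e ≠ 2) then Real.exp y else 1) := by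
      refine Finset.prod_congr rfl fun e _ => ?_
      by_cases h : e ∈ T <;> by_cases h' : ω e = 2 <;> simp [hf, h, h']
    rw [h2, Finset.prod_ite_mem, Finset.univ_inter, Finset.prod_const, ← Real.exp_nat_mul,
      ← Real.exp_add, Real.one_le_exp_iff]
    have : k ≤ (T.filter fun e => ω e ≠ 2).card := hω
    nlinarith

lemma Pr_forall_ne_zero {q : Fin 3 → ℝ} (hq1 : ∑ i, q i = 1) (W : Finset E) :
    Pr q {ω | ∀ e ∈ W, ω e ≠ 0} = (1 - q 0) ^ W.card := by
  classical
  have h1 := sum_prod_eq (fun (e : E) (j : Fin 3) =>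
    q j * (if e ∈ W then (if j = 0 then 0 else 1) else 1))
  rw [Fin.sum_univ_three] at hq1
  have h2 : ∀ e, ∑ j, q j * (if e ∈ W then (if j = 0 then (0 : ℝ) else 1) else 1) =
      if e ∈ W then 1 - q 0 else 1 := by
    intro e
    rw [Fin.sum_univ_three]
    by_cases h : e ∈ W <;> simp [h] <;> linarith
  rw [Finset.prod_congr rfl fun e _ => h2 e, Finset.prod_ite_mem, Finset.univ_inter,
    Finset.prod_const] at h1
  rw [← h1]
  unfold Pr
  refine Finset.sum_congr rfl fun ω _ => ?_
  rw [Finset.prod_mul_distrib]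
  by_cases h : ∀ e ∈ W, ω e ≠ 0
  · rw [if_pos (show ω ∈ {ω : E → Fin 3 | ∀ e ∈ W, ω e ≠ 0} from h),
      Finset.prod_eq_one (f := fun e => if e ∈ W then (if ω e = 0 then (0 : ℝ) else 1) else 1),
      mul_one]
    · rfl
    · intro e _
      by_cases he : e ∈ W <;> simp [he, h]
  · rw [if_neg (show ω ∉ {ω : E → Fin 3 | ∀ e ∈ W, ω e ≠ 0} from h)]
    push Not at h
    obtain ⟨e, he, h0⟩ := h
    rw [Finset.prod_eq_zero (i := e)
      (f := fun e => if e ∈ W then (if ω e = 0 then (0 : ℝ) else 1) else 1)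
      (Finset.mem_univ _) (by simp [he, h0]), mul_zero]

end

/-- The edges at a vertex. -/
def star {n : ℕ} (v : Fin n) : Finset (EdgeType n) := Finset.univ.filter fun e => v ∈ e.1

lemma ed_mem_star {n : ℕ} {u v w : Fin n} {h : u ≠ w} : ed u w h ∈ star v ↔ v = u ∨ v = w := by
  simp [star, ed]

open Classical in
lemma card_nb_edgesGraph {n : ℕ} (A : Set (EdgeType n)) (v : Fin n) :
    (nb (edgesGraph A) v).card = ((star v).filter (· ∈ A)).card := by
  refine Finset.card_bij (fun w hw => ed v w (mem_nb.mp hw).ne) (fun w hw => ?_) ?_ ?_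
  · obtain ⟨_, h⟩ := mem_nb.mp hw
    exact Finset.mem_filter.mpr ⟨ed_mem_star.mpr (Or.inl rfl), h⟩
  · intro w hw w' hw' h
    rcases ed_eq_iff.mp h with h | h
    · exact h.2
    · exact h.2.trans h.1
  · intro e he
    obtain ⟨x, y, h, rfl⟩ := exists_eq_ed e
    rw [Finset.mem_filter, ed_mem_star] at he
    rcases he.1 with rfl | rfl
    · exact ⟨y, mem_nb.mpr ⟨h, he.2⟩, rfl⟩
    · exact ⟨x, mem_nb.mpr ⟨h.symm, by rw [← ed_comm]; exact he.2⟩, (ed_comm _ _ _).symm⟩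

lemma card_star {n : ℕ} (v : Fin n) : (star v).card = n - 1 := by
  classical
  have h := card_nb_edgesGraph (Set.univ : Set (EdgeType n)) v
  have h1 : nb (edgesGraph (Set.univ : Set (EdgeType n))) v = Finset.univ.erase v := by
    ext w
    rw [mem_nb, edgesGraph_adj]
    simp [eq_comm]
  rw [h1, Finset.card_erase_of_mem (Finset.mem_univ _), Finset.card_univ, Fintype.card_fin] at h
  simpa using h.symm

lemma card_star_inter {n : ℕ} {u v : Fin n} (h : u ≠ v) : (star u ∩ star v).card = 1 := by
  rw [Finset.card_eq_one]
  refine ⟨ed u v h, ?_⟩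
  ext e
  obtain ⟨x, y, hxy, rfl⟩ := exists_eq_ed e
  rw [Finset.mem_inter, ed_mem_star, ed_mem_star, Finset.mem_singleton, ed_eq_iff]
  grind

lemma card_star_union {n : ℕ} {u v : Fin n} (h : u ≠ v) :
    ((star u ∪ star v).card : ℝ) = 2 * n - 3 := by
  have h1 := Finset.card_union_add_card_inter (star u) (star v)
  rw [card_star_inter h, card_star, card_star] at h1
  have h2 : 1 ≤ n := u.pos
  have h3 : (star u ∪ star v).card + 3 = 2 * n := by omega
  have h4 : ((star u ∪ star v).card : ℝ) + 3 = 2 * n := by exact_mod_cast h3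
  linarith

section

variable {n : ℕ} {q : Fin 3 → ℝ}

lemma Pr_le_card_mul (hq : ∀ i, 0 ≤ q i) {ι : Type*} [Fintype ι] (P : ι → Prop)
    (T : ι → Set (EdgeType n → Fin 3)) {S : Set (EdgeType n → Fin 3)} {B : ℝ} (hB : 0 ≤ B)
    (hT : ∀ i, P i → Pr q (T i) ≤ B) (h : ∀ ω ∈ S, ∃ i, P i ∧ ω ∈ T i) :
    Pr q S ≤ Fintype.card ι * B := by
  classical
  refine (Pr_le_sum hq (Finset.univ.filter P) T fun ω hω => ?_).trans ?_
  · obtain ⟨i, hi, hωi⟩ := h ω hω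
    exact ⟨i, by simpa using hi, hωi⟩
  · refine (Finset.sum_le_card_nsmul _ _ B fun i hi => hT i (Finset.mem_filter.mp hi).2).trans ?_
    rw [nsmul_eq_mul]
    gcongr
    exact Finset.card_le_univ _

/-- A bound for the probability that `k` given edges are present and two given vertices have
degree less than `D`. -/
def pathBound (n : ℕ) (q : Fin 3 → ℝ) (D : ℕ) (y : ℝ) (k : ℕ) : ℝ :=
  Real.exp (y * (2 * D)) * ((1 - q 2) ^ k *
    Real.exp (-(q 0 * (1 - Real.exp (-y)) * (2 * n - 3 - k))))

lemma one_sub_nonneg (hq : ∀ i, 0 ≤ q i) (hq1 : ∑ i, q i = 1) : 0 ≤ 1 - q 2 := by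
  rw [Fin.sum_univ_three] at hq1
  have := hq 0
  have := hq 1
  linarith

lemma pathBound_nonneg (hq : ∀ i, 0 ≤ q i) (hq1 : ∑ i, q i = 1) {D : ℕ} {y : ℝ} {k : ℕ} :
    0 ≤ pathBound n q D y k := by
  have := one_sub_nonneg hq hq1
  unfold pathBound
  positivity

lemma Pr_path_le (hq : ∀ i, 0 ≤ q i) (hq1 : ∑ i, q i = 1) {u v : Fin n} (huv : u ≠ v)
    (T : Finset (EdgeType n)) (D : ℕ) {y : ℝ} (hy : 0 ≤ y) :
    Pr q {ω | (∀ e ∈ T, ω e ≠ 2) ∧ (nb (edgesGraph {e | ω e = 0}) u).card < D ∧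
      (nb (edgesGraph {e | ω e = 0}) v).card < D} ≤ pathBound n q D y T.card := by
  classical
  have h1 := Pr_low_le hq hq1 (star u ∪ star v) T (2 * D) hy
  rw [card_star_union huv] at h1
  refine (Pr_mono hq ?_).trans (h1.trans_eq ?_)
  · rintro ω ⟨h2, hu, hv⟩
    refine ⟨h2, ?_⟩
    rw [Finset.filter_union]
    refine (Finset.card_union_le _ _).trans ?_
    rw [card_nb_edgesGraph] at hu hv
    simp only [Set.mem_ofPred_eq] at hu hv
    omega
  · unfold pathBound
    push_cast
    ring_nf

lemma Pr_adj_le (hq : ∀ i, 0 ≤ q i) (hq1 : ∑ i, q i = 1) (D : ℕ) {y : ℝ} (hy : 0 ≤ y) :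
    Pr q {ω : EdgeType n → Fin 3 | ∃ u v, (nb (edgesGraph {e | ω e = 0}) u).card < D ∧
      (nb (edgesGraph {e | ω e = 0}) v).card < D ∧ (edgesGraph {e | ω e ≠ 2}).Adj u v} ≤
    (n : ℝ) ^ 2 * pathBound n q D y 1 := by
  have := Pr_le_card_mul hq (fun i : Fin n × Fin n => i.1 ≠ i.2)
    (fun i => {ω | (nb (edgesGraph {e | ω e = 0}) i.1).card < D ∧
      (nb (edgesGraph {e | ω e = 0}) i.2).card < D ∧ (edgesGraph {e | ω e ≠ 2}).Adj i.1 i.2})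
    (S := {ω : EdgeType n → Fin 3 | ∃ u v, (nb (edgesGraph {e | ω e = 0}) u).card < D ∧
      (nb (edgesGraph {e | ω e = 0}) v).card < D ∧ (edgesGraph {e | ω e ≠ 2}).Adj u v})
    (pathBound_nonneg hq hq1 (n := n) (D := D) (y := y) (k := 1)) ?_ ?_
  · refine this.trans_eq ?_
    simp [pow_two]
  · rintro ⟨u, v⟩ (huv : u ≠ v)
    refine (Pr_mono hq ?_).trans ((Pr_path_le hq hq1 huv {ed u v huv} D hy).trans_eq ?_)
    · rintro ω ⟨hu, hv, _, h⟩
      exact ⟨by simpa using h, hu, hv⟩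
    · rw [Finset.card_singleton]
  · rintro ω ⟨u, v, hu, hv, h⟩
    exact ⟨(u, v), h.ne, hu, hv, h⟩

lemma Pr_path_two_le (hq : ∀ i, 0 ≤ q i) (hq1 : ∑ i, q i = 1) (D : ℕ) {y : ℝ} (hy : 0 ≤ y) :
    Pr q {ω : EdgeType n → Fin 3 | ∃ u v x, (nb (edgesGraph {e | ω e = 0}) u).card < D ∧
      (nb (edgesGraph {e | ω e = 0}) v).card < D ∧ u ≠ v ∧ (edgesGraph {e | ω e ≠ 2}).Adj u x ∧
      (edgesGraph {e | ω e ≠ 2}).Adj x v} ≤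
    (n : ℝ) ^ 3 * pathBound n q D y 2 := by
  have := Pr_le_card_mul hq (fun i : Fin n × Fin n × Fin n =>
      i.1 ≠ i.2.1 ∧ i.1 ≠ i.2.2 ∧ i.2.2 ≠ i.2.1)
    (fun i => {ω | (nb (edgesGraph {e | ω e = 0}) i.1).card < D ∧
      (nb (edgesGraph {e | ω e = 0}) i.2.1).card < D ∧
      (edgesGraph {e | ω e ≠ 2}).Adj i.1 i.2.2 ∧ (edgesGraph {e | ω e ≠ 2}).Adj i.2.2 i.2.1})
    (S := {ω : EdgeType n → Fin 3 | ∃ u v x, (nb (edgesGraph {e | ω e = 0}) u).card < D ∧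
      (nb (edgesGraph {e | ω e = 0}) v).card < D ∧ u ≠ v ∧ (edgesGraph {e | ω e ≠ 2}).Adj u x ∧
      (edgesGraph {e | ω e ≠ 2}).Adj x v})
    (pathBound_nonneg hq hq1 (n := n) (D := D) (y := y) (k := 2)) ?_ ?_
  · refine this.trans_eq ?_
    simp only [Fintype.card_prod, Fintype.card_fin]
    push_cast; ring
  · rintro ⟨u, v, x⟩ ⟨huv : u ≠ v, hux : u ≠ x, hxv : x ≠ v⟩
    refine (Pr_mono hq ?_).trans ((Pr_path_le hq hq1 huv {ed u x hux, ed x v hxv} D hy).trans_eq ?_)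
    · rintro ω ⟨hu, hv, ⟨_, h⟩, ⟨_, h'⟩⟩
      exact ⟨by simpa using ⟨h, h'⟩, hu, hv⟩
    · rw [Finset.card_pair]
      rw [Ne, ed_eq_iff]
      grind
  · rintro ω ⟨u, v, x, hu, hv, huv, h, h'⟩
    exact ⟨(u, v, x), ⟨huv, h.ne, h'.ne⟩, hu, hv, h, h'⟩

lemma Pr_path_four_le (hq : ∀ i, 0 ≤ q i) (hq1 : ∑ i, q i = 1) (D : ℕ) {y : ℝ} (hy : 0 ≤ y) :
    Pr q {ω : EdgeType n → Fin 3 | ∃ u v a b c, (nb (edgesGraph {e | ω e = 0}) u).card < D ∧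
      (nb (edgesGraph {e | ω e = 0}) v).card < D ∧ [u, v, a, b, c].Nodup ∧
      (edgesGraph {e | ω e ≠ 2}).Adj u a ∧ (edgesGraph {e | ω e ≠ 2}).Adj a b ∧
      (edgesGraph {e | ω e ≠ 2}).Adj b c ∧ (edgesGraph {e | ω e ≠ 2}).Adj c v} ≤
    (n : ℝ) ^ 5 * pathBound n q D y 4 := by
  have := Pr_le_card_mul hq (fun i : Fin n × Fin n × Fin n × Fin n × Fin n =>
      [i.1, i.2.1, i.2.2.1, i.2.2.2.1, i.2.2.2.2].Nodup)
    (fun i => {ω | (nb (edgesGraph {e | ω e = 0}) i.1).card < D ∧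
      (nb (edgesGraph {e | ω e = 0}) i.2.1).card < D ∧
      (edgesGraph {e | ω e ≠ 2}).Adj i.1 i.2.2.1 ∧
      (edgesGraph {e | ω e ≠ 2}).Adj i.2.2.1 i.2.2.2.1 ∧
      (edgesGraph {e | ω e ≠ 2}).Adj i.2.2.2.1 i.2.2.2.2 ∧
      (edgesGraph {e | ω e ≠ 2}).Adj i.2.2.2.2 i.2.1})
    (S := {ω : EdgeType n → Fin 3 | ∃ u v a b c, (nb (edgesGraph {e | ω e = 0}) u).card < D ∧
      (nb (edgesGraph {e | ω e = 0}) v).card < D ∧ [u, v, a, b, c].Nodup ∧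
      (edgesGraph {e | ω e ≠ 2}).Adj u a ∧ (edgesGraph {e | ω e ≠ 2}).Adj a b ∧
      (edgesGraph {e | ω e ≠ 2}).Adj b c ∧ (edgesGraph {e | ω e ≠ 2}).Adj c v})
    (pathBound_nonneg hq hq1 (n := n) (D := D) (y := y) (k := 4)) ?_ ?_
  · refine this.trans_eq ?_
    simp only [Fintype.card_prod, Fintype.card_fin]
    push_cast; ring
  · rintro ⟨u, v, a, b, c⟩ (hnd : [u, v, a, b, c].Nodup)
    simp only [List.nodup_cons, List.mem_cons, List.not_mem_nil, or_false, not_or, not_false_eq_true,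
      List.nodup_nil, and_true] at hnd
    obtain ⟨⟨huv, hua, hub, huc⟩, ⟨hva, hvb, hvc⟩, ⟨hab, hac⟩, hbc⟩ := hnd
    refine (Pr_mono hq ?_).trans ((Pr_path_le hq hq1 huv
      {ed u a hua, ed a b hab, ed b c hbc, ed c v (Ne.symm hvc)} D hy).trans_eq ?_)
    · rintro ω ⟨hu, hv, ⟨_, h⟩, ⟨_, h'⟩, ⟨_, h2⟩, ⟨_, h3⟩⟩
      exact ⟨by simpa using ⟨h, h', h2, h3⟩, hu, hv⟩
    · rw [Finset.card_insert_of_notMem, Finset.card_insert_of_notMem, Finset.card_pair]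
      all_goals simp only [Finset.mem_insert, Finset.mem_singleton, Ne, ed_eq_iff]
      all_goals grind
  · rintro ω ⟨u, v, a, b, c, hu, hv, hnd, h⟩
    exact ⟨(u, v, a, b, c), hnd, hu, hv, h⟩

lemma Pr_codeg_le (hq : ∀ i, 0 ≤ q i) (hq1 : ∑ i, q i = 1) :
    Pr q {ω : EdgeType n → Fin 3 | ∃ u v, u ≠ v ∧ 2 < (nb (edgesGraph {e | ω e ≠ 2}) u ∩
      nb (edgesGraph {e | ω e ≠ 2}) v).card} ≤ (n : ℝ) ^ 5 * (1 - q 2) ^ 6 := by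
  have h0 := one_sub_nonneg hq hq1
  have := Pr_le_card_mul hq (fun i : Fin n × Fin n × Fin n × Fin n × Fin n =>
      [i.1, i.2.1, i.2.2.1, i.2.2.2.1, i.2.2.2.2].Nodup)
    (fun i => {ω | (edgesGraph {e | ω e ≠ 2}).Adj i.1 i.2.2.1 ∧
      (edgesGraph {e | ω e ≠ 2}).Adj i.1 i.2.2.2.1 ∧
      (edgesGraph {e | ω e ≠ 2}).Adj i.1 i.2.2.2.2 ∧
      (edgesGraph {e | ω e ≠ 2}).Adj i.2.1 i.2.2.1 ∧
      (edgesGraph {e | ω e ≠ 2}).Adj i.2.1 i.2.2.2.1 ∧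
      (edgesGraph {e | ω e ≠ 2}).Adj i.2.1 i.2.2.2.2})
    (S := {ω : EdgeType n → Fin 3 | ∃ u v, u ≠ v ∧ 2 < (nb (edgesGraph {e | ω e ≠ 2}) u ∩
      nb (edgesGraph {e | ω e ≠ 2}) v).card})
    (B := (1 - q 2) ^ 6) (by positivity) ?_ ?_
  · refine this.trans_eq ?_
    simp only [Fintype.card_prod, Fintype.card_fin]
    push_cast; ring
  · rintro ⟨u, v, a, b, c⟩ (hnd : [u, v, a, b, c].Nodup)
    simp only [List.nodup_cons, List.mem_cons, List.not_mem_nil, or_false, not_or, not_false_eq_true,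
      List.nodup_nil, and_true] at hnd
    obtain ⟨⟨huv, hua, hub, huc⟩, ⟨hva, hvb, hvc⟩, ⟨hab, hac⟩, hbc⟩ := hnd
    have h1 := Pr_low_le hq hq1 ∅ {ed u a hua, ed u b hub, ed u c huc, ed v a hva, ed v b hvb,
      ed v c hvc} 0 le_rfl
    have h2 : ({ed u a hua, ed u b hub, ed u c huc, ed v a hva, ed v b hvb,
        ed v c hvc} : Finset (EdgeType n)).card = 6 := by
      rw [Finset.card_insert_of_notMem, Finset.card_insert_of_notMem, Finset.card_insert_of_notMem,
        Finset.card_insert_of_notMem, Finset.card_pair]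
      all_goals simp only [Finset.mem_insert, Finset.mem_singleton, Ne, ed_eq_iff]
      all_goals grind
    rw [h2] at h1
    refine (Pr_mono hq ?_).trans (h1.trans_eq (by simp))
    rintro ω ⟨⟨_, g1⟩, ⟨_, g2⟩, ⟨_, g3⟩, ⟨_, g4⟩, ⟨_, g5⟩, ⟨_, g6⟩⟩
    exact ⟨by simpa using ⟨g1, g2, g3, g4, g5, g6⟩, by simp⟩
  · rintro ω ⟨u, v, huv, h⟩
    obtain ⟨a, ha, b, hb, c, hc, hab, hac, hbc⟩ := Finset.two_lt_card.mp h
    simp only [Finset.mem_inter, mem_nb] at ha hb hc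
    refine ⟨(u, v, a, b, c), ?_, ha.1, hb.1, hc.1, ha.2, hb.2, hc.2⟩
    simp [huv, ha.1.ne, hb.1.ne, hc.1.ne, ha.2.ne, hb.2.ne, hc.2.ne, hab, hac, hbc]

open Classical in
/-- The edges inside a set of vertices. -/
def inside (U : Finset (Fin n)) : Finset (EdgeType n) :=
  Finset.univ.filter fun e => ∀ v ∈ e.1, v ∈ U

lemma ed_mem_inside {U : Finset (Fin n)} {u v : Fin n} {h : u ≠ v} :
    ed u v h ∈ inside U ↔ u ∈ U ∧ v ∈ U := by
  simp [inside, ed]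

open Classical in
lemma sum_card_nb_inter (A : Set (EdgeType n)) (U : Finset (Fin n)) :
    ∑ u ∈ U, (nb (edgesGraph A) u ∩ U).card = 2 * ((inside U).filter (· ∈ A)).card := by
  have h1 := dsum_eq_two_mul (edgesGraph (((inside U).filter (· ∈ A) : Finset _) : Set (EdgeType n)))
  rw [edgesOf_edgesGraph] at h1
  rw [← h1, dsum, ← Finset.sum_subset (Finset.subset_univ U)]
  · refine Finset.sum_congr rfl fun u hu => congrArg _ ?_
    ext v
    simp only [Finset.mem_inter, mem_nb, edgesGraph_adj, Finset.coe_filter, Set.mem_ofPred_eq,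
      ed_mem_inside]
    grind
  · intro u _ hu
    rw [Finset.card_eq_zero, Finset.eq_empty_iff_forall_notMem]
    intro v hv
    simp only [mem_nb, edgesGraph_adj, Finset.coe_filter, Set.mem_ofPred_eq, ed_mem_inside] at hv
    exact hu hv.2.1.1

lemma two_mul_card_inside_le (U : Finset (Fin n)) : 2 * (inside U).card ≤ U.card ^ 2 := by
  classical
  have h1 := sum_card_nb_inter (Set.univ : Set (EdgeType n)) U
  simp only [Set.mem_univ, Finset.filter_true] at h1
  rw [← h1, pow_two, ← smul_eq_mul]
  exact Finset.sum_le_card_nsmul _ _ _ fun u _ => Finset.card_le_card Finset.inter_subset_right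

lemma Pr_dense_le (hq : ∀ i, 0 ≤ q i) (hq1 : ∑ i, q i = 1) (hn : 1 ≤ n) {K r y : ℝ} (hy : 0 ≤ y)
    (hK : 4 * Real.log n + (1 - q 2) * Real.exp y * r ≤ y * K) :
    Pr q {ω : EdgeType n → Fin 3 | ∃ U : Finset (Fin n), U.Nonempty ∧ (U.card : ℝ) ≤ r ∧
      K * U.card ≤ ((∑ u ∈ U, (nb (edgesGraph {e | ω e ≠ 2}) u ∩ U).card : ℕ) : ℝ)} ≤
    Real.exp 1 / n := by
  classical
  have hn0 : (0 : ℝ) < n := by exact_mod_cast hn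
  have hb := one_sub_nonneg hq hq1
  refine (Pr_le_sum hq ((Finset.univ : Finset (Finset (Fin n))).filter fun U =>
      U.Nonempty ∧ (U.card : ℝ) ≤ r)
    (fun U => {ω | K * U.card / 2 ≤ ((inside U).filter fun e => ω e ≠ 2).card}) ?_).trans ?_
  · rintro ω ⟨U, hU, hr, h⟩
    refine ⟨U, by simp [hU, hr], ?_⟩
    rw [sum_card_nb_inter] at h
    push_cast at h
    change K * U.card / 2 ≤ _
    simp only [Set.mem_ofPred_eq] at h
    linarith
  · have h1 : ∀ U ∈ (Finset.univ : Finset (Finset (Fin n))).filter (fun U =>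
        U.Nonempty ∧ (U.card : ℝ) ≤ r),
        Pr q {ω | K * U.card / 2 ≤ ((inside U).filter fun e => ω e ≠ 2).card} ≤
          1 / n * ((1 / n) ^ U.card * 1 ^ (n - U.card)) := by
      intro U hU
      rw [Finset.mem_filter] at hU
      obtain ⟨_, hU, hr⟩ := hU
      refine (Pr_high_le hq hq1 (inside U) hy).trans ?_
      have hU1 : (1 : ℝ) ≤ U.card := by exact_mod_cast hU.card_pos
      have e1 : ((inside U).card : ℝ) ≤ U.card * r / 2 := by
        have e2 : (2 * (inside U).card : ℝ) ≤ (U.card : ℝ) ^ 2 := by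
          exact_mod_cast two_mul_card_inside_le U
        nlinarith
      have e3 : (1 - q 2) * Real.exp y * (inside U).card ≤
          (1 - q 2) * Real.exp y * (U.card * r / 2) := by gcongr
      have hlog : 0 ≤ Real.log n := Real.log_natCast_nonneg n
      have e4 : -(y * (K * U.card / 2)) + (1 - q 2) * Real.exp y * (inside U).card ≤
          -(Real.log n) + U.card * -(Real.log n) := by nlinarith
      refine (Real.exp_le_exp.mpr e4).trans_eq ?_
      rw [Real.exp_add, Real.exp_nat_mul, Real.exp_neg, Real.exp_log hn0, one_pow, mul_one, one_div]
    refine (Finset.sum_le_sum h1).trans ?_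
    refine (Finset.sum_le_sum_of_subset_of_nonneg (Finset.filter_subset _ _)
      fun _ _ _ => by positivity).trans ?_
    have h2 := Fintype.sum_pow_mul_eq_add_pow (Fin n) (1 / (n : ℝ)) 1
    rw [Fintype.card_fin] at h2
    rw [← Finset.mul_sum, h2]
    have h3 : (1 / (n : ℝ) + 1) ^ n ≤ Real.exp 1 := by
      calc (1 / (n : ℝ) + 1) ^ n ≤ (Real.exp (1 / n)) ^ n := by
            gcongr; exact Real.add_one_le_exp _
        _ = Real.exp 1 := by rw [← Real.exp_nat_mul]; congr 1; field_simp
    calc 1 / (n : ℝ) * (1 / (n : ℝ) + 1) ^ n ≤ 1 / (n : ℝ) * Real.exp 1 := by gcongr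
      _ = Real.exp 1 / n := by ring

theorem Pr_not_scattered_le (hq : ∀ i, 0 ≤ q i) (hq1 : ∑ i, q i = 1) (hn : 1 ≤ n) (D : ℕ)
    {K δ y z : ℝ} (hy : 0 ≤ y) (hz : 0 ≤ z)
    (hK : 4 * Real.log n + (1 - q 2) * Real.exp z * (4 * δ * n) ≤ z * K) :
    Pr q {ω : EdgeType n → Fin 3 |
      ¬ Scattered (edgesGraph {e | ω e = 0}) (edgesGraph {e | ω e ≠ 2}) D K δ} ≤
    (n : ℝ) ^ 5 * (1 - q 2) ^ 6 + (n : ℝ) ^ 2 * pathBound n q D y 1 +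
      (n : ℝ) ^ 3 * pathBound n q D y 2 + (n : ℝ) ^ 5 * pathBound n q D y 4 + Real.exp 1 / n := by
  refine (Pr_mono hq (T := (((_ ∪ _) ∪ _) ∪ _) ∪ _) ?_).trans
    ((Pr_union_le hq _ _).trans (add_le_add ((Pr_union_le hq _ _).trans (add_le_add
    ((Pr_union_le hq _ _).trans (add_le_add ((Pr_union_le hq _ _).trans (add_le_add
      (Pr_codeg_le hq hq1) (Pr_adj_le hq hq1 D hy))) (Pr_path_two_le hq hq1 D hy)))
      (Pr_path_four_le hq hq1 D hy))) (Pr_dense_le hq hq1 hn hz hK)))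
  intro ω hω
  by_contra hcon
  simp only [Set.mem_union, not_or, Set.mem_ofPred_eq, not_exists, not_and, not_lt, not_le] at hcon
  obtain ⟨⟨⟨⟨hc, hc1⟩, hc2⟩, hc4⟩, hc5⟩ := hcon
  refine hω ⟨hc, hc1, fun u v hu hv huv x h h' => hc2 u v x hu hv huv h h', ?_, hc5⟩
  intro u v hu hv huv a b c h1 h2 h3 h4
  refine hc4 u v a b c hu hv ?_ h1 h2 h3 h4
  have e1 : a ≠ v := by rintro rfl; exact hc1 u a hu hv h1
  have e2 : c ≠ u := by rintro rfl; exact hc1 c v hu hv h4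
  have e3 : b ≠ u := by rintro rfl; exact hc2 b v c hu hv huv h3 h4
  have e4 : b ≠ v := by rintro rfl; exact hc2 u b a hu hv huv h1 h2
  have e5 : a ≠ c := by rintro rfl; exact hc2 u v a hu hv huv h1 h4
  simp [huv, h1.ne, h2.ne, h3.ne, h4.ne.symm, e1.symm, e2.symm, e3.symm, e4.symm, e5]

end

lemma Scattered.mono {n : ℕ} {G₀ G₁ G₀' G₁' : SimpleGraph (Fin n)} {D : ℕ} {K δ : ℝ}
    (h : Scattered G₀ G₁ D K δ) (h₀ : G₀ ≤ G₀') (h₁ : G₁' ≤ G₁) : Scattered G₀' G₁' D K δ := by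
  have hlow : ∀ {u}, (nb G₀' u).card < D → (nb G₀ u).card < D := fun {u} hu =>
    (Finset.card_le_card (nb_mono h₀ u)).trans_lt hu
  refine ⟨fun u v huv => ?_, fun u v hu hv huv => h.one u v (hlow hu) (hlow hv) (h₁ huv),
    fun u v hu hv huv x e1 e2 => h.two u v (hlow hu) (hlow hv) huv x (h₁ e1) (h₁ e2),
    fun u v hu hv huv x y z e1 e2 e3 e4 =>
      h.four u v (hlow hu) (hlow hv) huv x y z (h₁ e1) (h₁ e2) (h₁ e3) (h₁ e4),
    fun U hU hUc => lt_of_le_of_lt ?_ (h.sparse U hU hUc)⟩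
  · exact (Finset.card_le_card (Finset.inter_subset_inter (nb_mono h₁ u) (nb_mono h₁ v))).trans
      (h.codeg u v huv)
  · exact_mod_cast Finset.sum_le_sum fun u _ =>
      Finset.card_le_card (Finset.inter_subset_inter (nb_mono h₁ u) subset_rfl)

lemma tendsto_mul_log {c : ℝ} (hc : 0 < c) :
    Tendsto (fun n : ℕ => c * Real.log n) atTop atTop :=
  tendsto_log_nat.const_mul_atTop hc

lemma tendsto_log_pow_mul_exp (C : ℝ) (k : ℕ) {c : ℝ} (hc : 0 < c) :
    Tendsto (fun n : ℕ => C * (Real.log n ^ k * Real.exp (-(c * Real.log n)))) atTop (nhds 0) := by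
  have h1 := ((Real.tendsto_pow_mul_exp_neg_atTop_nhds_zero k).comp
    (tendsto_mul_log hc)).const_mul (C / c ^ k)
  rw [mul_zero] at h1
  refine h1.congr fun n => ?_
  simp only [Function.comp]
  have : c ^ k ≠ 0 := by positivity
  field_simp
  ring

lemma eventually_Pr_cnt_gt_le {a b x η : ℝ} (hx : 1 < x) (h : a / 2 < b / x) (hη : 0 < η) :
    ∀ᶠ n : ℕ in atTop, ∀ q : Fin 3 → ℝ, (∀ i, 0 ≤ q i) → ∑ i, q i = 1 → ∀ (J : Finset (Fin 3))
      (m : ℕ), ∑ i ∈ J, q i ≤ a * Real.log n / n → b * (n * Real.log n) ≤ m + 1 → 0 ≤ b →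
      Pr q {ω : EdgeType n → Fin 3 | m < cnt J ω} ≤ η := by
  set c := (x - 1) * (b / x - a / 2) with hc
  have hc0 : 0 < c := mul_pos (by linarith) (by linarith)
  have h1 := (tendsto_log_pow_mul_exp 1 0 hc0).eventually (gt_mem_nhds hη)
  filter_upwards [h1, eventually_ge_atTop 1] with n hn hn1 q hq hq1 J m hJ hm hb
  have hn0 : (0 : ℝ) < n := by exact_mod_cast hn1
  have hn1' : (1 : ℝ) ≤ n := by exact_mod_cast hn1
  have hx0 : 0 < x := by linarith
  have hL : 0 ≤ Real.log n := Real.log_natCast_nonneg n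
  have hlx : 1 - x⁻¹ ≤ Real.log x := Real.one_sub_inv_le_log_of_pos hx0
  have hlx0 : 0 ≤ Real.log x := Real.log_nonneg hx.le
  refine (Pr_cnt_le hq hq1 J hx0 (μ := b * (n * Real.log n)) ?_).trans ?_
  · intro ω hω
    have : (m : ℝ) + 1 ≤ cnt J ω := by exact_mod_cast hω
    exact mul_le_mul_of_nonneg_right (hm.trans this) hlx0
  · refine le_trans ?_ hn.le
    rw [pow_zero, one_mul, one_mul, card_edgeType_cast]
    refine Real.exp_le_exp.mpr ?_
    have hs0 : 0 ≤ ∑ i ∈ J, q i := Finset.sum_nonneg fun i _ => hq i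
    have e1 : (∑ i ∈ J, q i) * (x - 1) * (n * (n - 1) / 2 : ℝ) ≤
        a * Real.log n / n * (x - 1) * (n * n / 2) := by
      have : 0 ≤ x - 1 := by linarith
      have : 0 ≤ (n : ℝ) - 1 := by linarith
      gcongr
      · exact mul_nonneg (hs0.trans hJ) (by linarith)
      · linarith
    have e2 : a * Real.log n / n * (x - 1) * (n * n / 2) =
        a / 2 * (x - 1) * (n * Real.log n) := by field_simp
    have e3 : b * (n * Real.log n) * (1 - x⁻¹) ≤ b * (n * Real.log n) * Real.log x := by gcongr
    have e4 : b * (n * Real.log n) * (1 - x⁻¹) = b / x * (x - 1) * (n * Real.log n) := by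
      field_simp
    have e5 : c * Real.log n ≤ c * (n * Real.log n) := by
      gcongr; nlinarith
    have e6 : c * (n * Real.log n) = b / x * (x - 1) * (n * Real.log n) -
      a / 2 * (x - 1) * (n * Real.log n) := by rw [hc]; ring
    linarith

lemma eventually_Pr_cnt_lt_le {a b x η : ℝ} (hx0 : 0 < x) (hx : x < 1) (h : b / x < a / 2)
    (hb : 0 ≤ b) (hη : 0 < η) :
    ∀ᶠ n : ℕ in atTop, ∀ q : Fin 3 → ℝ, (∀ i, 0 ≤ q i) → ∑ i, q i = 1 → ∀ (J : Finset (Fin 3))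
      (m : ℕ), a * Real.log n / n ≤ ∑ i ∈ J, q i → (m : ℝ) ≤ b * (n * Real.log n) →
      Pr q {ω : EdgeType n → Fin 3 | cnt J ω < m} ≤ η := by
  set c := (1 - x) * (a / 2 - b / x) / 2 with hc
  have hc0 : 0 < c := by
    have := mul_pos (sub_pos.mpr hx) (sub_pos.mpr h)
    positivity
  have h1 := (tendsto_log_pow_mul_exp 1 0 hc0).eventually (gt_mem_nhds hη)
  filter_upwards [h1, eventually_ge_atTop 1, eventually_le_nat (a * (1 - x) / (2 * c) + 1)] with
    n hn hn1 hn2 q hq hq1 J m hJ hm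
  have hn0 : (0 : ℝ) < n := by exact_mod_cast hn1
  have hn1' : (1 : ℝ) ≤ n := by exact_mod_cast hn1
  have hL : 0 ≤ Real.log n := Real.log_natCast_nonneg n
  have hlx : 1 - x⁻¹ ≤ Real.log x := Real.one_sub_inv_le_log_of_pos hx0
  have hlx0 : Real.log x ≤ 0 := Real.log_nonpos hx0.le hx.le
  refine (Pr_cnt_le hq hq1 J hx0 (μ := b * (n * Real.log n)) ?_).trans ?_
  · intro ω hω
    have h2 : (cnt J ω : ℝ) ≤ m := by exact_mod_cast le_of_lt hω
    exact mul_le_mul_of_nonpos_right (h2.trans hm) hlx0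
  · refine le_trans ?_ hn.le
    rw [pow_zero, one_mul, one_mul, card_edgeType_cast]
    refine Real.exp_le_exp.mpr ?_
    have e1 : (∑ i ∈ J, q i) * ((1 - x) * (n * (n - 1) / 2 : ℝ)) ≥
        a * Real.log n / n * ((1 - x) * (n * (n - 1) / 2)) := by
      have : 0 ≤ 1 - x := by linarith
      have : 0 ≤ (n : ℝ) - 1 := by linarith
      exact mul_le_mul_of_nonneg_right hJ (by positivity)
    have e2 : a * Real.log n / n * ((1 - x) * (n * (n - 1) / 2)) =
        a / 2 * (1 - x) * (n * Real.log n) - a / 2 * (1 - x) * Real.log n := by field_simp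
    have e3 : b * (n * Real.log n) * (1 - x⁻¹) ≤ b * (n * Real.log n) * Real.log x := by gcongr
    have e4 : b * (n * Real.log n) * (1 - x⁻¹) = -(b / x * (1 - x) * (n * Real.log n)) := by
      field_simp; ring
    have e6 : 2 * c * (n * Real.log n) = a / 2 * (1 - x) * (n * Real.log n) -
      b / x * (1 - x) * (n * Real.log n) := by rw [hc]; ring
    have e7 : a / 2 * (1 - x) * Real.log n + c * Real.log n ≤ c * (n * Real.log n) := by
      have e8 : a * (1 - x) / (2 * c) * c = a / 2 * (1 - x) := by field_simp
      have e9 : (a * (1 - x) / (2 * c) + 1) * c ≤ n * c := by gcongr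
      have e10 : (a / 2 * (1 - x) + c) * Real.log n ≤ (n * c) * Real.log n := by
        gcongr; linarith
      linarith
    have e11 : 0 ≤ c * (n * Real.log n) := by positivity
    linarith

/-- A number of steps after which some vertex is still of degree at most one. -/
def lowStep (n : ℕ) : ℕ := ⌊2 / 5 * (n * Real.log n)⌋₊

/-- A number of steps after which all degrees are at least two. -/
def highStep (n : ℕ) : ℕ := ⌊n * Real.log n⌋₊

lemma mul_log_nonneg (n : ℕ) : 0 ≤ n * Real.log n :=
  mul_nonneg n.cast_nonneg (Real.log_natCast_nonneg n)

lemma exp_neg_two_le : Real.exp (-2) ≤ 7 / 50 := by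
  have h1 := Real.exp_one_gt_d9
  have h2 : Real.exp 2 = Real.exp 1 * Real.exp 1 := by rw [← Real.exp_add]; norm_num
  rw [Real.exp_neg, inv_le_comm₀ (Real.exp_pos _) (by norm_num), h2]
  nlinarith

lemma pow_mul_pathBound_le {n : ℕ} (hn : 100 ≤ n) {q : Fin 3 → ℝ}
    (hq0 : q 0 = 7 / 10 * Real.log n / n) (hq2 : 1 - q 2 = 4 * Real.log n / n) {θ₁ : ℝ}
    (hθ : 0 < θ₁) (hθ1 : θ₁ ≤ 1 / 100) {k : ℕ} (hk : k ≤ 4) :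
    (n : ℝ) ^ (k + 1) * pathBound n q (2 * ⌈θ₁ * Real.log n⌉₊) 2 k ≤
      Real.exp 8 * 4 ^ k * (Real.log n ^ k * Real.exp (-(7 / 100 * Real.log n))) := by
  have hn0 : (0 : ℝ) < n := by exact_mod_cast (by omega : 0 < n)
  have hn' : (100 : ℝ) ≤ n := by exact_mod_cast hn
  have hk' : (k : ℝ) ≤ 4 := by exact_mod_cast hk
  set L := Real.log n with hL
  have hL0 : 0 ≤ L := Real.log_natCast_nonneg n
  have hnL : (n : ℝ) = Real.exp L := (Real.exp_log hn0).symm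
  have h1 := (Nat.ceil_lt_add_one (mul_nonneg hθ.le hL0)).le
  have h2 : (2 : ℝ) * (2 * ((2 * ⌈θ₁ * L⌉₊ : ℕ) : ℝ)) ≤ 8 / 100 * L + 8 := by
    push_cast
    nlinarith
  have h3 : 115 / 100 * L ≤ q 0 * (1 - Real.exp (-2)) * (2 * n - 3 - k) := by
    have e1 := exp_neg_two_le
    have e2 : 0 ≤ q 0 := by rw [hq0]; positivity
    calc 115 / 100 * L ≤ 7 / 10 * L * (43 / 50) * (2 - 7 / 100) := by nlinarith
      _ ≤ 7 / 10 * L * (43 / 50) * ((2 * n - 7) / n) := by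
        have : (2 : ℝ) - 7 / 100 ≤ (2 * n - 7) / n := by
          rw [le_div_iff₀ hn0]; linarith
        gcongr
      _ = q 0 * (43 / 50) * (2 * n - 7) := by rw [hq0]; field_simp
      _ ≤ _ := by
        have e3 : (43 : ℝ) / 50 ≤ 1 - Real.exp (-2) := by linarith
        exact mul_le_mul (mul_le_mul_of_nonneg_left e3 e2) (by linarith) (by linarith)
          (mul_nonneg e2 (by linarith))
  calc (n : ℝ) ^ (k + 1) * pathBound n q (2 * ⌈θ₁ * L⌉₊) 2 k
      ≤ (n : ℝ) ^ (k + 1) * (Real.exp (8 / 100 * L + 8) *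
          ((4 * L / n) ^ k * Real.exp (-(115 / 100 * L)))) := by
        unfold pathBound
        rw [hq2]
        gcongr
    _ = 4 ^ k * L ^ k * (n * Real.exp (8 / 100 * L + 8) * Real.exp (-(115 / 100 * L))) := by
        rw [div_pow, mul_pow, pow_succ]
        field_simp
    _ = 4 ^ k * L ^ k * (Real.exp 8 * Real.exp (-(7 / 100 * L))) := by
        rw [hnL, ← Real.exp_add, ← Real.exp_add, ← Real.exp_add]
        congr 2
        ring
    _ = _ := by ring

theorem eventually_PP_not_scattered_le {θ₁ : ℝ} (hθ : 0 < θ₁) (hθ1 : θ₁ ≤ 1 / 100) :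
    ∃ δ : ℝ, 0 < δ ∧ δ ≤ 1 / 8 ∧ ∀ η : ℝ, 0 < η → ∀ᶠ n : ℕ in atTop,
      PP {σ : ProcessSpace n | ¬ Scattered (processGraph σ (lowStep n))
        (processGraph σ (highStep n)) (2 * ⌈θ₁ * Real.log n⌉₊) (θ₁ * Real.log n / 8) δ} ≤ η := by
  refine ⟨min (1 / 8) (Real.exp (-(64 / θ₁)) / 8), by positivity, min_le_left _ _, ?_⟩
  set δ := min (1 / 8) (Real.exp (-(64 / θ₁)) / 8) with hδ
  intro η hη
  have hlim : Tendsto (fun n : ℕ => 4096 * (Real.log n ^ 6 * Real.exp (-(1 * Real.log n))) +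
      Real.exp 8 * 4 ^ 1 * (Real.log n ^ 1 * Real.exp (-(7 / 100 * Real.log n))) +
      Real.exp 8 * 4 ^ 2 * (Real.log n ^ 2 * Real.exp (-(7 / 100 * Real.log n))) +
      Real.exp 8 * 4 ^ 4 * (Real.log n ^ 4 * Real.exp (-(7 / 100 * Real.log n))) +
      Real.exp 1 * (Real.log n ^ 0 * Real.exp (-(1 * Real.log n)))) atTop (nhds 0) := by
    have := ((((tendsto_log_pow_mul_exp 4096 6 one_pos).add
      (tendsto_log_pow_mul_exp (Real.exp 8 * 4 ^ 1) 1 (c := 7 / 100) (by norm_num))).add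
      (tendsto_log_pow_mul_exp (Real.exp 8 * 4 ^ 2) 2 (c := 7 / 100) (by norm_num))).add
      (tendsto_log_pow_mul_exp (Real.exp 8 * 4 ^ 4) 4 (c := 7 / 100) (by norm_num))).add
      (tendsto_log_pow_mul_exp (Real.exp 1) 0 one_pos)
    simpa only [add_zero] using this
  filter_upwards [hlim.eventually (gt_mem_nhds (half_pos hη)), eventually_ge_atTop 100,
    eventually_mul_log_le (c := 1 / 4) (by norm_num),
    eventually_Pr_cnt_gt_le (a := 7 / 10) (b := 2 / 5) (x := 11 / 10) (η := η / 4) (by norm_num)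
      (by norm_num) (by linarith),
    eventually_Pr_cnt_lt_le (a := 4) (b := 1) (x := 3 / 4) (η := η / 4) (by norm_num) (by norm_num)
      (by norm_num) (by norm_num) (by linarith)] with n hn hn100 hlog hgt hlt
  have hn0 : (0 : ℝ) < n := by exact_mod_cast (by omega : 0 < n)
  set L := Real.log n with hL
  have hL0 : 0 ≤ L := Real.log_natCast_nonneg n
  set q : Fin 3 → ℝ := ![7 / 10 * L / n, 4 * L / n - 7 / 10 * L / n, 1 - 4 * L / n] with hqdef
  have hq0 : q 0 = 7 / 10 * L / n := rfl
  have hq1' : q 1 = 4 * L / n - 7 / 10 * L / n := rfl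
  have hq2 : q 2 = 1 - 4 * L / n := rfl
  have hp1 : 4 * L / n ≤ 1 := by rw [div_le_one hn0]; linarith
  have hp01 : 7 / 10 * L / n ≤ 4 * L / n := by gcongr; linarith
  have hq : ∀ i, 0 ≤ q i := by
    intro i
    fin_cases i
    · change 0 ≤ q 0; rw [hq0]; positivity
    · change 0 ≤ q 1; rw [hq1']; linarith
    · change 0 ≤ q 2; rw [hq2]; linarith
  have hq1 : ∑ i, q i = 1 := by rw [Fin.sum_univ_three, hq0, hq1', hq2]; ring
  have hq2' : 1 - q 2 = 4 * L / n := by rw [hq2]; ring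
  have hK : 4 * L + (1 - q 2) * Real.exp (64 / θ₁) * (4 * δ * n) ≤ 64 / θ₁ * (θ₁ * L / 8) := by
    have e1 : Real.exp (64 / θ₁) * δ ≤ 1 / 8 := by
      calc Real.exp (64 / θ₁) * δ ≤ Real.exp (64 / θ₁) * (Real.exp (-(64 / θ₁)) / 8) := by
            gcongr; exact min_le_right _ _
        _ = 1 / 8 := by rw [mul_div_assoc', ← Real.exp_add, add_neg_cancel, Real.exp_zero]
    have e2 : 64 / θ₁ * (θ₁ * L / 8) = 8 * L := by field_simp; ring
    have e3 : (1 - q 2) * Real.exp (64 / θ₁) * (4 * δ * n) =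
        16 * L * (Real.exp (64 / θ₁) * δ) := by rw [hq2']; field_simp; ring
    rw [e2, e3]
    nlinarith
  have hmain := Pr_not_scattered_le hq hq1 (by omega : 1 ≤ n) (2 * ⌈θ₁ * L⌉₊) (y := 2) (by norm_num)
    (by positivity) hK
  have hgt' := hgt q hq hq1 {0} (lowStep n) (by simp [hq0]) (Nat.lt_floor_add_one _).le
    (by norm_num)
  have hlt' := hlt q hq hq1 {0, 1} (highStep n) (by simp [hq0, hq1']) (by
    rw [one_mul]; exact Nat.floor_le (mul_log_nonneg n))
  have hPP := PP_le_add hq hq1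
    (Ω₀ := {ω : EdgeType n → Fin 3 | cnt {0} ω ≤ lowStep n ∧ highStep n ≤ cnt {0, 1} ω})
    (Bad := {ω : EdgeType n → Fin 3 | ¬ Scattered (edgesGraph {e | ω e = 0})
      (edgesGraph {e | ω e ≠ 2}) (2 * ⌈θ₁ * L⌉₊) (θ₁ * L / 8) δ})
    (Ev := {σ : ProcessSpace n | ¬ Scattered (processGraph σ (lowStep n))
        (processGraph σ (highStep n)) (2 * ⌈θ₁ * L⌉₊) (θ₁ * L / 8) δ})
    (by
      intro ω hω π
      change cnt {0} (ω ∘ π) ≤ _ ∧ _ ≤ cnt {0, 1} (ω ∘ π)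
      rw [cnt_comp, cnt_comp]
      exact hω)
    (by
      rintro ω ⟨hω0, hω1⟩ σ hσ hmono hs
      refine hσ (hs.mono ?_ ?_)
      · rw [processGraph_eq]
        refine edgesGraph_mono fun e he => ?_
        exact lt_of_cnt_le (J := {0}) (by decide) hmono hω0 (by simpa using he)
      · rw [processGraph_eq]
        refine edgesGraph_mono fun e he => ?_
        have := label_mem_of_lt (J := {0, 1}) (by decide) hmono hω1 he
        intro h2
        rw [h2] at this
        exact absurd this (by decide))
  have hcompl : Pr q {ω : EdgeType n → Fin 3 | cnt {0} ω ≤ lowStep n ∧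
      highStep n ≤ cnt {0, 1} ω}ᶜ ≤ η / 4 + η / 4 := by
    refine (Pr_mono hq (T := {ω | lowStep n < cnt {0} ω} ∪ {ω | cnt {0, 1} ω < highStep n})
      ?_).trans ((Pr_union_le hq _ _).trans (add_le_add hgt' hlt'))
    intro ω hω
    by_contra hcon
    simp only [Set.mem_union, Set.mem_ofPred_eq, not_or, not_lt] at hcon
    exact hω hcon
  have t1 := pow_mul_pathBound_le hn100 hq0 hq2' hθ hθ1 (k := 1) (by norm_num)
  have t2 := pow_mul_pathBound_le hn100 hq0 hq2' hθ hθ1 (k := 2) (by norm_num)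
  have t4 := pow_mul_pathBound_le hn100 hq0 hq2' hθ hθ1 (k := 4) (by norm_num)
  have hexp : Real.exp (-(1 * L)) = 1 / n := by
    rw [one_mul, Real.exp_neg, Real.exp_log hn0, one_div]
  have t6 : (n : ℝ) ^ 5 * (1 - q 2) ^ 6 = 4096 * (L ^ 6 * Real.exp (-(1 * L))) := by
    rw [hq2', hexp, div_pow, mul_pow]; field_simp; ring
  have t0 : Real.exp 1 / n = Real.exp 1 * (L ^ 0 * Real.exp (-(1 * L))) := by
    rw [hexp]; field_simp
  rw [t6, t0] at hmain
  linarith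

section

variable {E : Type*} [Fintype E] [DecidableEq E]

/-- The second moment method. -/
lemma Pr_forall_notMem_mul_sq_le {q : Fin 3 → ℝ} (hq : ∀ i, 0 ≤ q i) (hq1 : ∑ i, q i = 1)
    {ι : Type*} [Fintype ι] [DecidableEq ι] (A : ι → Set (E → Fin 3)) {a b : ℝ}
    (hA : ∀ i, Pr q (A i) = a) (hb : 0 ≤ b) (hAb : ∀ i j, i ≠ j → Pr q (A i ∩ A j) ≤ b) :
    Pr q {ω | ∀ i, ω ∉ A i} * (Fintype.card ι * a) ^ 2 ≤
      Fintype.card ι * a + (Fintype.card ι : ℝ) ^ 2 * (b - a ^ 2) := by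
  classical
  set N : ℝ := (Fintype.card ι : ℝ) with hN
  have hPr : ∀ S : Set (E → Fin 3), Pr q S = ∑ ω, wt q ω * S.indicator 1 ω := by
    intro S
    unfold Pr
    refine Finset.sum_congr rfl fun ω _ => ?_
    by_cases h : ω ∈ S <;> simp [h]
  have h1 : ∑ ω : E → Fin 3, wt q ω = 1 := by
    have := Pr_univ (E := E) hq1
    rw [hPr] at this
    simpa using this
  have h2 : Pr q {ω | ∀ i, ω ∉ A i} * (N * a) ^ 2 ≤
      ∑ ω, wt q ω * (∑ i, (A i).indicator 1 ω - N * a) ^ 2 := by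
    rw [hPr, Finset.sum_mul]
    refine Finset.sum_le_sum fun ω _ => ?_
    rw [mul_assoc]
    refine mul_le_mul_of_nonneg_left ?_ (wt_nonneg hq ω)
    by_cases h : ω ∈ {ω | ∀ i, ω ∉ A i}
    · rw [Finset.sum_eq_zero fun i _ => Set.indicator_of_notMem (h i) _,
        Set.indicator_of_mem h]
      simp
    · rw [Set.indicator_of_notMem h, zero_mul]
      positivity
  have h3 : ∑ ω, wt q ω * (∑ i, (A i).indicator 1 ω - N * a) ^ 2 =
      ∑ i, ∑ j, Pr q (A i ∩ A j) - 2 * (N * a) * ∑ i, Pr q (A i) + (N * a) ^ 2 := by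
    have e1 : ∑ i, ∑ j, Pr q (A i ∩ A j) =
        ∑ ω, wt q ω * (∑ i, (A i).indicator 1 ω) ^ 2 := by
      simp only [hPr]
      rw [Finset.sum_congr rfl fun i _ => Finset.sum_comm, Finset.sum_comm]
      refine Finset.sum_congr rfl fun ω _ => ?_
      rw [pow_two, Finset.sum_mul_sum, Finset.mul_sum]
      refine Finset.sum_congr rfl fun i _ => ?_
      rw [Finset.mul_sum]
      simp only [Set.inter_indicator_one, Pi.mul_apply]
    have e2 : ∑ i, Pr q (A i) = ∑ ω, wt q ω * ∑ i, (A i).indicator 1 ω := by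
      simp only [hPr, Finset.mul_sum]
      rw [Finset.sum_comm]
    rw [e1, e2, Finset.mul_sum, ← Finset.sum_sub_distrib, ← mul_one ((N * a) ^ 2), ← h1,
      Finset.mul_sum, ← Finset.sum_add_distrib]
    refine Finset.sum_congr rfl fun ω _ => ?_
    ring
  have h4 : ∑ i, ∑ j, Pr q (A i ∩ A j) ≤ N * a + N ^ 2 * b := by
    have e1 : ∀ i, ∑ j, Pr q (A i ∩ A j) ≤ a + N * b := by
      intro i
      calc ∑ j, Pr q (A i ∩ A j) ≤ ∑ j, ((if i = j then a else 0) + b) := by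
            refine Finset.sum_le_sum fun j _ => ?_
            split_ifs with h
            · rw [← h, Set.inter_self, hA]; linarith
            · rw [zero_add]; exact hAb i j h
        _ = a + N * b := by
            rw [Finset.sum_add_distrib]; simp [hN]
    calc _ ≤ ∑ _i : ι, (a + N * b) := Finset.sum_le_sum fun i _ => e1 i
      _ = N * a + N ^ 2 * b := by rw [Finset.sum_const, nsmul_eq_mul, Finset.card_univ]; ring
  have h5 : ∑ i, Pr q (A i) = N * a := by simp [hA, hN]
  rw [h3, h5] at h2
  linarith

end

lemma Pr_no_isolated_le {n : ℕ} (hn : 2 ≤ n) {q : Fin 3 → ℝ} (hq : ∀ i, 0 ≤ q i)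
    (hq1 : ∑ i, q i = 1) (hq0 : q 0 ≤ 1 / 50) :
    Pr q {ω : EdgeType n → Fin 3 | ∀ v, ∃ e ∈ star v, ω e = 0} ≤
      1 / (n * Real.exp (-(50 / 49 * q 0 * n))) + 2 * q 0 := by
  set p := q 0 with hp
  have hp0 : 0 ≤ p := hq 0
  have hn0 : (0 : ℝ) < n := by exact_mod_cast (by omega : 0 < n)
  set a : ℝ := (1 - p) ^ (n - 1) with ha
  set b : ℝ := (1 - p) ^ (2 * n - 3) with hb
  have h1p : 0 < 1 - p := by linarith
  have ha0 : 0 < a := by positivity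
  have hab : b * (1 - p) = a ^ 2 := by
    rw [ha, hb, ← pow_succ, ← pow_mul]
    congr 1
    omega
  have h1 := Pr_forall_notMem_mul_sq_le hq hq1 (ι := Fin n)
    (fun v => {ω : EdgeType n → Fin 3 | ∀ e ∈ star v, ω e ≠ 0}) (a := a) (b := b)
    (fun v => by rw [Pr_forall_ne_zero hq1, card_star]) (by positivity) (by
      intro u v huv
      refine (Pr_mono hq (T := {ω | ∀ e ∈ star u ∪ star v, ω e ≠ 0}) ?_).trans ?_
      · rintro ω ⟨h1, h2⟩ e he
        rcases Finset.mem_union.mp he with h | h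
        exacts [h1 e h, h2 e h]
      · rw [Pr_forall_ne_zero hq1]
        have h3 : (star u ∪ star v).card = 2 * n - 3 := by
          have h4 := card_star_union huv
          have h5 : (star u ∪ star v).card + 3 = 2 * n := by
            have : ((star u ∪ star v).card : ℝ) + 3 = 2 * n := by linarith
            exact_mod_cast this
          omega
        rw [h3])
  rw [Fintype.card_fin] at h1
  have hset : {ω : EdgeType n → Fin 3 | ∀ v, ∃ e ∈ star v, ω e = 0} =
      {ω : EdgeType n → Fin 3 | ∀ v, ω ∉ {ω : EdgeType n → Fin 3 | ∀ e ∈ star v, ω e ≠ 0}} := by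
    ext ω
    simp
  rw [hset]
  have hapow : Real.exp (-(50 / 49 * p * n)) ≤ a := by
    have e1 : Real.exp (-(50 / 49 * p)) ≤ 1 - p := by
      rw [← Real.le_log_iff_exp_le h1p]
      have e2 := Real.one_sub_inv_le_log_of_pos h1p
      have e3 : (1 - p)⁻¹ ≤ 1 + 50 / 49 * p := by
        rw [inv_le_iff_one_le_mul₀ h1p]
        nlinarith
      linarith
    calc Real.exp (-(50 / 49 * p * n)) = Real.exp (-(50 / 49 * p)) ^ n := by
          rw [← Real.exp_nat_mul]; congr 1; ring
      _ ≤ Real.exp (-(50 / 49 * p)) ^ (n - 1) :=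
          pow_le_pow_of_le_one (Real.exp_nonneg _) (e1.trans (by linarith)) (by omega)
      _ ≤ a := by rw [ha]; gcongr
  have hbp : b - a ^ 2 ≤ a ^ 2 * (2 * p) := by
    have hb0 : 0 ≤ b := by positivity
    rw [← hab]
    nlinarith [mul_nonneg hb0 hp0]
  have h2 : Pr q {ω : EdgeType n → Fin 3 | ∀ v, ω ∉ {ω : EdgeType n → Fin 3 |
      ∀ e ∈ star v, ω e ≠ 0}} ≤ 1 / (n * a) + 2 * p := by
    have h3 : 0 < (n * a) ^ 2 := by positivity
    refine le_of_mul_le_mul_right (h1.trans ?_) h3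
    have e1 : (1 / (n * a) + 2 * p) * (n * a) ^ 2 = n * a + (n : ℝ) ^ 2 * (a ^ 2 * (2 * p)) := by
      field_simp
    rw [e1]
    gcongr
  refine h2.trans ?_
  gcongr

lemma nb_card_le_deg {n : ℕ} {G G' : SimpleGraph (Fin n)} (h : G ≤ G') (v : Fin n) :
    (nb G v).card ≤ deg G' v := by
  rw [deg_eq_card_nb]
  exact Finset.card_le_card (nb_mono h v)

theorem eventually_PP_lowStep_le {η : ℝ} (hη : 0 < η) : ∀ᶠ n : ℕ in atTop,
    PP {σ : ProcessSpace n | ∀ v, 2 ≤ deg (processGraph σ (lowStep n)) v} ≤ η := by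
  have hlim : Tendsto (fun n : ℕ => 1 * (Real.log n ^ 0 * Real.exp (-(3 / 100 * Real.log n))) +
      2 * (Real.log n ^ 1 * Real.exp (-(1 * Real.log n)))) atTop (nhds 0) := by
    have := (tendsto_log_pow_mul_exp 1 0 (c := 3 / 100) (by norm_num)).add
      (tendsto_log_pow_mul_exp 2 1 one_pos)
    simpa only [add_zero] using this
  filter_upwards [hlim.eventually (gt_mem_nhds (half_pos hη)), eventually_ge_atTop 2,
    eventually_mul_log_le (c := 1 / 50) (by norm_num),
    eventually_Pr_cnt_lt_le (a := 95 / 100) (b := 2 / 5) (x := 9 / 10) (η := η / 2) (by norm_num)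
      (by norm_num) (by norm_num) (by norm_num) (by linarith)] with n hn hn2 hlog hlt
  have hn0 : (0 : ℝ) < n := by exact_mod_cast (by omega : 0 < n)
  set L := Real.log n with hL
  have hL0 : 0 ≤ L := Real.log_natCast_nonneg n
  set p := 95 / 100 * L / n with hp
  have hp0 : 0 ≤ p := by positivity
  have hp1 : p ≤ 1 / 50 := by rw [hp, div_le_iff₀ hn0]; linarith
  have hq := qm_nonneg hp0 (by linarith : p ≤ 1)
  have hqp : qm p 0 = p := rfl
  have hlt' := hlt (qm p) hq (qm_sum p) {0} (lowStep n) (by simp [hqp])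
    (Nat.floor_le (by have := mul_log_nonneg n; positivity))
  have hmain := Pr_no_isolated_le hn2 hq (qm_sum p) (by rwa [hqp])
  have hPP := PP_le_add hq (qm_sum p)
    (Ω₀ := {ω : EdgeType n → Fin 3 | lowStep n ≤ cnt {0} ω})
    (Bad := {ω : EdgeType n → Fin 3 | ∀ v, ∃ e ∈ star v, ω e = 0})
    (Ev := {σ : ProcessSpace n | ∀ v, 2 ≤ deg (processGraph σ (lowStep n)) v})
    (by
      intro ω hω π
      change _ ≤ cnt {0} (ω ∘ π)
      rw [cnt_comp]
      exact hω)
    (by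
      intro ω hω σ hσ hmono v
      have h1 := hσ v
      rw [deg_eq_card_nb, processGraph_eq, card_nb_edgesGraph] at h1
      obtain ⟨e, he⟩ := Finset.card_pos.mp (lt_of_lt_of_le two_pos h1)
      replace he := (@Finset.mem_filter _ _ (_) _ _).mp he
      refine ⟨e, he.1, ?_⟩
      simpa using label_mem_of_lt (J := {0}) (by decide) hmono hω he.2)
  have hcompl : {ω : EdgeType n → Fin 3 | lowStep n ≤ cnt {0} ω}ᶜ =
      {ω | cnt {0} ω < lowStep n} := by
    ext ω; simp
  rw [hcompl] at hPP
  rw [hqp] at hmain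
  have e1 : 1 / (n * Real.exp (-(50 / 49 * p * n))) ≤ Real.exp (-(3 / 100 * L)) := by
    have e2 : (n : ℝ) = Real.exp L := (Real.exp_log hn0).symm
    have e3 : 50 / 49 * p * n = 50 / 49 * (95 / 100) * L := by rw [hp]; field_simp
    rw [e3, e2, ← Real.exp_add, one_div, ← Real.exp_neg]
    apply Real.exp_le_exp.mpr
    linarith
  have e4 : 2 * p ≤ 2 * (L ^ 1 * Real.exp (-(1 * L))) := by
    rw [one_mul, Real.exp_neg, Real.exp_log hn0, hp, pow_one, ← div_eq_mul_inv]
    gcongr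
    linarith
  rw [pow_zero, one_mul, one_mul] at hn
  linarith

theorem eventually_PP_highStep_le {η : ℝ} (hη : 0 < η) : ∀ᶠ n : ℕ in atTop,
    PP {σ : ProcessSpace n | ¬ ∀ v, 2 ≤ deg (processGraph σ (highStep n)) v} ≤ η := by
  have hlim := tendsto_log_pow_mul_exp (Real.exp 2) 0 (c := 1 / 5) (by norm_num)
  filter_upwards [hlim.eventually (gt_mem_nhds (half_pos hη)), eventually_ge_atTop 100,
    eventually_mul_log_le (c := 1 / 2) (by norm_num),
    eventually_Pr_cnt_gt_le (a := 3 / 2) (b := 1) (x := 6 / 5) (η := η / 2) (by norm_num)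
      (by norm_num) (by linarith)] with n hn hn100 hlog hgt
  have hn0 : (0 : ℝ) < n := by exact_mod_cast (by omega : 0 < n)
  have hn' : (100 : ℝ) ≤ n := by exact_mod_cast hn100
  set L := Real.log n with hL
  have hL0 : 0 ≤ L := Real.log_natCast_nonneg n
  set p := 3 / 2 * L / n with hp
  have hp0 : 0 ≤ p := by positivity
  have hp1 : p ≤ 1 := by rw [hp, div_le_iff₀ hn0]; linarith
  have hq := qm_nonneg hp0 hp1
  have hqp : qm p 0 = p := rfl
  have hgt' := hgt (qm p) hq (qm_sum p) {0} (highStep n) (by simp [hqp])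
    (by rw [one_mul]; exact (Nat.lt_floor_add_one _).le) one_pos.le
  have hPP := PP_le_add hq (qm_sum p)
    (Ω₀ := {ω : EdgeType n → Fin 3 | cnt {0} ω ≤ highStep n})
    (Bad := {ω : EdgeType n → Fin 3 | ∃ v, ((star v).filter fun e => ω e = 0).card ≤ 1})
    (Ev := {σ : ProcessSpace n | ¬ ∀ v, 2 ≤ deg (processGraph σ (highStep n)) v})
    (by
      intro ω hω π
      change cnt {0} (ω ∘ π) ≤ _
      rw [cnt_comp]
      exact hω)
    (by
      intro ω hω σ hσ hmono
      by_contra hcon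
      simp only [Set.mem_ofPred_eq, not_exists, not_le] at hcon
      refine hσ fun v => Nat.succ_le_of_lt ((hcon v).trans_le ?_)
      have h1 := nb_card_le_deg (G := edgesGraph {e | ω e = 0}) (G' := processGraph σ (highStep n))
        (by
          rw [processGraph_eq]
          refine edgesGraph_mono fun e he => ?_
          exact lt_of_cnt_le (J := {0}) (by decide) hmono hω (by simpa using he)) v
      rw [card_nb_edgesGraph] at h1
      refine le_trans (le_of_eq ?_) h1
      congr!)
  have hcompl : {ω : EdgeType n → Fin 3 | cnt {0} ω ≤ highStep n}ᶜ =
      {ω | highStep n < cnt {0} ω} := by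
    ext ω; simp
  rw [hcompl] at hPP
  have hv : ∀ v : Fin n, Pr (qm p) {ω : EdgeType n → Fin 3 |
      ((star v).filter fun e => ω e = 0).card ≤ 1} ≤
      Real.exp 2 * Real.exp (-(6 / 5 * L)) := by
    intro v
    have h1 := Pr_low_le hq (qm_sum p) (star v) ∅ 1 (y := 2) (by norm_num)
    simp only [Finset.notMem_empty, false_implies, implies_true, true_and, Finset.card_empty,
      pow_zero, one_mul, Nat.cast_one, mul_one, Nat.cast_zero, sub_zero, card_star, hqp] at h1
    refine h1.trans (mul_le_mul_of_nonneg_left (Real.exp_le_exp.mpr (neg_le_neg ?_))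
      (Real.exp_nonneg _))
    have e1 := exp_neg_two_le
    have e2 : (99 / 100 * n : ℝ) ≤ ((n - 1 : ℕ) : ℝ) := by
      rw [Nat.cast_sub (by omega)]; push_cast; linarith
    calc 6 / 5 * L ≤ 3 / 2 * L * (43 / 50) * (99 / 100) := by nlinarith
      _ = p * (43 / 50) * (99 / 100 * n) := by rw [hp]; field_simp
      _ ≤ _ := by
        have e3 : (43 : ℝ) / 50 ≤ 1 - Real.exp (-2) := by linarith
        exact mul_le_mul (mul_le_mul_of_nonneg_left e3 hp0) e2 (by positivity)
          (mul_nonneg hp0 (by linarith))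
  have hbad : Pr (qm p) {ω : EdgeType n → Fin 3 |
      ∃ v, ((star v).filter fun e => ω e = 0).card ≤ 1} ≤ η / 2 := by
    refine (Pr_le_sum hq (Finset.univ : Finset (Fin n)) (fun v => {ω |
      ((star v).filter fun e => ω e = 0).card ≤ 1}) ?_).trans ?_
    · rintro ω ⟨v, hv⟩
      exact ⟨v, Finset.mem_univ _, hv⟩
    · refine (Finset.sum_le_sum fun v _ => hv v).trans (le_trans (le_of_eq ?_) hn.le)
      rw [Finset.sum_const, Finset.card_univ, Fintype.card_fin, nsmul_eq_mul, pow_zero, one_mul]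
      have e2 : (n : ℝ) = Real.exp L := (Real.exp_log hn0).symm
      rw [e2, ← Real.exp_add, ← Real.exp_add, ← Real.exp_add]
      congr 1
      ring
  linarith

lemma processMeasure_apply {n : ℕ} (S : Set (ProcessSpace n)) :
    processMeasure n S = ENNReal.ofReal (PP S) := by
  classical
  have hc : (0 : ℝ) < Fintype.card (ProcessSpace n) := by
    have : Nonempty (ProcessSpace n) := ⟨(Fintype.equivFin _).symm⟩
    exact_mod_cast Fintype.card_pos
  have hS : MeasurableSet S := MeasurableSpace.measurableSet_top
  rw [processMeasure, Measure.smul_apply, Measure.sum_apply _ hS, tsum_fintype, PP,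
    ENNReal.ofReal_div_of_pos hc, ENNReal.ofReal_natCast, ENNReal.ofReal_natCast, smul_eq_mul,
    mul_comm, div_eq_mul_inv]
  congr 1
  rw [Finset.card_filter, Nat.cast_sum]
  refine Finset.sum_congr rfl fun σ _ => ?_
  rw [Measure.dirac_apply' _ hS]
  by_cases h : σ ∈ S <;> simp [h]

lemma one_le_PP_add_compl {n : ℕ} (S : Set (ProcessSpace n)) : 1 ≤ PP S + PP Sᶜ := by
  classical
  have hc : (Fintype.card (ProcessSpace n) : ℝ) ≠ 0 := by
    have : Nonempty (ProcessSpace n) := ⟨(Fintype.equivFin _).symm⟩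
    exact_mod_cast Fintype.card_ne_zero
  refine le_trans (le_of_eq ?_) (PP_union_le S Sᶜ)
  rw [Set.union_compl_self, PP]
  simp only [Set.mem_univ, Finset.filter_true, Finset.card_univ]
  exact (div_self hc).symm

lemma Resilient.anti {G : SimpleGraph V} {α β : ℝ} {P : SimpleGraph V → Prop}
    (h : Resilient G β P) (hαβ : α ≤ β) : Resilient G α P := fun H hH hdeg =>
  h H hH fun v => (hdeg v).trans (mul_le_mul_of_nonneg_right hαβ (Nat.cast_nonneg _))

theorem eventually_PP_not_resilient_le {ε η : ℝ} (hε : 0 < ε) (hε1 : ε ≤ 1 / 4) (hη : 0 < η) :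
    ∀ᶠ n : ℕ in atTop, PP {σ : ProcessSpace n |
      Resilient (processGraph σ (sInf {m : ℕ | ∀ v, 2 ≤ deg (processGraph σ m) v}))
        (1 / 2 - ε) IsHam}ᶜ ≤ η := by
  obtain ⟨M, hM, θ, hθ, hrot⟩ := exists_rotationRobust hε hε1
  have hθ₁ : 0 < min (θ / 2) (1 / 100) := by positivity
  obtain ⟨δ, hδ, hδ8, hscat⟩ := eventually_PP_not_scattered_le hθ₁ (min_le_right _ _)
  have hexp : Tendsto (fun n : ℕ => 3 * ((n : ℝ) ^ 2 * Real.exp (-n))) atTop (nhds 0) := by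
    have := ((Real.tendsto_pow_mul_exp_neg_atTop_nhds_zero 2).comp
      tendsto_natCast_atTop_atTop).const_mul 3
    rwa [mul_zero] at this
  filter_upwards [hrot, eventually_PP_hit_le hε hε1 (half_pos hδ) (by linarith),
    eventually_PP_lowStep_le (η := η / 4) (by linarith),
    eventually_PP_highStep_le (η := η / 4) (by linarith), hscat (η / 4) (by linarith),
    eventually_isHam_sdiff hε hε1 hθ₁ (min_le_left _ _) hδ hδ8 hM,
    hexp.eventually (gt_mem_nhds (by linarith : 0 < η / 4)),
    eventually_mul_log_le (c := 1) one_pos] with n h₁ h₂ hlow hhigh hsc hham hexp hlog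
  have hnL := mul_log_nonneg n
  have hhL : (highStep n : ℝ) ≤ n * Real.log n := Nat.floor_le hnL
  set I := Finset.Ioc (lowStep n) (highStep n) with hI
  have hsteps : ∀ m ∈ I, n * Real.log n / 4 ≤ m ∧ m ≤ n * Real.log n := by
    intro m hm
    obtain ⟨hm1, hm2⟩ := Finset.mem_Ioc.mp hm
    have e1 : 2 / 5 * (n * Real.log n) < m := Nat.lt_of_floor_lt hm1
    have e2 : (m : ℝ) ≤ highStep n := by exact_mod_cast hm2
    exact ⟨by linarith, e2.trans hhL⟩
  set Bad : ℕ → Set (ProcessSpace n) := fun m =>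
    {σ | ¬ RotationRobust (processGraph σ m) ε θ M} ∪
    {σ | ∃ Z : Finset (Fin n), (Z.card : ℝ) ≤ (1 / 2 + ε / 2) * n ∧ δ / 2 * n ≤
      (viol (processGraph σ m) (fun _ => Z) (1 / 2 + ε) (ε / 32 * Real.log n)).card} with hBad
  have hbad : PP {σ | ∃ m ∈ I, σ ∈ Bad m} ≤ 3 * ((n : ℝ) ^ 2 * Real.exp (-n)) := by
    refine (PP_le_sum I Bad fun σ hσ => hσ).trans ?_
    have e1 : ∀ m ∈ I, PP (Bad m) ≤ 3 * Real.exp (-n) := by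
      intro m hm
      obtain ⟨hm1, hm2⟩ := hsteps m hm
      refine (PP_union_le _ _).trans ((add_le_add (h₁ m hm1 hm2) (h₂ m hm1 hm2)).trans_eq ?_)
      ring
    refine (Finset.sum_le_sum e1).trans ?_
    rw [Finset.sum_const, nsmul_eq_mul]
    have e2 : (I.card : ℝ) ≤ n ^ 2 := by
      have : (I.card : ℝ) ≤ highStep n := by
        rw [hI, Nat.card_Ioc]
        exact_mod_cast Nat.sub_le _ _
      have e3 : n * Real.log n ≤ n * (1 * n) := by gcongr
      nlinarith
    have := Real.exp_nonneg (-(n : ℝ))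
    nlinarith
  refine (PP_mono (T := (({σ | ∀ v, 2 ≤ deg (processGraph σ (lowStep n)) v} ∪
    {σ | ¬ ∀ v, 2 ≤ deg (processGraph σ (highStep n)) v}) ∪ _) ∪ {σ | ∃ m ∈ I, σ ∈ Bad m})
    ?_).trans ((PP_union_le _ _).trans ((add_le_add ((PP_union_le _ _).trans
      (add_le_add ((PP_union_le _ _).trans (add_le_add hlow hhigh)) hsc)) hbad).trans
        (by linarith)))
  intro σ hσ
  by_contra hcon
  simp only [Set.mem_union, not_or, Set.mem_ofPred_eq, not_not, not_exists, not_and] at hcon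
  obtain ⟨⟨⟨hlo, hhi⟩, hs⟩, hgood⟩ := hcon
  refine hσ ?_
  set m := sInf {m : ℕ | ∀ v, 2 ≤ deg (processGraph σ m) v} with hm
  have hmem : m ∈ {m : ℕ | ∀ v, 2 ≤ deg (processGraph σ m) v} := Nat.sInf_mem ⟨highStep n, hhi⟩
  have hm2 : m ≤ highStep n := Nat.sInf_le hhi
  have hm1 : lowStep n < m := by
    by_contra hle
    refine hlo fun v => (hmem v).trans ?_
    rw [deg_eq_card_nb]
    exact nb_card_le_deg (processGraph_mono σ (not_lt.mp hle)) v
  have hmI : m ∈ I := Finset.mem_Ioc.mpr ⟨hm1, hm2⟩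
  have hg := hgood m hmI
  simp only [hBad, Set.mem_union, not_or, Set.mem_ofPred_eq, not_not, not_exists, not_and,
    not_le] at hg
  intro H hH hdeg
  refine hham (processGraph σ (lowStep n)) (processGraph σ m) (processGraph σ (highStep n)) H
    (processGraph_mono σ hm1.le) (processGraph_mono σ hm2) hH hdeg hmem ?_ hg.1 hg.2 hs
  have e1 : (dsum (processGraph σ m) : ℝ) ≤ 2 * m := by exact_mod_cast dsum_processGraph_le σ m
  have := (hsteps m hmI).2
  linarith

theorem statement_3 (ε : ℝ) (hε : 0 < ε) :
    Tendsto (fun n : ℕ =>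
      processMeasure n {σ : ProcessSpace n |
        Resilient (processGraph σ (sInf {m : ℕ | ∀ v, 2 ≤ deg (processGraph σ m) v}))
          (1 / 2 - ε) IsHam})
      atTop (nhds 1) := by
  simp only [processMeasure_apply]
  rw [← ENNReal.ofReal_one]
  refine ENNReal.tendsto_ofReal ?_
  rw [Metric.tendsto_nhds]
  intro η hη
  filter_upwards [eventually_PP_not_resilient_le (ε := min ε (1 / 4)) (by positivity)
    (min_le_right _ _) (half_pos hη)] with n hn
  set S := {σ : ProcessSpace n | Resilient (processGraph σ (sInf {m : ℕ | ∀ v,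
    2 ≤ deg (processGraph σ m) v})) (1 / 2 - min ε (1 / 4)) IsHam} with hS
  have h1 := one_le_PP_add_compl S
  have h2 := PP_mono (S := S) (T := {σ : ProcessSpace n | Resilient (processGraph σ
    (sInf {m : ℕ | ∀ v, 2 ≤ deg (processGraph σ m) v})) (1 / 2 - ε) IsHam})
    fun σ hσ => Resilient.anti hσ (by linarith [min_le_left ε (1 / 4)])
  rw [Real.dist_eq, abs_lt]
  have h3 := PP_le_one {σ : ProcessSpace n | Resilient (processGraph σ
    (sInf {m : ℕ | ∀ v, 2 ≤ deg (processGraph σ m) v})) (1 / 2 - ε) IsHam}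
  constructor <;> linarith

end
end RGP
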